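/- For all k, γ > 0, there exists w = w(k,γ) such that every graph G with γ_3(G) ≤ γ and treewidth more than w contains a subdivision of the k-by-k wall W_{k×k} or the line graph of a subdivision of W_{k×k} as an induced subgraph. -/

import Mathlib

open SimpleGraph Set List

namespace Paper

variable {V : Type} {W : Type}

/-- The closed neighborhood `N[v]` of a vertex. -/
def closedNbhd (G : SimpleGraph V) (v : V) : Set V := insert v (G.neighborSet v)

/-- The degree of a vertex (as the number of its neighbors). -/
noncomputable def deg (G : SimpleGraph V) (v : V) : ℕ := (G.neighborSet v).ncard

/-- `G` contains `H` as an induced subgraph, i.e. some induced subgraph of `G` is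
isomorphic to `H`. -/
def ContainsInduced (G : SimpleGraph V) (H : SimpleGraph W) : Prop :=
  ∃ s : Set V, Nonempty (H ≃g G.induce s)

/-- `(A, C, B)` is a separation of `G`. -/
def IsSeparation (G : SimpleGraph V) (A C B : Set V) : Prop :=
  A ∪ C ∪ B = Set.univ ∧ Disjoint A C ∧ Disjoint A B ∧ Disjoint C B ∧
    ∀ a ∈ A, ∀ b ∈ B, ¬G.Adj a b

/-- `G` admits a star cutset. -/
def HasStarCutset (G : SimpleGraph V) : Prop :=
  ∃ A C B : Set V, IsSeparation G A C B ∧ A.Nonempty ∧ B.Nonempty ∧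
    ∃ v ∈ C, C ⊆ closedNbhd G v

/-- `G` admits a clique cutset. -/
def HasCliqueCutset (G : SimpleGraph V) : Prop :=
  ∃ A C B : Set V, IsSeparation G A C B ∧ A.Nonempty ∧ B.Nonempty ∧ G.IsClique C

/-- `D` is a connected component of `G \ X`: a maximal connected subset of `Xᶜ`. -/
def IsComponentOf (G : SimpleGraph V) (X : Set V) (D : Set V) : Prop :=
  D.Nonempty ∧ D ⊆ Xᶜ ∧ (G.induce D).Connected ∧
    ∀ D' : Set V, D ⊆ D' → D' ⊆ Xᶜ → (G.induce D').Connected → D' = D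

/-- An induced path in `G` ("path" in the paper always means induced path). -/
def IsIPath (G : SimpleGraph V) {u v : V} (P : G.Walk u v) : Prop :=
  P.IsPath ∧ P.toSubgraph.IsInduced

/-- A hole: an induced cycle of length at least four. -/
def IsHole (G : SimpleGraph V) {v : V} (c : G.Walk v v) : Prop :=
  c.IsCycle ∧ 4 ≤ c.length ∧ c.toSubgraph.IsInduced

/-- `G` is sparse: for every hole and every vertex not in it, there is an edge `ab` of the
hole containing all neighbors of the vertex in the hole. -/
def Sparse (G : SimpleGraph V) : Prop :=
  ∀ (v : V) (c : G.Walk v v), IsHole G c → ∀ x, x ∉ c.support →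
    ∃ a b, c.toSubgraph.Adj a b ∧ ∀ y ∈ c.support, G.Adj x y → y = a ∨ y = b

/-- `G` contains a pyramid (necessarily as an induced subgraph). -/
def ContainsPyramid (G : SimpleGraph V) : Prop :=
  ∃ (a b₁ b₂ b₃ : V) (P₁ : G.Walk a b₁) (P₂ : G.Walk a b₂) (P₃ : G.Walk a b₃),
    G.Adj b₁ b₂ ∧ G.Adj b₂ b₃ ∧ G.Adj b₁ b₃ ∧
    IsIPath G P₁ ∧ IsIPath G P₂ ∧ IsIPath G P₃ ∧
    1 ≤ P₁.length ∧ 1 ≤ P₂.length ∧ 1 ≤ P₃.length ∧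
    ¬(P₁.length = 1 ∧ P₂.length = 1) ∧ ¬(P₁.length = 1 ∧ P₃.length = 1) ∧
    ¬(P₂.length = 1 ∧ P₃.length = 1) ∧
    (∀ p ∈ P₁.support, p ≠ a → ∀ q ∈ P₂.support, q ≠ a →
      p ≠ q ∧ (G.Adj p q → p = b₁ ∧ q = b₂)) ∧
    (∀ p ∈ P₁.support, p ≠ a → ∀ q ∈ P₃.support, q ≠ a →
      p ≠ q ∧ (G.Adj p q → p = b₁ ∧ q = b₃)) ∧
    (∀ p ∈ P₂.support, p ≠ a → ∀ q ∈ P₃.support, q ≠ a →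
      p ≠ q ∧ (G.Adj p q → p = b₂ ∧ q = b₃))

/-- `G` contains a prism (necessarily as an induced subgraph). -/
def ContainsPrism (G : SimpleGraph V) : Prop :=
  ∃ (a₁ a₂ a₃ b₁ b₂ b₃ : V) (P₁ : G.Walk a₁ b₁) (P₂ : G.Walk a₂ b₂) (P₃ : G.Walk a₃ b₃),
    G.Adj a₁ a₂ ∧ G.Adj a₂ a₃ ∧ G.Adj a₁ a₃ ∧
    G.Adj b₁ b₂ ∧ G.Adj b₂ b₃ ∧ G.Adj b₁ b₃ ∧
    IsIPath G P₁ ∧ IsIPath G P₂ ∧ IsIPath G P₃ ∧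
    1 ≤ P₁.length ∧ 1 ≤ P₂.length ∧ 1 ≤ P₃.length ∧
    (∀ p ∈ P₁.support, ∀ q ∈ P₂.support,
      p ≠ q ∧ (G.Adj p q → (p = a₁ ∧ q = a₂) ∨ (p = b₁ ∧ q = b₂))) ∧
    (∀ p ∈ P₁.support, ∀ q ∈ P₃.support,
      p ≠ q ∧ (G.Adj p q → (p = a₁ ∧ q = a₃) ∨ (p = b₁ ∧ q = b₃))) ∧
    (∀ p ∈ P₂.support, ∀ q ∈ P₃.support,
      p ≠ q ∧ (G.Adj p q → (p = a₂ ∧ q = a₃) ∨ (p = b₂ ∧ q = b₃)))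

/-- `G` is very sparse: sparse, pyramid-free and prism-free. -/
def VerySparse (G : SimpleGraph V) : Prop :=
  Sparse G ∧ ¬ContainsPyramid G ∧ ¬ContainsPrism G

/-- `G ∈ 𝓕_t`: `G` is very sparse with no clique of size at least `t+1`. -/
def MemF (t : ℕ) (G : SimpleGraph V) : Prop :=
  VerySparse G ∧ ∀ s : Set V, G.IsClique s → s.ncard ≤ t

/-- `G` has a tree decomposition of width at most `k`. -/
def HasTreewidthAtMost (G : SimpleGraph V) (k : ℕ) : Prop :=
  ∃ (ι : Type) (T : SimpleGraph ι) (χ : ι → Finset V),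
    T.IsTree ∧
    (∀ v : V, ∃ t, v ∈ χ t) ∧
    (∀ u v : V, G.Adj u v → ∃ t, u ∈ χ t ∧ v ∈ χ t) ∧
    (∀ v : V, (T.induce {t | v ∈ χ t}).Connected) ∧
    ∀ t, (χ t).card ≤ k + 1

/-- The `n`-by-`n` wall, as a brick wall graph: `n` rows of `2n` vertices each,
with horizontal path edges in each row, and vertical edges between consecutive
rows placed alternately. -/
def Wall (n : ℕ) : SimpleGraph (Fin n × Fin (2 * n)) :=
  SimpleGraph.fromRel (fun a b =>
    (a.1 = b.1 ∧ a.2.val + 1 = b.2.val) ∨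
    (a.2 = b.2 ∧ a.1.val + 1 = b.1.val ∧ (a.1.val + a.2.val) % 2 = 0))

/-- The graph obtained from `G` by subdividing the edge `uv` once (the new vertex
is `none`). -/
def subdivideEdge (G : SimpleGraph V) (u v : V) : SimpleGraph (Option V) :=
  SimpleGraph.fromRel (fun a b =>
    (∃ x y : V, a = some x ∧ b = some y ∧ G.Adj x y ∧ ¬(x = u ∧ y = v) ∧ ¬(x = v ∧ y = u)) ∨
    (a = none ∧ (b = some u ∨ b = some v)))

/-- `IsSubdivision G H`: `G` is (isomorphic to) a graph obtained from `H` by repeatedly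
subdividing edges. -/
inductive IsSubdivision : {α : Type} → SimpleGraph α → {β : Type} → SimpleGraph β → Prop where
  | base {α β : Type} {G : SimpleGraph α} {H : SimpleGraph β} :
      Nonempty (G ≃g H) → IsSubdivision G H
  | step {α β : Type} {G : SimpleGraph α} {H : SimpleGraph β} (u v : β) :
      H.Adj u v → IsSubdivision G (subdivideEdge H u v) → IsSubdivision G H

/-- `G` contains a subdivision of the `t`-by-`t` wall as an induced subgraph. -/
def ContainsWallSubdiv (G : SimpleGraph V) (t : ℕ) : Prop :=
  ∃ (α : Type) (S : SimpleGraph α), IsSubdivision S (Wall t) ∧ ContainsInduced G S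

/-- `G` contains the line graph of a subdivision of the `t`-by-`t` wall as an induced
subgraph. -/
def ContainsLineWallSubdiv (G : SimpleGraph V) (t : ℕ) : Prop :=
  ∃ (α : Type) (S : SimpleGraph α), IsSubdivision S (Wall t) ∧
    ContainsInduced G S.lineGraph

/-- `G` is `𝓣₁`-free: no vertex has two or more neighbors in a hole not containing it. -/
def T1Free (G : SimpleGraph V) : Prop :=
  ∀ (v : V) (c : G.Walk v v), IsHole G c → ∀ x, x ∉ c.support →
    ∀ y z, y ∈ c.support → z ∈ c.support → G.Adj x y → G.Adj x z → y = z

/-- `G` is `𝓣₂`-free: no vertex has two non-adjacent neighbors in a hole not containing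
it, and `G` is pyramid-free and prism-free. -/
def T2Free (G : SimpleGraph V) : Prop :=
  (∀ (v : V) (c : G.Walk v v), IsHole G c → ∀ x, x ∉ c.support →
    ∀ y z, y ∈ c.support → z ∈ c.support → G.Adj x y → G.Adj x z → y ≠ z → G.Adj y z) ∧
  ¬ContainsPyramid G ∧ ¬ContainsPrism G

/-- The weight `w(X)` of a set of vertices. -/
noncomputable def setW (w : V → ℝ) (X : Set V) : ℝ := ∑ᶠ x ∈ X, w x

/-- `w` is a weight function on `G`: values in `[0,1]` with total weight `1`. -/
def IsWeightFn (w : V → ℝ) : Prop :=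
  (∀ v, 0 ≤ w v ∧ w v ≤ 1) ∧ setW w Set.univ = 1

/-- `X` is a `(w, c)`-balanced separator. -/
def IsBalSep (G : SimpleGraph V) (w : V → ℝ) (c : ℝ) (X : Set V) : Prop :=
  ∀ D, IsComponentOf G X D → setW w D ≤ c

/-- `(G, w)` is `d`-unbalanced: `w` is a weight function and there is no
`(w, 1/2)`-balanced separator of size at most `d`. -/
def Unbalanced (G : SimpleGraph V) (w : V → ℝ) (d : ℕ) : Prop :=
  IsWeightFn w ∧ ∀ X : Set V, X.ncard ≤ d → ¬IsBalSep G w (1 / 2 : ℝ) X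

/-- `B = B(K₁,K₂)` is the (unique) component of `G ∖ (K₁ ∪ K₂)` of weight more
than `1/2`.  Then `A(K₁,K₂) = (B ∪ K₁ ∪ K₂)ᶜ` and `S(K₁,K₂) = (A, K₁ ∪ K₂, B)` is the
canonical two-clique-separation for `{K₁, K₂}`. -/
def IsCanonicalB (G : SimpleGraph V) (w : V → ℝ) (K₁ K₂ B : Set V) : Prop :=
  IsComponentOf G (K₁ ∪ K₂) B ∧ (1 / 2 : ℝ) < setW w B

/-- The open neighborhood `N(D)` of a set of vertices. -/
def nbhdOfSet (G : SimpleGraph V) (D : Set V) : Set V :=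
  {v | v ∉ D ∧ ∃ d ∈ D, G.Adj v d}

/-- The canonical two-clique-separation `S(K₁,K₂)` (with big side `B`) is proper. -/
def ProperPair (G : SimpleGraph V) (w : V → ℝ) (K₁ K₂ B : Set V) : Prop :=
  IsCanonicalB G w K₁ K₂ B ∧
  (∃ D, IsComponentOf G (K₁ ∪ K₂) D ∧ D ⊆ (B ∪ K₁ ∪ K₂)ᶜ ∧
    K₁ ∪ K₂ ⊆ nbhdOfSet G D) ∧
  (K₁.ncard = 1 → K₂.ncard = 1 →
    ¬∃ (x y : V) (P : G.Walk x y), K₁ = {x} ∧ K₂ = {y} ∧ IsIPath G P ∧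
      {v | v ∈ P.support} = (B ∪ K₁ ∪ K₂)ᶜ ∪ K₁ ∪ K₂)

/-- The canonical two-clique-separation `S(K₁,K₂)` (with big side `B`) is active,
where `K` bounds the size of the cliques considered. -/
def ActivePair (G : SimpleGraph V) (w : V → ℝ) (K : ℕ) (K₁ K₂ B : Set V) : Prop :=
  ProperPair G w K₁ K₂ B ∧
  ∀ K₁' K₂' B' : Set V, G.IsClique K₁' → G.IsClique K₂' →
    K₁'.ncard ≤ K → K₂'.ncard ≤ K → ProperPair G w K₁' K₂' B' →
    K₁ ∪ K₂ ≠ K₁' ∪ K₂' →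
      ¬(B' ∪ K₁' ∪ K₂' ⊂ B ∪ K₁ ∪ K₂) ∧
      (B' ∪ K₁' ∪ K₂' = B ∪ K₁ ∪ K₂ → B' ⊂ B)

/-- The interiors of two paths from `a` to `b` are disjoint and anticomplete. -/
def IntDisjAnti (G : SimpleGraph V) {a b : V} (P Q : G.Walk a b) : Prop :=
  ∀ x ∈ P.support, x ≠ a → x ≠ b → ∀ y ∈ Q.support, y ≠ a → y ≠ b → x ≠ y ∧ ¬G.Adj x y

/-- `Q₁, Q₂, Q₃` form a theta (as an induced subgraph of `G`) with ends `a, b`. -/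
def ThetaCfg (G : SimpleGraph V) {a b : V} (Q₁ Q₂ Q₃ : G.Walk a b) : Prop :=
  ¬G.Adj a b ∧
  IsIPath G Q₁ ∧ IsIPath G Q₂ ∧ IsIPath G Q₃ ∧
  2 ≤ Q₁.length ∧ 2 ≤ Q₂.length ∧ 2 ≤ Q₃.length ∧
  IntDisjAnti G Q₁ Q₂ ∧ IntDisjAnti G Q₁ Q₃ ∧ IntDisjAnti G Q₂ Q₃

/-- There is a theta through the seagull `a-v-u` in `G`: a theta one of whose ends is
`a` or `u` and which contains the seagull. -/
def ThetaThroughSeagull (G : SimpleGraph V) (a v u : V) : Prop :=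
  (∃ (b : V) (Q₁ Q₂ Q₃ : G.Walk a b), ThetaCfg G Q₁ Q₂ Q₃ ∧ [a, v, u] <+: Q₁.support) ∨
  (∃ (b : V) (Q₁ Q₂ Q₃ : G.Walk u b), ThetaCfg G Q₁ Q₂ Q₃ ∧ [u, v, a] <+: Q₁.support)

/-- `a-v-u` is a heavy seagull in `G`: an induced three-vertex path whose ends both
have degree at least three. -/
def HeavySeagull (G : SimpleGraph V) (a v u : V) : Prop :=
  a ≠ u ∧ G.Adj a v ∧ G.Adj v u ∧ ¬G.Adj a u ∧ 3 ≤ deg G a ∧ 3 ≤ deg G u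

end Paper

namespace Paper

def Conn {V : Type} (G : SimpleGraph V) (s : Set V) : Prop :=
  s.Nonempty ∧ ∀ t ⊆ s, t.Nonempty → (∀ x ∈ t, ∀ y ∈ s, G.Adj x y → y ∈ t) → s ⊆ t

def HasBramble {V : Type} (G : SimpleGraph V) (n : ℕ) : Prop :=
  ∃ β : Set (Set V), (∀ b ∈ β, ∀ b' ∈ β, Conn G (b ∪ b')) ∧
    ∀ X : Set V, X.ncard < n → ∃ b ∈ β, Disjoint b X

def HasMinor {V W : Type} (K : SimpleGraph W) (G : SimpleGraph V) : Prop :=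
  ∃ μ : W → Set V, (∀ w, Conn G (μ w)) ∧ (∀ w w', w ≠ w' → Disjoint (μ w) (μ w')) ∧
    ∀ w w', K.Adj w w' → ∃ x ∈ μ w, ∃ y ∈ μ w', G.Adj x y

def Linked {V : Type} (G : SimpleGraph V) (A B : Set V) (k : ℕ) : Prop :=
  ∃ c : Fin k → Set V, (∀ i, Conn G (c i) ∧ (c i ∩ A).Nonempty ∧ (c i ∩ B).Nonempty) ∧
    ∀ i j, i ≠ j → Disjoint (c i) (c j)

def res {V : Type} (G : SimpleGraph V) (U : Set V) : SimpleGraph V where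
  Adj x y := G.Adj x y ∧ x ∈ U ∧ y ∈ U
  symm := ⟨fun _ _ h => ⟨h.1.symm, h.2.2, h.2.1⟩⟩
  loopless := ⟨fun _ h => G.irrefl h.1⟩

def Chn {V : Type} (G : SimpleGraph V) (f : ℕ → V) (n : ℕ) : Prop :=
  ∀ i < n, G.Adj (f i) (f (i + 1))

section
variable {V : Type} {G H : SimpleGraph V} {s t : Set V}

theorem Conn.single (x : V) : Conn G {x} := by
  refine ⟨⟨x, rfl⟩, ?_⟩
  rintro t ht ⟨y, hy⟩ _ z rfl
  have := ht hy
  rw [Set.mem_singleton_iff] at this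
  exact this ▸ hy

theorem Conn.mono (h : Conn G s) (hGH : G ≤ H) : Conn H s :=
  ⟨h.1, fun t ht hn hc => h.2 t ht hn fun x hx y hy hxy => hc x hx y hy (hGH hxy)⟩

theorem Conn.mono' (h : Conn G s) (hGH : ∀ x ∈ s, ∀ y ∈ s, G.Adj x y → H.Adj x y) : Conn H s :=
  ⟨h.1, fun t ht hn hc => h.2 t ht hn fun x hx y hy hxy =>
    hc x hx y hy (hGH x (ht hx) y hy hxy)⟩

theorem Conn.cross (h : Conn G s) {A : Set V} (hA : (s ∩ A).Nonempty) (hn : ¬ s ⊆ A) :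
    ∃ x ∈ s, x ∈ A ∧ ∃ y ∈ s, y ∉ A ∧ G.Adj x y := by
  by_contra hc
  push Not at hc
  refine hn ((h.2 (s ∩ A) Set.inter_subset_left hA ?_).trans Set.inter_subset_right)
  intro x hx y hy hxy
  by_contra h'
  exact hc x hx.1 hx.2 y hy (fun h => h' ⟨hy, h⟩) hxy

theorem Conn.of_pt {x : V} (hx : x ∈ s) (h : ∀ y ∈ s, ∃ t ⊆ s, x ∈ t ∧ y ∈ t ∧ Conn G t) :
    Conn G s := by
  refine ⟨⟨x, hx⟩, fun t ht ⟨z, hz⟩ hc => ?_⟩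
  have key : ∀ u ⊆ s, Conn G u → (u ∩ t).Nonempty → u ⊆ t := by
    intro u hu hcu hne
    by_contra hcon
    obtain ⟨a, ha, hat, b, hb, hbt, hab⟩ := hcu.cross hne hcon
    exact hbt (hc a hat b (hu hb) hab)
  obtain ⟨u, hu, hxu, hzu, hcu⟩ := h z (ht hz)
  have hxt : x ∈ t := key u hu hcu ⟨z, hzu, hz⟩ hxu
  intro y hy
  obtain ⟨u, hu, hxu, hyu, hcu⟩ := h y hy
  exact key u hu hcu ⟨x, hxu, hxt⟩ hyu

theorem Conn.union (hs : Conn G s) (ht : Conn G t) (h : (s ∩ t).Nonempty) : Conn G (s ∪ t) := by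
  obtain ⟨x, hx, hx'⟩ := h
  refine Conn.of_pt (x := x) (Or.inl hx) ?_
  rintro y (hy | hy)
  · exact ⟨s, Set.subset_union_left, hx, hy, hs⟩
  · exact ⟨t, Set.subset_union_right, hx', hy, ht⟩

theorem Conn.pair {x y : V} (h : G.Adj x y) : Conn G {x, y} := by
  refine ⟨⟨x, by simp⟩, ?_⟩
  rintro t ht ⟨z, hz⟩ hc
  have h1 : x ∈ t ∧ y ∈ t := by
    rcases ht hz with rfl | h'
    · exact ⟨hz, hc _ hz y (by simp) h⟩
    · rw [Set.mem_singleton_iff] at h'; subst h'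
      exact ⟨hc _ hz x (by simp) h.symm, hz⟩
  rintro w (rfl | h')
  · exact h1.1
  · rw [Set.mem_singleton_iff] at h'; exact h' ▸ h1.2

theorem Conn.union_adj (hs : Conn G s) (ht : Conn G t) {x y : V} (hx : x ∈ s) (hy : y ∈ t)
    (h : G.Adj x y) : Conn G (s ∪ t) := by
  have h1 := (hs.union (Conn.pair h) ⟨x, hx, by simp⟩).union ht ⟨y, by simp, hy⟩
  convert h1 using 1
  ext z; simp only [Set.mem_union, Set.mem_insert_iff, Set.mem_singleton_iff]
  constructor
  · tauto
  · rintro ((h | rfl | rfl) | h) <;> tauto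

theorem Conn.insert (hs : Conn G s) {x y : V} (hx : x ∈ s) (h : G.Adj x y) :
    Conn G (insert y s) := by
  have := (Conn.single y).union_adj hs rfl hx h.symm
  rwa [Set.singleton_union] at this

theorem Conn.iUnion {ι : Type*} (hs : Conn G s) {f : ι → Set V} (hf : ∀ i, Conn G (f i))
    (h : ∀ i, (f i ∩ s).Nonempty ∨ ∃ x ∈ f i, ∃ y ∈ s, G.Adj x y) : Conn G (s ∪ ⋃ i, f i) := by
  obtain ⟨x, hx⟩ := hs.1
  refine Conn.of_pt (x := x) (Or.inl hx) ?_
  rintro y (hy | hy)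
  · exact ⟨s, Set.subset_union_left, hx, hy, hs⟩
  · obtain ⟨i, hi⟩ := Set.mem_iUnion.1 hy
    refine ⟨s ∪ f i, Set.union_subset_union_right _ (Set.subset_iUnion _ i), Or.inl hx,
      Or.inr hi, ?_⟩
    rcases h i with ⟨z, hz, hz'⟩ | ⟨a, ha, b, hb, hab⟩
    · exact hs.union (hf i) ⟨z, hz', hz⟩
    · exact hs.union_adj (hf i) hb ha hab.symm

/-- component of `x` in `U` -/
def cmp (G : SimpleGraph V) (U : Set V) (x : V) : Set V :=
  {y | ∃ t ⊆ U, x ∈ t ∧ y ∈ t ∧ Conn G t}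

theorem cmp_sub (U : Set V) (x : V) : cmp G U x ⊆ U := fun _ ⟨_, h, _, h', _⟩ => h h'

theorem cmp_self {U : Set V} {x : V} (hx : x ∈ U) : x ∈ cmp G U x :=
  ⟨{x}, by simpa using hx, rfl, rfl, Conn.single x⟩

theorem cmp_conn {U : Set V} {x : V} (hx : x ∈ U) : Conn G (cmp G U x) :=
  Conn.of_pt (cmp_self hx) fun _ ⟨t, h1, h2, h3, h4⟩ =>
    ⟨t, fun _ hz => ⟨t, h1, h2, hz, h4⟩, h2, h3, h4⟩

theorem cmp_max {U : Set V} {x : V} {t : Set V} (ht : Conn G t) (htU : t ⊆ U)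
    (h : (t ∩ cmp G U x).Nonempty) : t ⊆ cmp G U x := by
  obtain ⟨z, hz, u, hu, hxu, hzu, hcu⟩ := h
  exact fun y hy => ⟨u ∪ t, Set.union_subset hu htU, Or.inl hxu, Or.inr hy,
    hcu.union ht ⟨z, hzu, hz⟩⟩

theorem cmp_adj {U : Set V} {x y z : V} (hy : y ∈ cmp G U x) (hz : z ∈ U) (h : G.Adj y z) :
    z ∈ cmp G U x :=
  cmp_max (Conn.pair h) (by
    rintro w (rfl | h')
    · exact cmp_sub _ _ hy
    · rw [Set.mem_singleton_iff] at h'; exact h' ▸ hz) ⟨y, by simp, hy⟩ (by simp)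

theorem Chn.seg {f : ℕ → V} {n : ℕ} (h : Chn G f n) {i j : ℕ} (hij : i ≤ j) (hj : j ≤ n) :
    Conn G (f '' Set.Icc i j) := by
  induction j, hij using Nat.le_induction with
  | base => simpa using Conn.single (f i)
  | succ j hij ih =>
    have := (ih (by omega)).insert (x := f j) (y := f (j + 1)) ⟨j, ⟨hij, le_rfl⟩, rfl⟩ (h j (by omega))
    convert this using 1
    rw [← Set.image_insert_eq]
    congr 1
    ext z; simp only [Set.mem_Icc, Set.mem_insert_iff]; omega

theorem Conn.chn (hs : Conn G s) {a b : V} (ha : a ∈ s) (hb : b ∈ s) :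
    ∃ f n, Chn G f n ∧ f 0 = a ∧ f n = b ∧ ∀ i ≤ n, f i ∈ s := by
  have := hs.2 {b ∈ s | ∃ f n, Chn G f n ∧ f 0 = a ∧ f n = b ∧ ∀ i ≤ n, f i ∈ s}
    (fun x hx => hx.1) ⟨a, ha, fun _ => a, 0, by intro i hi; omega, rfl, rfl, fun _ _ => ha⟩ ?_
  · exact (this hb).2
  rintro x ⟨hx, f, n, h1, h2, h3, h4⟩ y hy hxy
  refine ⟨hy, fun i => if i ≤ n then f i else y, n + 1, ?_, by simpa using h2, by simp, ?_⟩
  · intro i hi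
    by_cases h : i < n
    · simpa [h.le, Nat.succ_le_of_lt h] using h1 i h
    · have : i = n := by omega
      subst this; simpa [h3] using hxy
  · intro i _
    dsimp only
    split_ifs with h
    exacts [h4 i h, hy]

/-- trimmed path -/
structure TP (G : SimpleGraph V) (s A B : Set V) (f : ℕ → V) (n : ℕ) : Prop where
  chn : Chn G f n
  inj : ∀ i ≤ n, ∀ j ≤ n, f i = f j → i = j
  mem : ∀ i ≤ n, f i ∈ s
  fst : f 0 ∈ A
  lst : f n ∈ B
  fst' : ∀ i ≤ n, f i ∈ A → i = 0
  lst' : ∀ i ≤ n, f i ∈ B → i = n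
  ind : ∀ i j, i < j → j ≤ n → G.Adj (f i) (f j) → j = i + 1

theorem Conn.tp (hs : Conn G s) {A B : Set V} (ha : (s ∩ A).Nonempty) (hb : (s ∩ B).Nonempty) :
    ∃ f n, TP G s A B f n := by
  classical
  have hex : ∃ n, ∃ f, Chn G f n ∧ f 0 ∈ A ∧ f n ∈ B ∧ ∀ i ≤ n, f i ∈ s := by
    obtain ⟨a, ha, ha'⟩ := ha
    obtain ⟨b, hb, hb'⟩ := hb
    obtain ⟨f, n, h1, h2, h3, h4⟩ := hs.chn ha hb
    exact ⟨n, f, h1, h2 ▸ ha', h3 ▸ hb', h4⟩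
  obtain ⟨f, hc, hA, hB, hm⟩ := Nat.find_spec hex
  set n := Nat.find hex with hn
  have hmin : ∀ m < n, ∀ f, Chn G f m → f 0 ∈ A → f m ∈ B → (∀ i ≤ m, f i ∈ s) → False :=
    fun m hm f h1 h2 h3 h4 => Nat.find_min hex hm ⟨f, h1, h2, h3, h4⟩
  have cut : ∀ i j, i < j → j ≤ n → G.Adj (f i) (f j) → j = i + 1 := by
    intro i j hij hj hadj
    by_contra hne
    refine hmin (n - (j - i - 1)) (by omega) (fun t => if t ≤ i then f t else f (t + (j - i - 1)))
      ?_ (by simpa using hA) ?_ ?_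
    · intro t ht
      dsimp only
      rcases lt_trichotomy t i with h | h | h
      · rw [if_pos h.le, if_pos (by omega)]; exact hc t (by omega)
      · subst h
        rw [if_pos le_rfl, if_neg (by omega)]
        convert hadj using 2; omega
      · rw [if_neg (by omega), if_neg (by omega)]
        convert hc (t + (j - i - 1)) (by omega) using 2; omega
    · rw [if_neg (by omega)]; convert hB using 2; omega
    · intro t ht
      split_ifs
      exacts [hm _ (by omega), hm _ (by omega)]
  have hl : ∀ i ≤ n, f i ∈ B → i = n := fun i hi h => by
    by_contra hne
    exact hmin i (by omega) f (fun t ht => hc t (by omega)) hA h (fun t ht => hm t (by omega))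
  have hf : ∀ i ≤ n, f i ∈ A → i = 0 := fun i hi h => by
    by_contra hne
    refine hmin (n - i) (by omega) (fun t => f (t + i)) (fun t ht => ?_) (by simpa using h) ?_
      (fun t ht => hm _ (by omega))
    · convert hc (t + i) (by omega) using 2; omega
    · convert hB using 2; omega
  have inj : ∀ i j, i < j → j ≤ n → f i ≠ f j := by
    intro i j hij hj h
    rcases Nat.lt_or_ge j n with h' | h'
    · have := cut i (j + 1) (by omega) (by omega) (h ▸ hc j h'); omega
    · have : j = n := by omega
      subst this
      have := hl i (by omega) (h ▸ hB); omega
  refine ⟨f, n, hc, fun i hi j hj h => ?_, hm, hA, hB, hf, hl, cut⟩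
  rcases lt_trichotomy i j with h' | h' | h'
  · exact absurd h (inj i j h' hj)
  · exact h'
  · exact absurd h.symm (inj j i h' hi)

theorem res_le (G : SimpleGraph V) (U : Set V) : res G U ≤ G := fun _ _ h => h.1

theorem conn_res {U : Set V} (h : Conn G s) (hs : s ⊆ U) : Conn (res G U) s :=
  h.mono' fun _ hx _ hy hxy => ⟨hxy, hs hx, hs hy⟩

theorem Conn.res_sub {U : Set V} (h : Conn (res G U) s) (hm : (s ∩ U).Nonempty) : s ⊆ U := by
  by_contra hc
  obtain ⟨x, _, _, y, _, hy, hxy⟩ := h.cross hm hc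
  exact hy hxy.2.2

theorem Conn.nbr (h : Conn G s) {x : V} (hx : x ∈ s) (h2 : ∃ y ∈ s, y ≠ x) :
    ∃ y ∈ s, G.Adj x y := by
  obtain ⟨y, hy, hyx⟩ := h2
  obtain ⟨a, _, rfl, b, hb, _, hab⟩ := h.cross (A := {x}) ⟨x, hx, rfl⟩ (fun h => hyx (h hy))
  exact ⟨b, hb, hab⟩

theorem HasMinor.mono {W : Type} {K : SimpleGraph W} (h : HasMinor K G) (hGH : G ≤ H) :
    HasMinor K H := by
  obtain ⟨μ, h1, h2, h3⟩ := h
  exact ⟨μ, fun w => (h1 w).mono hGH, h2, fun w w' hw => by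
    obtain ⟨x, hx, y, hy, hxy⟩ := h3 w w' hw
    exact ⟨x, hx, y, hy, hGH hxy⟩⟩

theorem HasMinor.sub {W W' : Type} {K : SimpleGraph W} {K' : SimpleGraph W'} (h : HasMinor K G)
    (φ : W' → W) (hφ : Function.Injective φ) (ha : ∀ a b, K'.Adj a b → K.Adj (φ a) (φ b)) :
    HasMinor K' G := by
  obtain ⟨μ, h1, h2, h3⟩ := h
  exact ⟨fun w => μ (φ w), fun w => h1 _, fun a b hab => h2 _ _ (hφ.ne hab),
    fun a b hab => h3 _ _ (ha a b hab)⟩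

theorem Linked.mono {A B : Set V} {k l : ℕ} (h : Linked G A B k) (hl : l ≤ k) (hGH : G ≤ H) :
    Linked H A B l := by
  obtain ⟨c, h1, h2⟩ := h
  exact ⟨fun i => c (Fin.castLE hl i), fun i => ⟨(h1 _).1.mono hGH, (h1 _).2⟩,
    fun i j hij => h2 _ _ (by simpa [Fin.ext_iff] using hij)⟩

theorem Linked.symm {A B : Set V} {k : ℕ} (h : Linked G A B k) : Linked G B A k := by
  obtain ⟨c, h1, h2⟩ := h
  exact ⟨c, fun i => ⟨(h1 i).1, (h1 i).2.2, (h1 i).2.1⟩, h2⟩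
end
end Paper

namespace Paper
section
variable {V : Type} {G H : SimpleGraph V} {s t : Set V}

theorem Conn.trim (hs : Conn G s) {A S U : Set V} (hA : (s ∩ A).Nonempty) (hS : (s ∩ S).Nonempty)
    (hAU : ∀ v ∈ A, v ∉ S → v ∈ U)
    (hst : ∀ u v, u ∈ U → u ∉ S → G.Adj u v → (v ∉ S → v ∈ U) ∧ H.Adj u v) :
    ∃ s' ⊆ s, Conn H s' ∧ (s' ∩ A).Nonempty ∧ ∃ σ ∈ s', σ ∈ S ∧ (∀ z ∈ s', z ∈ S → z = σ) ∧
      (∀ z ∈ s', z ∉ S → z ∈ U) ∧ ∃ α ∈ s', α ∈ A ∧ ∀ z ∈ s', z ∈ A → z = α := by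
  obtain ⟨f, n, h⟩ := hs.tp hA hS
  have hU : ∀ i < n, f i ∈ U := by
    intro i hi
    induction i with
    | zero => exact hAU _ h.fst fun h' => by have := h.lst' 0 (by omega) h'; omega
    | succ i ih =>
      refine (hst _ _ (ih (by omega)) ?_ (h.chn i (by omega))).1 ?_
      · intro h'; have := h.lst' i (by omega) h'; omega
      · intro h'; have := h.lst' _ (by omega) h'; omega
  have hch : Chn H f n := fun i hi => (hst _ _ (hU i hi) (fun h' => by
    have := h.lst' i (by omega) h'; omega) (h.chn i hi)).2
  refine ⟨f '' Set.Icc 0 n, ?_, hch.seg (Nat.zero_le _) le_rfl, ⟨f 0, ⟨0, by simp, rfl⟩, h.fst⟩,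
    f n, ⟨n, by simp, rfl⟩, h.lst, ?_, ?_, f 0, ⟨0, by simp, rfl⟩, h.fst, ?_⟩
  · rintro _ ⟨i, hi, rfl⟩; exact h.mem i hi.2
  · rintro _ ⟨i, hi, rfl⟩ h'; rw [h.lst' i hi.2 h']
  · rintro _ ⟨i, hi, rfl⟩ h'
    refine hU i (lt_of_le_of_ne hi.2 ?_)
    rintro rfl; exact h' h.lst
  · rintro _ ⟨i, hi, rfl⟩ h'; rw [h.fst' i hi.2 h']

theorem ncard_surj [Finite V] {k : ℕ} {S : Set V} (hS : S.ncard ≤ k) (σ : Fin k → V)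
    (hσ : ∀ i, σ i ∈ S) (hi : Function.Injective σ) {z : V} (hz : z ∈ S) : ∃ i, σ i = z := by
  have h1 : Set.range σ = S := by
    refine Set.eq_of_subset_of_ncard_le (by rintro _ ⟨i, rfl⟩; exact hσ i) ?_
    rw [← Set.image_univ, Set.ncard_image_of_injective _ hi]
    simpa using hS
  rw [← h1] at hz; exact hz

def Seps (G : SimpleGraph V) (A B S : Set V) : Prop :=
  ∀ s, Conn G s → (s ∩ A).Nonempty → (s ∩ B).Nonempty → (s ∩ S).Nonempty

theorem menger [Finite V] (G : SimpleGraph V) : ∀ (A B : Set V) (k : ℕ),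
    (∃ S : Set V, S.ncard < k ∧ Seps G A B S) ∨ Linked G A B k := by
  induction G using WellFoundedLT.induction with
  | ind G IH =>
  intro A B k
  by_cases hE : ∀ x y, ¬ G.Adj x y
  · by_cases hk : (A ∩ B).ncard < k
    · left
      refine ⟨_, hk, fun s hs ⟨x, hx, hxA⟩ ⟨y, hy, hyB⟩ => ?_⟩
      by_cases hxy : y = x
      · exact ⟨x, hx, hxA, hxy ▸ hyB⟩
      · obtain ⟨z, _, hz⟩ := hs.nbr hx ⟨y, hy, hxy⟩
        exact absurd hz (hE _ _)
    · right
      push Not at hk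
      obtain ⟨g⟩ : Nonempty (Fin k ↪ (A ∩ B : Set V)) := by
        have := Fintype.ofFinite (A ∩ B : Set V)
        refine Function.Embedding.nonempty_of_card_le ?_
        rw [Fintype.card_fin, ← Nat.card_eq_fintype_card]; exact hk
      refine ⟨fun i => {(g i : V)}, fun i => ⟨Conn.single _, ⟨g i, rfl, (g i).2.1⟩,
        ⟨g i, rfl, (g i).2.2⟩⟩, fun i j hij => ?_⟩
      rw [Set.disjoint_singleton]
      exact fun h => hij (g.injective (Subtype.ext h))
  push Not at hE
  obtain ⟨x, y, hxy⟩ := hE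
  by_cases hsep : ∃ S : Set V, S.ncard < k ∧ Seps G A B S
  · exact Or.inl hsep
  right
  push Not at hsep
  set G' := G.deleteEdges {s(x, y)} with hG'
  have hle : G' ≤ G := deleteEdges_le _
  have hlt : G' < G := by
    refine lt_of_le_of_ne hle fun h => ?_
    rw [← h, hG', deleteEdges_adj] at hxy
    exact hxy.2 rfl
  rcases IH G' hlt A B k with ⟨S, hSk, hS⟩ | h
  swap
  · exact h.mono le_rfl hle
  obtain ⟨U, hUdef⟩ : ∃ U : Set V, U = {v | ∃ s, Conn G' s ∧ Disjoint s S ∧ v ∈ s ∧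
    (s ∩ A).Nonempty} := ⟨_, rfl⟩
  have hUS : ∀ v ∈ U, v ∉ S := by
    rw [hUdef]
    rintro v ⟨s, _, h, hv, _⟩ hvS; exact Set.disjoint_left.1 h hv hvS
  have hUA : ∀ v ∈ A, v ∉ S → v ∈ U := fun v hv hvS => by
    rw [hUdef]
    exact ⟨{v}, Conn.single v, Set.disjoint_singleton_left.2 hvS, rfl, ⟨v, rfl, hv⟩⟩
  have hUB : ∀ v ∈ B, v ∉ U := fun v hv hvU => by
    rw [hUdef] at hvU
    obtain ⟨s, h1, h2, h3, h4⟩ := hvU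
    obtain ⟨z, hz, hz'⟩ := hS s h1 h4 ⟨v, h3, hv⟩
    exact Set.disjoint_left.1 h2 hz hz'
  have hUst : ∀ u v, u ∈ U → v ∉ S → G'.Adj u v → v ∈ U := by
    intro u v hu hv huv
    rw [hUdef] at hu ⊢
    obtain ⟨s, h1, h2, h3, h4⟩ := hu
    exact ⟨Insert.insert v s, h1.insert h3 huv, Set.disjoint_insert_left.2 ⟨hv, h2⟩, by simp,
      h4.mono (Set.inter_subset_inter_left _ (Set.subset_insert _ _))⟩
  have hcr : ∀ s, Conn G s → (s ∩ A).Nonempty → (s ∩ B).Nonempty → Disjoint s S →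
      ∃ a ∈ s, a ∈ U ∧ ∃ b ∈ s, b ∉ U ∧ G.Adj a b ∧ ¬ G'.Adj a b ∧ b ∉ S := by
    rintro s hs ⟨a, ha, haA⟩ ⟨b, hb, hbB⟩ hd
    obtain ⟨a, ha, haU, b, hb, hbU, hab⟩ := hs.cross (A := U)
      ⟨a, ha, hUA a haA (Set.disjoint_left.1 hd ha)⟩ (fun h => hUB b hbB (h hb))
    have hbS := Set.disjoint_left.1 hd hb
    exact ⟨a, ha, haU, b, hb, hbU, hab, fun h => hbU (hUst a b haU hbS h), hbS⟩
  obtain ⟨s0, hs0, hs0A, hs0B, hs0S⟩ : ∃ s, Conn G s ∧ (s ∩ A).Nonempty ∧ (s ∩ B).Nonempty ∧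
      Disjoint s S := by
    have := hsep S hSk
    unfold Seps at this
    push Not at this
    obtain ⟨s, h1, h2, h3, h4⟩ := this
    exact ⟨s, h1, h2, h3, Set.disjoint_iff_inter_eq_empty.2 h4⟩
  obtain ⟨a, _, haU, b, _, hbU, hab, hab', hbS⟩ := hcr s0 hs0 hs0A hs0B hs0S
  have haS := hUS a haU
  have hE : ∀ u v, G.Adj u v → ¬ G'.Adj u v → (u = a ∧ v = b) ∨ (u = b ∧ v = a) := by
    intro u v h1 h2
    rw [hG', deleteEdges_adj] at h2 hab'
    simp only [h1, hab, true_and, not_not, Set.mem_singleton_iff] at h2 hab'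
    rw [← h2] at hab'
    have := Sym2.eq_iff.1 hab'
    tauto
  have hne : a ≠ b := hab.ne
  have hmeet : ∀ s, Conn G s → (s ∩ A).Nonempty → (s ∩ B).Nonempty →
      (s ∩ (Insert.insert a S)).Nonempty ∧ (s ∩ (Insert.insert b S)).Nonempty := by
    intro s h1 h2 h3
    by_cases hd : Disjoint s S
    · obtain ⟨u, hu, huU, v, hv, hvU, huv, huv', hvS⟩ := hcr s h1 h2 h3 hd
      rcases hE u v huv huv' with ⟨rfl, rfl⟩ | ⟨rfl, rfl⟩
      · exact ⟨⟨u, hu, by simp⟩, ⟨v, hv, by simp⟩⟩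
      · exact absurd huU hbU
    · rw [Set.not_disjoint_iff] at hd
      obtain ⟨z, hz, hz'⟩ := hd
      exact ⟨⟨z, hz, by simp [hz']⟩, ⟨z, hz, by simp [hz']⟩⟩
  have st1 : ∀ u v, u ∈ U → u ∉ Insert.insert a S → G.Adj u v →
      (v ∉ Insert.insert a S → v ∈ U) ∧ G'.Adj u v := by
    intro u v hu hu' huv
    have : G'.Adj u v := by
      by_contra h
      rcases hE u v huv h with ⟨rfl, rfl⟩ | ⟨rfl, rfl⟩
      · simp at hu'
      · exact hbU hu
    exact ⟨fun hv => hUst u v hu (fun h => hv (by simp [h])) this, this⟩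
  have st2 : ∀ u v, u ∈ Uᶜ → u ∉ Insert.insert b S → G.Adj u v →
      (v ∉ Insert.insert b S → v ∈ Uᶜ) ∧ G'.Adj u v := by
    intro u v hu hu' huv
    have : G'.Adj u v := by
      by_contra h
      rcases hE u v huv h with ⟨rfl, rfl⟩ | ⟨rfl, rfl⟩
      · exact hu haU
      · simp at hu'
    exact ⟨fun hv hvU => hu (hUst v u hvU (fun h => hu' (by simp [h])) this.symm), this⟩
  have hA' : ∀ v ∈ A, v ∉ Insert.insert a S → v ∈ U :=
    fun v h1 h2 => hUA v h1 (fun h => h2 (by simp [h]))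
  have hB' : ∀ v ∈ B, v ∉ Insert.insert b S → v ∈ Uᶜ := fun v h1 _ => hUB v h1
  have L1 : Linked G' A (Insert.insert a S) k := by
    refine (IH G' hlt A _ k).resolve_left ?_
    rintro ⟨T, hT, hT'⟩
    refine hsep T hT fun s h1 h2 h3 => ?_
    obtain ⟨s', hs', h4, h5, σ, h6, h7, _⟩ := h1.trim h2 (hmeet s h1 h2 h3).1 hA' st1
    exact (hT' s' h4 h5 ⟨σ, h6, h7⟩).mono (Set.inter_subset_inter_left _ hs')
  have L2 : Linked G' B (Insert.insert b S) k := by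
    refine (IH G' hlt B _ k).resolve_left ?_
    rintro ⟨T, hT, hT'⟩
    refine hsep T hT fun s h1 h2 h3 => ?_
    obtain ⟨s', hs', h4, h5, σ, h6, h7, _⟩ := h1.trim h3 (hmeet s h1 h2 h3).2 hB' st2
    exact (hT' s' h4 h5 ⟨σ, h6, h7⟩).mono (Set.inter_subset_inter_left _ hs')
  obtain ⟨c0, hc0, hcd0⟩ := L1
  obtain ⟨d0, hd0, hdd0⟩ := L2
  have T1 := fun i => (hc0 i).1.trim (hc0 i).2.1 (hc0 i).2.2 hA'
    (fun u v h1 h2 h3 => st1 u v h1 h2 (hle h3))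
  have T2 := fun i => (hd0 i).1.trim (hd0 i).2.1 (hd0 i).2.2 hB'
    (fun u v h1 h2 h3 => st2 u v h1 h2 (hle h3))
  choose c hcs hc hcA σ hσc hσS hσu hcU _ using T1
  choose d hds hd hdB τ hτd hτS hτu hdU _ using T2
  have hσi : Function.Injective σ := fun i j hij => by
    by_contra hne
    exact Set.disjoint_left.1 (hcd0 i j hne) (hcs i (hσc i)) (hcs j (hij ▸ hσc j))
  have hτi : Function.Injective τ := fun i j hij => by
    by_contra hne
    exact Set.disjoint_left.1 (hdd0 i j hne) (hds i (hτd i)) (hds j (hij ▸ hτd j))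
  have hcard : (Insert.insert b S).ncard ≤ k := (Set.ncard_insert_le _ _).trans hSk
  classical
  have hj : ∀ i, ∃ j, τ j = if σ i = a then b else σ i := fun i => by
    refine ncard_surj hcard τ hτS hτi ?_
    split_ifs with h
    · simp
    · have := hσS i
      simp only [Set.mem_insert_iff, h, false_or] at this
      simp [this]
  choose J hJ using hj
  have hint : ∀ i j z, z ∈ c i → z ∈ d j → z = σ i ∧ z = τ j ∧ z ∈ S := by
    intro i j z h1 h2
    by_cases hz : z ∈ S
    · exact ⟨hσu i z h1 (by simp [hz]), hτu j z h2 (by simp [hz]), hz⟩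
    · exfalso
      by_cases hza : z = a
      · exact hdU j z h2 (by simp [hza, hne, haS]) (hza ▸ haU)
      · have h3 := hcU i z h1 (by simp [hza, hz])
        by_cases hzb : z = b
        · exact hbU (hzb ▸ h3)
        · exact hdU j z h2 (by simp [hzb, hz]) h3
  have hJi : ∀ i i', J i = J i' → i = i' := by
    intro i i' h
    have h1 := hJ i
    rw [h, hJ i'] at h1
    have h2 := hσS i
    have h3 := hσS i'
    simp only [Set.mem_insert_iff] at h2 h3
    apply hσi
    split_ifs at h1 with h4 h5 h5
    · rw [h4, h5]
    · rw [← h1] at h2 h5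
      rcases h2 with h | h
      · exact absurd h h5
      · exact absurd h hbS
    · rcases h3 with h | h
      · exact absurd h h4
      · exact absurd (h1 ▸ h) hbS
    · exact h1.symm
  refine ⟨fun i => c i ∪ d (J i), fun i => ⟨?_, (hcA i).mono (by gcongr; simp),
    (hdB (J i)).mono (by gcongr; simp)⟩, fun i i' hii => ?_⟩
  · have h1 := hJ i
    split_ifs at h1 with h
    · exact ((hc i).mono hle).union_adj ((hd _).mono hle) (hσc i) (hτd (J i)) (by rw [h, h1]; exact hab)
    · exact ((hc i).mono hle).union ((hd _).mono hle) ⟨σ i, hσc i, h1 ▸ hτd (J i)⟩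
  · have key : ∀ i i' z, z ∈ c i → z ∈ d (J i') → i = i' := by
      intro i i' z h1 h2
      obtain ⟨h3, h4, h5⟩ := hint i _ z h1 h2
      have h6 := hJ i'
      rw [← h4] at h6
      split_ifs at h6 with h
      · exact absurd (h6 ▸ h5) hbS
      · exact hσi (h3.symm.trans h6)
    rw [Set.disjoint_left]
    rintro z (h1 | h1) (h2 | h2)
    · exact Set.disjoint_left.1 (hcd0 i i' hii) (hcs i h1) (hcs i' h2)
    · exact hii (key _ _ _ h1 h2)
    · exact hii (key _ _ _ h2 h1).symm
    · exact Set.disjoint_left.1 (hdd0 _ _ (fun h => hii (hJi _ _ h))) (hds _ h1) (hds _ h2)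
end
end Paper

namespace Paper
section
variable {V W : Type} {G H : SimpleGraph V} {s t : Set V}

theorem Conn.image {K : SimpleGraph W} (hs : Conn G s) (f : V → W)
    (hf : ∀ x ∈ s, ∀ y ∈ s, G.Adj x y → f x = f y ∨ K.Adj (f x) (f y)) : Conn K (f '' s) := by
  refine ⟨hs.1.image f, fun t ht ⟨z, hz⟩ hc => ?_⟩
  obtain ⟨x, hx, rfl⟩ := ht hz
  have := hs.2 (s ∩ f ⁻¹' t) Set.inter_subset_left ⟨x, hx, hz⟩ (fun a ha b hb hab => ⟨hb, by
    rcases hf a ha.1 b hb hab with h | h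
    · exact (h ▸ ha.2 : f b ∈ t)
    · exact hc _ ha.2 _ ⟨b, hb, rfl⟩ h⟩)
  rintro _ ⟨y, hy, rfl⟩
  exact (this hy).2

theorem Conn.induce (hs : Conn G s) : (G.induce s).Connected := by
  obtain ⟨x, hx⟩ := hs.1
  have := hs.2 {y | ∃ h : y ∈ s, (G.induce s).Reachable ⟨x, hx⟩ ⟨y, h⟩} (fun y hy => hy.1)
    ⟨x, hx, Reachable.refl _⟩ (fun a ⟨ha, h⟩ b hb hab => ⟨hb, h.trans (Adj.reachable hab)⟩)
  rw [connected_iff_exists_forall_reachable]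
  exact ⟨⟨x, hx⟩, fun ⟨y, hy⟩ => (this hy).2⟩

theorem reach_map {K : SimpleGraph W} (f : V → W)
    (hf : ∀ x y, G.Adj x y → f x = f y ∨ K.Adj (f x) (f y)) {a b : V} (h : G.Reachable a b) :
    K.Reachable (f a) (f b) := by
  obtain ⟨p⟩ := h
  induction p with
  | nil => rfl
  | cons h _ ih =>
    rcases hf _ _ h with h' | h'
    · rw [h']; exact ih
    · exact h'.reachable.trans ih

theorem acyclic_sum {K : SimpleGraph W} (hG : G.IsAcyclic) (hK : K.IsAcyclic) (r : V) (q : W) :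
    (G ⊕g K).IsAcyclic := by
  rw [isAcyclic_iff_forall_adj_isBridge] at *
  rintro (a | a) (b | b) hab
  · rw [sum_adj_inl] at hab
    intro h
    refine hG hab ?_
    refine reach_map (Sum.elim id fun _ => r) ?_ h
    rintro (x | x) (y | y) hxy
    · right
      rw [deleteEdges_adj] at *
      simpa using hxy
    · simp at hxy
    · simp at hxy
    · simp
  · simp at hab
  · simp at hab
  · rw [sum_adj_inr] at hab
    intro h
    refine hK hab ?_
    refine reach_map (Sum.elim (fun _ => q) id) ?_ h
    rintro (x | x) (y | y) hxy
    · simp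
    · simp at hxy
    · simp at hxy
    · right
      rw [deleteEdges_adj] at *
      simpa using hxy

def TDec (G : SimpleGraph V) (A Z : Set V) (r : ℕ) : Prop :=
  ∃ (ι : Type) (T : SimpleGraph ι) (χ : ι → Set V) (t0 : ι), T.IsTree ∧ (∀ t, χ t ⊆ A) ∧
    Z ⊆ χ t0 ∧ (∀ u ∈ A, ∀ v ∈ A, G.Adj u v → ∃ t, u ∈ χ t ∧ v ∈ χ t) ∧
    (∀ v ∈ A, Conn T {t | v ∈ χ t}) ∧ ∀ t, (χ t).ncard ≤ r

theorem td_single {A : Set V} {r : ℕ} (h : A.ncard ≤ r) : TDec G A A r :=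
  ⟨Unit, ⊥, fun _ => A, (), IsTree.of_subsingleton, fun _ => le_rfl, le_rfl,
    fun u hu v hv _ => ⟨(), hu, hv⟩, fun v hv => by
      have : {t : Unit | v ∈ A} = {()} := by ext; simp [hv]
      rw [this]; exact Conn.single _, fun _ => h⟩

theorem td_glue {A₁ A₂ Z₁ Z₂ : Set V} {r : ℕ} (h₁ : TDec G A₁ Z₁ r) (h₂ : TDec G A₂ Z₂ r)
    (hA : A₁ ∩ A₂ ⊆ Z₁ ∩ Z₂) (hE : ∀ u ∈ A₁, ∀ v ∈ A₂, G.Adj u v → u ∈ A₂ ∨ v ∈ A₁) :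
    TDec G (A₁ ∪ A₂) Z₁ r := by
  obtain ⟨ι, T, χ, t, a1, a2, a3, a4, a5, a6⟩ := h₁
  obtain ⟨ι', T', χ', t', b1, b2, b3, b4, b5, b6⟩ := h₂
  refine ⟨ι ⊕ ι', (T ⊕g T') ⊔ edge (Sum.inl t) (Sum.inr t'), Sum.elim χ χ', Sum.inl t,
    ⟨Connected.sum_sup_edge a1.1 b1.1, IsAcyclic.sup_edge_of_not_reachable
      (not_reachable_sum_inl_inr _ _) (acyclic_sum a1.2 b1.2 t t')⟩, ?_, a3, ?_, ?_, ?_⟩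
  · rintro (i | i)
    · exact (a2 i).trans Set.subset_union_left
    · exact (b2 i).trans Set.subset_union_right
  · have L : ∀ u ∈ A₁, ∀ v ∈ A₁, G.Adj u v →
        ∃ t, u ∈ (Sum.elim χ χ' t : Set V) ∧ v ∈ (Sum.elim χ χ' t : Set V) := by
      intro u hu v hv h
      obtain ⟨i, hi⟩ := a4 u hu v hv h
      exact ⟨Sum.inl i, hi⟩
    have R : ∀ u ∈ A₂, ∀ v ∈ A₂, G.Adj u v →
        ∃ t, u ∈ (Sum.elim χ χ' t : Set V) ∧ v ∈ (Sum.elim χ χ' t : Set V) := by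
      intro u hu v hv h
      obtain ⟨i, hi⟩ := b4 u hu v hv h
      exact ⟨Sum.inr i, hi⟩
    rintro u (hu | hu) v (hv | hv) huv
    · exact L u hu v hv huv
    · rcases hE u hu v hv huv with h | h
      · exact R u h v hv huv
      · exact L u hu v h huv
    · rcases hE v hv u hu huv.symm with h | h
      · exact R u hu v h huv
      · exact L u h v hv huv
    · exact R u hu v hv huv
  · intro v hv
    have hs : {t | v ∈ (Sum.elim χ χ' t : Set V)} =
        Sum.inl '' {t | v ∈ χ t} ∪ Sum.inr '' {t | v ∈ χ' t} := by
      ext (i | i) <;> simp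
    have C1 : v ∈ A₁ → Conn ((T ⊕g T') ⊔ edge (Sum.inl t) (Sum.inr t')) (Sum.inl '' {t | v ∈ χ t}) :=
      fun h => (a5 v h).image _ fun x _ y _ hxy => Or.inr (Or.inl (by simpa using hxy))
    have C2 : v ∈ A₂ → Conn ((T ⊕g T') ⊔ edge (Sum.inl t) (Sum.inr t')) (Sum.inr '' {t | v ∈ χ' t}) :=
      fun h => (b5 v h).image _ fun x _ y _ hxy => Or.inr (Or.inl (by simpa using hxy))
    rw [hs]
    by_cases h1 : v ∈ A₁ <;> by_cases h2 : v ∈ A₂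
    · have h3 := hA ⟨h1, h2⟩
      exact (C1 h1).union_adj (C2 h2) ⟨t, a3 h3.1, rfl⟩ ⟨t', b3 h3.2, rfl⟩
        (Or.inr (by rw [edge_adj]; simp))
    · have : {t | v ∈ χ' t} = ∅ := by
        ext i; simpa using fun h => h2 (b2 i h)
      rw [this, Set.image_empty, Set.union_empty]; exact C1 h1
    · have : {t | v ∈ χ t} = ∅ := by
        ext i; simpa using fun h => h1 (a2 i h)
      rw [this, Set.image_empty, Set.empty_union]; exact C2 h2
    · exact absurd hv (by simp [h1, h2])
  · rintro (i | i)
    · exact a6 i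
    · exact b6 i

theorem TDec.mono {A Z Z' : Set V} {r : ℕ} (h : TDec G A Z r) (hZ : Z' ⊆ Z) : TDec G A Z' r := by
  obtain ⟨ι, T, χ, t, a1, a2, a3, a4⟩ := h
  exact ⟨ι, T, χ, t, a1, a2, hZ.trans a3, a4⟩

/-- neighbourhood of a set -/
def Nb (G : SimpleGraph V) (C : Set V) : Set V := {v | v ∉ C ∧ ∃ c ∈ C, G.Adj c v}

theorem td_main [Finite V] {n : ℕ} (hB : ¬ HasBramble G n) : ∀ (m : ℕ) (U Z : Set V), U.ncard ≤ m →
    Disjoint U Z → Z.ncard ≤ 2 * n → Nb G U ⊆ Z → TDec G (U ∪ Z) Z (3 * n + 1) := by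
  intro m
  induction m with
  | zero =>
    intro U Z hU _ hZ _
    have : U = ∅ := (Set.ncard_eq_zero (Set.toFinite _)).1 (by omega)
    rw [this, Set.empty_union]
    exact td_single (by omega)
  | succ m ih =>
    intro U Z hU hUZ hZ hN
    rcases U.eq_empty_or_nonempty with rfl | ⟨u, hu⟩
    · rw [Set.empty_union]
      exact td_single (by omega)
    have hdec := hB
    unfold HasBramble at hdec
    push Not at hdec
    obtain ⟨X, hXn, hX⟩ := hdec {b | Conn G b ∧ (Insert.insert u Z).ncard < 2 * (b ∩ (Insert.insert u Z)).ncard} (by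
      rintro b ⟨hb, hb'⟩ c ⟨hc, hc'⟩
      refine hb.union hc ?_
      by_contra hne
      rw [Set.not_nonempty_iff_eq_empty] at hne
      have h1 : Disjoint (b ∩ Insert.insert u Z) (c ∩ Insert.insert u Z) := by
        rw [Set.disjoint_left]
        intro z hz hz'
        exact (hne ▸ ⟨hz.1, hz'.1⟩ : z ∈ (∅ : Set V))
      have h2 := Set.ncard_union_eq h1 (Set.toFinite _) (Set.toFinite _)
      have h3 := Set.ncard_le_ncard (Set.union_subset (Set.inter_subset_right : b ∩ Insert.insert u Z ⊆ _)
        (Set.inter_subset_right : c ∩ Insert.insert u Z ⊆ _)) (Set.toFinite _)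
      omega)
    set Zp := Insert.insert u Z with hZp
    have hZpc : Zp.ncard ≤ 2 * n + 1 := (Set.ncard_insert_le _ _).trans (by omega)
    set R := Zp ∪ (X ∩ U) with hR
    have hRc : R.ncard ≤ 3 * n := by
      rw [hR]
      have h1 := Set.ncard_union_le Zp (X ∩ U)
      have h2 := Set.ncard_le_ncard (Set.inter_subset_left : X ∩ U ⊆ X) (Set.toFinite _)
      omega
    have hcl : ∀ x ∈ U \ R, TDec G (cmp G (U \ R) x ∪ Nb G (cmp G (U \ R) x))
        (Nb G (cmp G (U \ R) x)) (3 * n + 1) ∧ Nb G (cmp G (U \ R) x) ⊆ R := by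
      intro x hx
      set C := cmp G (U \ R) x with hC
      have hCU : C ⊆ U \ R := cmp_sub _ _
      have hNR : Nb G C ⊆ R := by
        rintro v ⟨hv, c, hc, hcv⟩
        by_contra hvR
        by_cases hvU : v ∈ U
        · exact hv (cmp_adj hc ⟨hvU, hvR⟩ hcv)
        · exact hvR (Or.inl (Or.inr (hN ⟨hvU, c, (hCU hc).1, hcv⟩)))
      refine ⟨ih C _ ?_ ?_ ?_ le_rfl, hNR⟩
      · have : C ⊂ U := by
          refine ⟨fun z hz => (hCU hz).1, fun h => (hCU (h hu)).2 ?_⟩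
          exact Or.inl (Or.inl rfl)
        have := Set.ncard_lt_ncard this (Set.toFinite _)
        omega
      · rw [Set.disjoint_right]; exact fun z hz => hz.1
      · have hb : Conn G (C ∪ ⋃ v : ↥((Nb G C ∩ Zp) \ X), {(v : V)}) := by
          refine (cmp_conn hx).iUnion (fun _ => Conn.single _) fun v => Or.inr ?_
          obtain ⟨c, hc, hcv⟩ := v.2.1.1.2
          exact ⟨v, rfl, c, hc, hcv.symm⟩
        rw [Set.iUnion_coe_set, Set.biUnion_of_singleton] at hb
        have h1 : ¬ Zp.ncard < 2 * ((C ∪ ((Nb G C ∩ Zp) \ X)) ∩ Zp).ncard := by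
          intro h
          refine hX _ ⟨hb, h⟩ ?_
          rw [Set.disjoint_left]
          rintro z (hz | hz) hzX
          · exact (hCU hz).2 (Or.inr ⟨hzX, (hCU hz).1⟩)
          · exact hz.2 hzX
        have h2 : ((Nb G C ∩ Zp) \ X).ncard ≤ ((C ∪ ((Nb G C ∩ Zp) \ X)) ∩ Zp).ncard :=
          Set.ncard_le_ncard (fun z hz => ⟨Or.inr hz, hz.1.2⟩) (Set.toFinite _)
        have h3 : (Nb G C).ncard ≤ (((Nb G C ∩ Zp) \ X) ∪ X).ncard := by
          refine Set.ncard_le_ncard (fun z hz => ?_) (Set.toFinite _)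
          by_cases h : z ∈ X
          · exact Or.inr h
          · rcases hNR hz with h' | h'
            · exact Or.inl ⟨⟨hz, h'⟩, h⟩
            · exact Or.inr h'.1
        have h4 := Set.ncard_union_le ((Nb G C ∩ Zp) \ X) X
        omega
    have hD : ∀ (d : ℕ) (D : Set V), D.ncard ≤ d → D ⊆ U \ R →
        (∀ x ∈ D, ∀ y ∈ U \ R, G.Adj x y → y ∈ D) → TDec G (R ∪ D) R (3 * n + 1) := by
      intro d
      induction d with
      | zero =>
        intro D hD _ _
        have : D = ∅ := (Set.ncard_eq_zero (Set.toFinite _)).1 (by omega)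
        rw [this, Set.union_empty]
        exact td_single (by omega)
      | succ d ihd =>
        intro D hDc hDU hDcl
        rcases D.eq_empty_or_nonempty with rfl | ⟨x, hx⟩
        · rw [Set.union_empty]
          exact td_single (by omega)
        have hxU := hDU hx
        obtain ⟨h1, h2⟩ := hcl x hxU
        have hxC : x ∈ cmp G (U \ R) x := cmp_self hxU
        have hCcon : Conn G (cmp G (U \ R) x) := cmp_conn hxU
        have hCU : cmp G (U \ R) x ⊆ U \ R := cmp_sub _ _
        have hCadj : ∀ y ∈ cmp G (U \ R) x, ∀ z ∈ U \ R, G.Adj y z → z ∈ cmp G (U \ R) x :=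
          fun y hy z hz h => cmp_adj hy hz h
        set C := cmp G (U \ R) x with hC
        have hCD : C ⊆ D := by
          by_contra hnot
          obtain ⟨a, ha, haD, b, hb, hbD, hab⟩ := hCcon.cross (A := D) ⟨x, hxC, hx⟩ hnot
          exact hbD (hDcl a haD b (hCU hb) hab)
        have h3 := ihd (D \ C) (by
          have : (D \ C) ⊂ D := ⟨Set.sdiff_subset, fun h => (h hx).2 hxC⟩
          have := Set.ncard_lt_ncard this (Set.toFinite _)
          omega) (fun z hz => hDU hz.1) (fun a ha b hb hab => ⟨hDcl a ha.1 b hb hab, fun hbC =>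
            ha.2 (hCadj b hbC a (hDU ha.1) hab.symm)⟩)
        have h4 := td_glue h3 h1 (by
          rintro z ⟨hz1, hz2⟩
          have : z ∈ Nb G C := by
            rcases hz2 with h | h
            · rcases hz1 with h' | h'
              · exact absurd h' (hCU h).2
              · exact absurd h h'.2
            · exact h
          exact ⟨h2 this, this⟩) (by
          rintro a ha b (hb | hb) hab
          · left
            by_cases haC : a ∈ C
            · exact Or.inl haC
            · exact Or.inr ⟨haC, b, hb, hab.symm⟩
          · exact Or.inr (Or.inl (h2 hb)))
        convert h4 using 1
        ext z
        simp only [Set.mem_union, Set.mem_sdiff]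
        constructor
        · rintro (h | h)
          · tauto
          · by_cases hzC : z ∈ C <;> tauto
        · rintro ((h | h) | (h | h))
          · tauto
          · tauto
          · exact Or.inr (hCD h)
          · exact Or.inl (h2 h)
    have := (hD _ (U \ R) le_rfl le_rfl (fun x _ y hy _ => hy)).mono
      (Z' := Z) (fun z hz => Or.inl (Or.inr hz))
    convert this using 1
    ext z
    simp only [hR, hZp, Set.mem_union, Set.mem_sdiff, Set.mem_insert_iff, Set.mem_inter_iff]
    constructor
    · tauto
    · rintro ((((rfl | h) | h)) | h)
      · exact Or.inl hu
      all_goals tauto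

theorem tw_bramble [Finite V] {n : ℕ} (h : ¬ HasTreewidthAtMost G (3 * n)) : HasBramble G n := by
  by_contra hB
  obtain ⟨ι, T, χ, t, a1, a2, a3, a4, a5, a6⟩ := td_main hB _ Set.univ ∅ le_rfl
    (by simp) (by simp) (fun z hz => absurd (Set.mem_univ z) hz.1)
  rw [Set.union_empty] at *
  refine h ⟨ι, T, fun t => (Set.toFinite (χ t)).toFinset, a1, fun v => ?_, fun u v huv => ?_, ?_, ?_⟩
  · obtain ⟨t, ht⟩ := (a5 v trivial).1
    exact ⟨t, by simpa using ht⟩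
  · simpa using a4 u trivial v trivial huv
  · intro v
    have e : {t | v ∈ (Set.toFinite (χ t)).toFinset} = {t | v ∈ χ t} := by ext; simp
    rw [e]; exact (a5 v trivial).induce
  · intro t
    rw [← Set.ncard_eq_toFinset_card _ (Set.toFinite _)]
    exact a6 t
end
end Paper

namespace Paper
section
variable {V W : Type} {G H : SimpleGraph V} {s t : Set V}

theorem bramble_path [Finite V] {β : Set (Set V)} (hβ : ∀ b ∈ β, ∀ b' ∈ β, Conn G (b ∪ b'))
    (hne : β.Nonempty) : ∃ (f : ℕ → V) (N : ℕ), Chn G f N ∧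
      (∀ i ≤ N, ∀ j ≤ N, f i = f j → i = j) ∧ ∀ b ∈ β, ∃ i ≤ N, f i ∈ b := by
  classical
  have hbc : ∀ b ∈ β, Conn G b := fun b hb => by simpa using hβ b hb b hb
  let Q : ℕ → Prop := fun N => ∃ f, Chn G f N ∧ (∀ i ≤ N, ∀ j ≤ N, f i = f j → i = j) ∧
    ∃ b ∈ β, f N ∈ b ∧ ∀ i ≤ N, f i ∈ b → i = N
  have h0 : Q 0 := by
    obtain ⟨b, hb⟩ := hne
    obtain ⟨x, hx⟩ := (hbc b hb).1
    exact ⟨fun _ => x, fun i hi => by omega, fun i hi j hj _ => by omega, b, hb, hx,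
      fun i hi _ => by omega⟩
  have hbd : ∀ N, Q N → N ≤ Nat.card V := by
    rintro N ⟨f, _, h, _⟩
    have := Nat.card_le_card_of_injective (fun i : Fin N => f i) (fun i j hij =>
      Fin.ext (h i i.2.le j j.2.le hij))
    simpa using this
  obtain ⟨f, hc, hi, b, hb, hbN, hbu⟩ := Nat.findGreatest_spec (P := Q) (Nat.zero_le (Nat.card V)) h0
  set N := Nat.findGreatest Q (Nat.card V) with hN
  have hmax : ∀ M, Q M → M ≤ N := fun M hM => Nat.le_findGreatest (hbd M hM) hM
  refine ⟨f, N, hc, hi, fun b' hb' => ?_⟩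
  by_contra hno
  push Not at hno
  obtain ⟨g, M, h⟩ := (hβ b hb b' hb').tp (A := {f N}) (B := b') ⟨f N, Or.inl hbN, rfl⟩
    (by obtain ⟨x, hx⟩ := (hbc b' hb').1; exact ⟨x, Or.inr hx, hx⟩)
  have hg0 : g 0 = f N := h.fst
  have hM : M ≠ 0 := by rintro rfl; exact hno N le_rfl (hg0 ▸ h.lst)
  have hfg : ∀ i ≤ N, ∀ j, 1 ≤ j → j ≤ M → f i ≠ g j := by
    intro i hi' j hj hjM he
    rcases h.mem j hjM with h' | h'
    · have := hbu i hi' (he ▸ h')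
      subst this
      have := h.fst' j hjM he.symm
      omega
    · exact hno i hi' (he ▸ h')
  have := hmax (N + M) ⟨fun i => if i ≤ N then f i else g (i - N), ?_, ?_, b', hb', ?_, ?_⟩
  · omega
  · intro i hi'
    beta_reduce
    rcases lt_trichotomy i N with h' | h' | h'
    · rw [if_pos h'.le, if_pos (by omega)]; exact hc i h'
    · subst h'
      rw [if_pos le_rfl, if_neg (by omega), ← hg0]
      convert h.chn 0 (by omega) using 2; omega
    · rw [if_neg (by omega), if_neg (by omega)]
      convert h.chn (i - N) (by omega) using 2; omega
  · intro i hi' j hj' he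
    beta_reduce at he
    split_ifs at he with h1 h2 h2
    · exact hi i h1 j h2 he
    · exact absurd he (hfg i h1 _ (by omega) (by omega))
    · exact absurd he.symm (hfg j h2 _ (by omega) (by omega))
    · have := h.inj _ (by omega) _ (by omega) he; omega
  · beta_reduce
    rw [if_neg (by omega)]; convert h.lst using 2; omega
  · intro i hi' he
    beta_reduce at he
    split_ifs at he with h1
    · exact absurd he (hno i h1)
    · have := h.lst' _ (by omega) he; omega

theorem mesh [Finite V] {n : ℕ} (m k : ℕ) (hm : 2 ≤ m) (hk : 1 ≤ k) (hB : HasBramble G n)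
    (hn : 2 * (m * k) + k ≤ n) : ∃ (K : Set V) (A : Fin m → Set V), (∀ i, Conn G (A i)) ∧
      (∀ i, Disjoint (A i) K) ∧ (∀ i j, i ≠ j → Disjoint (A i) (A j)) ∧
      ∀ i j, i ≠ j → (∃ x ∈ A i, ∃ y ∈ A j, G.Adj x y) ∨
        Linked (res G K) (Nb G (A i) ∩ K) (Nb G (A j) ∩ K) k := by
  classical
  obtain ⟨β, hβ, hord⟩ := hB
  have hmk : 2 ≤ m * k := by nlinarith
  have hbc : ∀ b ∈ β, Conn G b := fun b hb => by simpa using hβ b hb b hb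
  obtain ⟨f, N, hch, hinj, hhit⟩ := bramble_path hβ (by
    obtain ⟨b, hb, _⟩ := hord ∅ (by simp; omega)
    exact ⟨b, hb⟩)
  let Sp : Set V → ℕ → Prop := fun Y j => ∀ s, Conn G s → Disjoint s Y →
    (s ∩ f '' Set.Iic j).Nonempty → ∀ b ∈ β, Disjoint b Y → Disjoint s b
  have hex : ∃ j, ∀ Y : Set V, Y.ncard < m * k → ¬ Sp Y j := by
    refine ⟨N, fun Y hY hS => ?_⟩
    obtain ⟨b, hb, hbY⟩ := hord Y (by omega)
    obtain ⟨i, hi, hib⟩ := hhit b hb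
    have := hS b (hbc b hb) hbY ⟨f i, hib, i, hi, rfl⟩ b hb hbY
    exact Set.disjoint_left.1 this hib hib
  have hjN : Nat.find hex ≤ N := Nat.find_min' hex (by
    intro Y hY hS
    obtain ⟨b, hb, hbY⟩ := hord Y (by omega)
    obtain ⟨i, hi, hib⟩ := hhit b hb
    have := hS b (hbc b hb) hbY ⟨f i, hib, i, hi, rfl⟩ b hb hbY
    exact Set.disjoint_left.1 this hib hib)
  have hmin := Nat.find_spec hex
  obtain ⟨X, hXc, hXS⟩ : ∃ X : Set V, X.ncard = m * k ∧ Sp X (Nat.find hex) := by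
    have hj0 : Nat.find hex ≠ 0 := by
      intro h0
      refine hmin {f 0} (by simp; omega) ?_
      rw [h0]
      rintro s _ hd ⟨_, hx, i, hi, rfl⟩
      have : i = 0 := by simpa using hi
      subst this
      exact absurd rfl (Set.disjoint_left.1 hd hx)
    have h1 := Nat.find_min hex (Nat.pred_lt hj0)
    push Not at h1
    obtain ⟨Y, hY, hYS⟩ := h1
    have h2 : Sp (Insert.insert (f (Nat.find hex)) Y) (Nat.find hex) := by
      rintro s hs hd ⟨_, hx, i, hi, rfl⟩ b hb hbd
      rw [Set.disjoint_insert_right] at hd hbd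
      refine hYS s hs hd.2 ⟨f i, hx, i, ?_, rfl⟩ b hb hbd.2
      have : i ≠ Nat.find hex := by rintro rfl; exact hd.1 hx
      simp only [Set.mem_Iic, Nat.pred_eq_sub_one] at hi ⊢; omega
    refine ⟨_, le_antisymm ((Set.ncard_insert_le _ _).trans hY) ?_, h2⟩
    by_contra hlt
    exact hmin _ (by omega) h2
  generalize Nat.find hex = j0 at *
  obtain ⟨b0, hb0, hb0X⟩ := hord X (by omega)
  obtain ⟨x0, hx0⟩ := (hbc b0 hb0).1
  have hx0X : x0 ∈ Xᶜ := Set.disjoint_left.1 hb0X hx0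
  obtain ⟨K, hK⟩ : ∃ K, K = cmp G Xᶜ x0 := ⟨_, rfl⟩
  have hKc : Conn G K := hK ▸ cmp_conn hx0X
  have hKX : ∀ v ∈ K, v ∉ X := fun v hv => by rw [hK] at hv; exact cmp_sub _ _ hv
  have hKadj : ∀ u v, u ∈ K → v ∉ X → G.Adj u v → v ∈ K := fun u v hu hv h => by
    rw [hK] at hu ⊢; exact cmp_adj hu hv h
  have hb0K : b0 ⊆ K := by
    rw [hK]; exact cmp_max (hbc b0 hb0) (fun z hz => Set.disjoint_left.1 hb0X hz)
      ⟨x0, hx0, cmp_self hx0X⟩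
  have hbK : ∀ b ∈ β, Disjoint b X → b ⊆ K := by
    intro b hb hbX
    have : b ∪ b0 ⊆ K := by
      rw [hK]
      exact cmp_max (hβ b hb b0 hb0) (by
        rintro z (hz | hz)
        · exact Set.disjoint_left.1 hbX hz
        · exact Set.disjoint_left.1 hb0X hz) ⟨x0, Or.inr hx0, cmp_self hx0X⟩
    exact Set.subset_union_left.trans this
  set A0 := f '' Set.Iic j0 with hA0
  have hAK : ∀ v ∈ A0, v ∉ K := fun v hv hvK => by
    have := hXS K hKc (Set.disjoint_left.2 hKX) ⟨v, hvK, hv⟩ b0 hb0 hb0X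
    exact Set.disjoint_left.1 this (hb0K hx0) hx0
  -- generic: replacing a bramble-reaching set
  have hreach : ∀ Y : Set V, (¬ Sp Y j0) → ∀ Y' : Set V, Y'.ncard + (m * k) < n → Y' = Y →
      ∃ s b, Conn G s ∧ Disjoint s Y ∧ (s ∩ A0).Nonempty ∧ (s ∩ X).Nonempty ∧
        b ∈ β ∧ b ⊆ s ∧ b ⊆ K := by
    intro Y hY Y' hc hYY
    subst hYY
    simp only [Sp] at hY
    push Not at hY
    obtain ⟨s, hs, hsY, hsA, b, hb, hbY, hsb⟩ := hY
    obtain ⟨b', hb', hbd'⟩ := hord (Y' ∪ X) (by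
      have := Set.ncard_union_le Y' X; omega)
    rw [Set.disjoint_union_right] at hbd'
    rw [Set.not_disjoint_iff] at hsb
    have hc1 : Conn G (s ∪ (b ∪ b')) := hs.union (hβ b hb b' hb') (by
      obtain ⟨z, h1, h2⟩ := hsb; exact ⟨z, h1, Or.inl h2⟩)
    have hmA : ((s ∪ (b ∪ b')) ∩ A0).Nonempty := hsA.mono (by gcongr; simp)
    refine ⟨s ∪ (b ∪ b'), b', hc1, ?_, hmA, ?_, hb',
      fun z hz => Or.inr (Or.inr hz), hbK b' hb' hbd'.2⟩
    · rw [Set.disjoint_union_left, Set.disjoint_union_left]; exact ⟨hsY, hbY, hbd'.1⟩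
    · by_contra hno
      rw [Set.not_nonempty_iff_eq_empty, ← Set.disjoint_iff_inter_eq_empty] at hno
      have := hXS _ hc1 hno hmA b' hb' hbd'.2
      obtain ⟨z, hz⟩ := (hbc b' hb').1
      exact Set.disjoint_left.1 this (Or.inr (Or.inr hz)) hz
  have hL : Linked G A0 X (m * k) := by
    refine (menger G A0 X (m * k)).resolve_left ?_
    rintro ⟨S, hSc, hS⟩
    obtain ⟨s, b, h1, h2, h3, h4, _⟩ := hreach S (hmin S hSc) S (by omega) rfl
    obtain ⟨z, hz, hz'⟩ := hS s h1 h3 h4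
    exact Set.disjoint_left.1 h2 hz hz'
  obtain ⟨c0, hc0, hcd0⟩ := hL
  have T1 := fun i => (hc0 i).1.trim (U := Kᶜ) (H := G) (hc0 i).2.1 (hc0 i).2.2 (fun v hv _ => hAK v hv)
    (fun u v h1 h2 h3 => ⟨fun hv hvK => h1 (hKadj v u hvK h2 h3.symm), h3⟩)
  choose c1 hcs1 hc1 _ σ1 hσc1 hσX1 _ hcK1 α1 hαc1 hαA1 hαu1 using T1
  have hcK1' : ∀ i, ∀ z ∈ c1 i, z ∉ K := fun i z hz hzK => hcK1 i z hz (hKX z hzK) hzK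
  choose a1 ha1 ha1f using hαA1
  have ha1i : Function.Injective a1 := fun i j hij => by
    by_contra hne
    refine Set.disjoint_left.1 (hcd0 i j hne) (hcs1 i (hαc1 i)) (hcs1 j ?_)
    rw [← ha1f i, hij, ha1f j]; exact hαc1 j
  let e := Tuple.sort a1
  have ha : StrictMono (a1 ∘ e) :=
    (Tuple.monotone_sort a1).strictMono_of_injective (ha1i.comp e.injective)
  obtain ⟨a, haE⟩ : ∃ a, a = a1 ∘ e := ⟨_, rfl⟩
  obtain ⟨c, hcE⟩ : ∃ c, c = c1 ∘ e := ⟨_, rfl⟩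
  obtain ⟨σ, hσE⟩ : ∃ σ, σ = σ1 ∘ e := ⟨_, rfl⟩
  rw [← haE] at ha
  have hc : ∀ r, Conn G (c r) := fun r => by rw [hcE]; exact hc1 _
  have hcd : ∀ r r', r ≠ r' → Disjoint (c r) (c r') := fun r r' h => by
    rw [hcE]
    exact (hcd0 _ _ (e.injective.ne h)).mono (hcs1 _) (hcs1 _)
  have hcK : ∀ r, ∀ z ∈ c r, z ∉ K := fun r => by rw [hcE]; exact hcK1' _
  have haj : ∀ r, a r ≤ j0 := fun r => by rw [haE]; exact ha1 _
  have hac : ∀ r, f (a r) ∈ c r := fun r => by rw [haE, hcE]; simp only [Function.comp, ha1f, hαc1]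
  have hau : ∀ r, ∀ p ≤ j0, f p ∈ c r → p = a r := fun r p hp h => by
    apply hinj p (by omega) _ ((haj r).trans hjN)
    rw [haE]; rw [hcE] at h
    simp only [Function.comp, ha1f]
    exact hαu1 _ _ h ⟨p, hp, rfl⟩
  have hσc : ∀ r, σ r ∈ c r := fun r => by rw [hσE, hcE]; exact hσc1 _
  have hσX : ∀ r, σ r ∈ X := fun r => by rw [hσE]; exact hσX1 _
  have hσi : Function.Injective σ := fun i j hij => by
    by_contra hne
    exact Set.disjoint_left.1 (hcd i j hne) (hσc i) (hij ▸ hσc j)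
  let id : Fin m → Fin k → Fin (m * k) := fun i t => finProdFinEquiv (i, t)
  have hidi : ∀ i t i' t', id i t = id i' t' → i = i' ∧ t = t' := fun i t i' t' h => by
    simpa [id] using h
  have hlt : ∀ i t i' t', i < i' → id i t < id i' t' := fun i t i' t' h => by
    simp only [id, Fin.lt_def, finProdFinEquiv_apply_val]
    have h1 := t.2
    have h2 : (i : ℕ) + 1 ≤ i' := h
    nlinarith
  let z0 : Fin k := ⟨0, hk⟩
  let z1 : Fin k := ⟨k - 1, by omega⟩
  have hle0 : ∀ i t, id i z0 ≤ id i t := fun i t => by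
    simp [id, Fin.le_def, finProdFinEquiv_apply_val, z0]
  have hle1 : ∀ i t, id i t ≤ id i z1 := fun i t => by
    have := t.2
    simp only [id, Fin.le_def, finProdFinEquiv_apply_val, z1]; omega
  let A : Fin m → Set V := fun i => f '' Set.Icc (a (id i z0)) (a (id i z1)) ∪ ⋃ t, c (id i t)
  have hAc : ∀ i, Conn G (A i) := fun i => by
    refine Conn.iUnion (hch.seg (ha.monotone (hle0 i z1)) ((haj _).trans hjN)) (fun t => hc _)
      fun t => Or.inl ⟨f (a (id i t)), hac _, a (id i t), ⟨ha.monotone (hle0 _ _),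
        ha.monotone (hle1 _ _)⟩, rfl⟩
  have hAd : ∀ i j, i < j → Disjoint (A i) (A j) := by
    intro i j hij
    have hdiff : ∀ t t', id i t ≠ id j t' := fun t t' h => hij.ne (hidi _ _ _ _ h).1
    rw [Set.disjoint_left]
    rintro z (⟨p, hp, rfl⟩ | hz) (hz' | hz')
    · obtain ⟨q, hq, hqp⟩ := hz'
      have h1 := hinj q (hq.2.trans ((haj _).trans hjN)) p (hp.2.trans ((haj _).trans hjN)) hqp
      have h2 := ha (hlt i z1 j z0 hij)
      have := hq.1; have := hp.2; omega
    · obtain ⟨t, ht⟩ := Set.mem_iUnion.1 hz'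
      have h1 := hau _ p (hp.2.trans (haj _)) ht
      have h2 := ha (hlt i z1 j t hij)
      have := hp.2; omega
    · obtain ⟨q, hq, rfl⟩ := hz'
      obtain ⟨t, ht⟩ := Set.mem_iUnion.1 hz
      have h1 := hau _ q (hq.2.trans (haj _)) ht
      have h2 := ha (hlt i t j z0 hij)
      have := hq.1; omega
    · obtain ⟨t, ht⟩ := Set.mem_iUnion.1 hz
      obtain ⟨t', ht'⟩ := Set.mem_iUnion.1 hz'
      exact Set.disjoint_left.1 (hcd _ _ (hdiff t t')) ht ht'
  refine ⟨K, A, hAc, fun i => ?_, fun i j hij => ?_, fun i j hij => ?_⟩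
  · rw [Set.disjoint_left]
    rintro z (⟨p, hp, rfl⟩ | hz)
    · exact hAK _ ⟨p, hp.2.trans (haj _), rfl⟩
    · obtain ⟨t, ht⟩ := Set.mem_iUnion.1 hz
      exact hcK _ z ht
  · rcases lt_or_gt_of_ne hij with h | h
    · exact hAd i j h
    · exact (hAd j i h).symm
  let Xi : Fin m → Set V := fun i => Set.range fun t => σ (id i t)
  have hXA : ∀ i, Xi i ⊆ A i := by
    rintro i _ ⟨t, rfl⟩
    exact Or.inr (Set.mem_iUnion.2 ⟨t, hσc _⟩)
  have hXX : ∀ i, Xi i ⊆ X := by rintro i _ ⟨t, rfl⟩; exact hσX _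
  have hXk : ∀ i, (Xi i).ncard = k := fun i => by
    have : Function.Injective fun t => σ (id i t) := fun t t' h => (hidi _ _ _ _ (hσi h)).2
    show (Set.range fun t => σ (id i t)).ncard = k
    rw [← Set.image_univ, Set.ncard_image_of_injective _ this]; simp
  rcases menger (res G (K ∪ Xi i ∪ Xi j)) (Xi i) (Xi j) k with ⟨Z, hZc, hZ⟩ | ⟨d, hd, hdd⟩
  · exfalso
    obtain ⟨b, hb, hbd⟩ := hord (X ∪ Z) (by have := Set.ncard_union_le X Z; omega)
    rw [Set.disjoint_union_right] at hbd
    have hbK' := hbK b hb hbd.1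
    obtain ⟨y, hy⟩ := (hbc b hb).1
    have hyU : y ∈ (K ∪ Xi i ∪ Xi j) \ Z := ⟨Or.inl (Or.inl (hbK' hy)), Set.disjoint_left.1 hbd.2 hy⟩
    obtain ⟨D, hD⟩ : ∃ D, D = cmp G ((K ∪ Xi i ∪ Xi j) \ Z) y := ⟨_, rfl⟩
    have hDU : D ⊆ (K ∪ Xi i ∪ Xi j) \ Z := hD ▸ cmp_sub _ _
    have key : ∀ X' : Set V, X' ⊆ X → X'.ncard = k → X' ⊆ Xi i ∪ Xi j → Disjoint X' D → False := by
      intro X' h1 h2 h3 h4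
      have hYc : ((X \ X') ∪ Z).ncard < m * k := by
        have e1 := Set.ncard_union_le (X \ X') Z
        have e2 := Set.ncard_sdiff_add_ncard_of_subset h1
        omega
      have hnot := hmin _ hYc
      simp only [Sp] at hnot
      push Not at hnot
      obtain ⟨s, hs, hsY, hsA, b', hb', hbY, hsb⟩ := hnot
      rw [Set.not_disjoint_iff] at hsb
      have hc1 : Conn G (s ∪ (b' ∪ b)) := hs.union (hβ b' hb' b hb) (by
        obtain ⟨z, h1, h2⟩ := hsb; exact ⟨z, h1, Or.inl h2⟩)
      have hmA : ((s ∪ (b' ∪ b)) ∩ A0).Nonempty := hsA.mono (by gcongr; simp)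
      have hav : ∀ z ∈ s ∪ (b' ∪ b), z ∉ Z ∧ (z ∈ X → z ∈ X') := by
        have aux : ∀ q : Set V, Disjoint q (X \ X' ∪ Z) → ∀ z ∈ q, z ∉ Z ∧ (z ∈ X → z ∈ X') := by
          intro q hq z hz
          have := Set.disjoint_left.1 hq hz
          simp only [Set.mem_union, Set.mem_sdiff] at this
          tauto
        rintro z (hz | hz | hz)
        · exact aux s hsY z hz
        · exact aux b' hbY z hz
        · exact ⟨Set.disjoint_left.1 hbd.2 hz, fun h => absurd h (Set.disjoint_left.1 hbd.1 hz)⟩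
      have hmX : ((s ∪ (b' ∪ b)) ∩ X).Nonempty := by
        by_contra hno
        rw [Set.not_nonempty_iff_eq_empty, ← Set.disjoint_iff_inter_eq_empty] at hno
        have := hXS _ hc1 hno hmA b hb hbd.1
        exact Set.disjoint_left.1 this (Or.inr (Or.inr hy)) hy
      obtain ⟨w, hw, hwX⟩ := hmX
      obtain ⟨p, hp, hpD, q, hq, hqD, hpq⟩ := hc1.cross (A := D)
        ⟨y, Or.inr (Or.inr hy), hD ▸ cmp_self hyU⟩
        (fun h => Set.disjoint_left.1 h4 ((hav w hw).2 hwX) (h hw))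
      have hpK : p ∈ K := by
        have hpX : p ∉ X := fun h => Set.disjoint_left.1 h4 ((hav p hp).2 h) hpD
        rcases (hDU hpD).1 with (h | h) | h
        · exact h
        · exact absurd (hXX i h) hpX
        · exact absurd (hXX j h) hpX
      refine hqD ?_
      rw [hD] at hpD ⊢
      refine cmp_adj hpD ⟨?_, (hav q hq).1⟩ hpq
      by_cases hqX : q ∈ X
      · rcases h3 ((hav q hq).2 hqX) with h | h
        · exact Or.inl (Or.inr h)
        · exact Or.inr h
      · exact Or.inl (Or.inl (hKadj p q hpK hqX hpq))
    have h1 : ¬ Disjoint (Xi i) D := fun h => key _ (hXX i) (hXk i) Set.subset_union_left h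
    have h2 : ¬ Disjoint (Xi j) D := fun h => key _ (hXX j) (hXk j) Set.subset_union_right h
    rw [Set.not_disjoint_iff] at h1 h2
    obtain ⟨u, hu, huD⟩ := h1
    obtain ⟨v, hv, hvD⟩ := h2
    have hDc : Conn G D := hD ▸ cmp_conn hyU
    obtain ⟨z, hz, hzZ⟩ := hZ D (conn_res hDc fun z hz => (hDU hz).1) ⟨u, huD, hu⟩ ⟨v, hvD, hv⟩
    exact (hDU hz).2 hzZ
  · by_cases hadj : ∃ x ∈ A i, ∃ y ∈ A j, G.Adj x y
    · exact Or.inl hadj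
    right
    have hAij : Disjoint (A i) (A j) := by
      rcases lt_or_gt_of_ne hij with h | h
      · exact hAd i j h
      · exact (hAd j i h).symm
    have : ∀ r, ∃ s ⊆ d r, Conn (res G K) s ∧ (s ∩ (Nb G (A i) ∩ K)).Nonempty ∧
        (s ∩ (Nb G (A j) ∩ K)).Nonempty := by
      intro r
      obtain ⟨g, M, hg⟩ := (hd r).1.tp (hd r).2.1 (hd r).2.2
      have hM0 : M ≠ 0 := by
        rintro rfl
        exact Set.disjoint_left.1 hAij (hXA i hg.fst) (hXA j hg.lst)
      have hM1 : M ≠ 1 := by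
        rintro rfl
        exact hadj ⟨_, hXA i hg.fst, _, hXA j hg.lst, (hg.chn 0 (by omega)).1⟩
      have hin : ∀ p, 1 ≤ p → p ≤ M - 1 → g p ∈ K := by
        intro p h1 h2
        rcases (hg.chn p (by omega)).2.1 with (h | h) | h
        · exact h
        · have := hg.fst' p (by omega) h; omega
        · have := hg.lst' p (by omega) h; omega
      have hdis : ∀ i p, 1 ≤ p → p ≤ M - 1 → g p ∉ A i := by
        intro i p h1 h2 h3
        rcases h3 with ⟨q, hq, hqe⟩ | hz
        · exact hAK _ ⟨q, hq.2.trans (haj _), hqe⟩ (hin p h1 h2)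
        · obtain ⟨t, ht⟩ := Set.mem_iUnion.1 hz
          exact hcK _ _ ht (hin p h1 h2)
      refine ⟨g '' Set.Icc 1 (M - 1), ?_, ?_, ⟨g 1, ⟨1, ⟨le_rfl, by omega⟩, rfl⟩,
        ⟨hdis i 1 le_rfl (by omega), _, hXA i hg.fst, (hg.chn 0 (by omega)).1⟩, hin 1 le_rfl (by omega)⟩,
        ⟨g (M - 1), ⟨M - 1, ⟨by omega, le_rfl⟩, rfl⟩,
        ⟨hdis j _ (by omega) le_rfl, _, hXA j hg.lst, ?_⟩, hin _ (by omega) le_rfl⟩⟩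
      · rintro _ ⟨p, hp, rfl⟩
        exact hg.mem p (by have := hp.2; omega)
      · refine conn_res ?_ (by rintro _ ⟨p, hp, rfl⟩; exact hin p hp.1 hp.2)
        have : Chn G g M := fun p hp => (hg.chn p hp).1
        exact this.seg (by omega) (by omega)
      · have := (hg.chn (M - 1) (by omega)).1.symm
        rwa [show M - 1 + 1 = M by omega] at this
    choose s hs1 hs2 hs3 hs4 using this
    exact ⟨s, fun r => ⟨hs2 r, hs3 r, hs4 r⟩, fun r r' h => (hdd r r' h).mono (hs1 r) (hs1 r')⟩
end
end Paper

namespace Paper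
section
variable {V W : Type} {G H : SimpleGraph V} {s t : Set V}

theorem Conn.trim2 (hs : Conn G s) {A B : Set V} (hA : (s ∩ A).Nonempty) (hB : (s ∩ B).Nonempty)
    (hd : Disjoint A B) : ∃ s' ⊆ s, Conn G s' ∧ Disjoint s' B ∧ (s' ∩ A).Nonempty ∧
      ∃ x ∈ s', ∃ y ∈ s, y ∈ B ∧ G.Adj x y := by
  obtain ⟨f, n, h⟩ := hs.tp hA hB
  have hn : n ≠ 0 := by
    rintro rfl
    exact Set.disjoint_left.1 hd h.fst h.lst
  refine ⟨f '' Set.Icc 0 (n - 1), ?_, h.chn.seg (by omega) (by omega), ?_,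
    ⟨f 0, ⟨0, by simp, rfl⟩, h.fst⟩, f (n - 1), ⟨n - 1, by simp, rfl⟩, f n, h.mem _ le_rfl, h.lst, ?_⟩
  · rintro _ ⟨i, hi, rfl⟩; exact h.mem i (by have := hi.2; omega)
  · rw [Set.disjoint_left]
    rintro _ ⟨i, hi, rfl⟩ hb
    have := h.lst' i (by have := hi.2; omega) hb
    have := hi.2; omega
  · convert h.chn (n - 1) (by omega) using 2; omega

/-- vertex set of a row -/
def rw_ (R : ℕ → ℕ → V) (len : ℕ → ℕ) (i : ℕ) : Set V := R i '' Set.Icc 0 (len i)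

structure RowLad (G : SimpleGraph V) (R : ℕ → ℕ → V) (len : ℕ → ℕ) (E : ℕ → Set V) (q M : ℕ) :
    Prop where
  chn : ∀ i < q, Chn G (R i) (len i)
  inj : ∀ i < q, ∀ i' < q, ∀ p ≤ len i, ∀ p' ≤ len i', R i p = R i' p' → i = i' ∧ p = p'
  dis : ∀ n < M, ∀ n' < M, n ≠ n' → Disjoint (E n) (E n')
  meet : ∀ n < M, ∀ i < q, ∃ p ≤ len i, R i p ∈ E n
  ord : ∀ n n', n < n' → n' < M → ∀ i < q, ∀ p ≤ len i, ∀ p' ≤ len i, R i p ∈ E n → R i p' ∈ E n' →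
    p < p'

theorem RowLad.wall {R : ℕ → ℕ → V} {len : ℕ → ℕ} {E : ℕ → Set V} {k : ℕ}
    (h : RowLad G R len E k (2 * k * k))
    (hD : ∀ n < 2 * k * k, ∀ i, i + 1 < k → ∃ D ⊆ E n, Conn G D ∧ (D ∩ rw_ R len i).Nonempty ∧
      (D ∩ rw_ R len (i + 1)).Nonempty ∧ ∀ l < k, l ≠ i → l ≠ i + 1 → Disjoint D (rw_ R len l)) :
    HasMinor (Wall k) G := by
  classical
  rcases Nat.eq_zero_or_pos k with rfl | hk
  · exact ⟨fun _ => ∅, fun w => w.1.elim0, fun w => w.1.elim0, fun w => w.1.elim0⟩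
  have hjk : ∀ j i, j < 2 * k → i < k → j * k + i < 2 * k * k := fun j i hj hi => by
    have : (j + 1) * k ≤ 2 * k * k := Nat.mul_le_mul_right k hj
    rw [Nat.succ_mul] at this; omega
  -- trimmed connectors
  have hD' : ∀ n i, ∃ D' : Set V, n < 2 * k * k → i + 1 < k → D' ⊆ E n ∧ Conn G D' ∧
      (D' ∩ rw_ R len i).Nonempty ∧ (∀ l < k, l ≠ i → Disjoint D' (rw_ R len l)) ∧
      ∃ x ∈ D', ∃ y ∈ E n, y ∈ rw_ R len (i + 1) ∧ G.Adj x y := by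
    intro n i
    by_cases hh : n < 2 * k * k ∧ i + 1 < k
    · obtain ⟨D, hDE, hDc, h1, h2, h3⟩ := hD n hh.1 i hh.2
      obtain ⟨D', hs, hc, hd, hm, x, hx, y, hy, hyB, hxy⟩ := hDc.trim2 h1 h2 (by
        rw [Set.disjoint_left]
        rintro _ ⟨p, hp, rfl⟩ ⟨p', hp', he⟩
        have := (h.inj _ hh.2 _ (by omega) _ hp'.2 _ hp.2 he).1; omega)
      refine ⟨D', fun _ _ => ⟨hs.trans hDE, hc, hm, fun l hl hli => ?_, x, hx, y, hDE hy, hyB, hxy⟩⟩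
      by_cases hl' : l = i + 1
      · rw [hl']; exact hd
      · exact (h3 l hl hli hl').mono_left hs
    · exact ⟨∅, fun h1 h2 => absurd ⟨h1, h2⟩ hh⟩
  choose D hD using hD'
  have hex : ∀ i j, i < k → j < 2 * k → ∃ p, p ≤ len i ∧ R i p ∈ E (j * k) := fun i j hi hj =>
    h.meet _ (hjk j 0 hj hk) i hi
  let T : ℕ → ℕ → ℕ := fun i j => if j = 0 then 0 else
    if hh : i < k ∧ j < 2 * k then Nat.find (hex i j hh.1 hh.2) else len i + 1
  have hT : ∀ i < k, ∀ j < 2 * k, ∀ l < k, ∀ p ≤ len i, R i p ∈ E (j * k + l) →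
      T i j ≤ p ∧ p < T i (j + 1) := by
    intro i hi j hj l hl p hp hpE
    constructor
    · by_cases h0 : j = 0
      · simp [T, h0]
      · simp only [T, h0, if_false, hi, hj, and_self, dif_pos]
        have hs := Nat.find_spec (hex i j hi hj)
        rcases Nat.eq_zero_or_pos l with rfl | hl'
        · exact Nat.find_min' _ ⟨hp, hpE⟩
        · exact (h.ord _ _ (by omega) (hjk j l hj hl) i hi _ hs.1 _ hp hs.2 hpE).le
    · by_cases h1 : j + 1 < 2 * k
      · simp only [T, hi, h1, and_self, dif_pos, Nat.succ_ne_zero, if_false]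
        have hs := Nat.find_spec (hex i (j + 1) hi h1)
        have := hjk (j + 1) 0 h1 hk
        exact h.ord _ _ (by rw [Nat.succ_mul]; omega) this i hi _ hp _ hs.1 hpE hs.2
      · simp only [T, h1, and_false, dif_neg, not_false_iff, Nat.succ_ne_zero, if_false]; omega
  have hTs : ∀ i < k, ∀ j < 2 * k, T i j < T i (j + 1) := fun i hi j hj => by
    obtain ⟨p, hp, hpE⟩ := hex i j hi hj
    have := hT i hi j hj 0 hk p hp hpE; omega
  have hTm : ∀ i < k, Monotone (T i) := fun i hi => monotone_nat_of_le_succ fun j => by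
    by_cases hj : j < 2 * k
    · exact (hTs i hi j hj).le
    · have h1 : T i (j + 1) = len i + 1 := by simp [T]; intros; omega
      have h2 : T i j = len i + 1 := by
        have : j ≠ 0 := by omega
        simp [T, this]; intros; omega
      omega
  have hTl : ∀ i < k, ∀ j < 2 * k, T i (j + 1) ≤ len i + 1 := fun i hi j hj => by
    have h2 : T i (2 * k) = len i + 1 := by
      have : 2 * k ≠ 0 := by omega
      simp [T]; omega
    exact h2 ▸ hTm i hi (by omega)
  let B : ℕ → ℕ → Set V := fun i j => R i '' Set.Icc (T i j) (T i (j + 1) - 1)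
  have hBmem : ∀ i < k, ∀ j < 2 * k, ∀ p, T i j ≤ p → p < T i (j + 1) → R i p ∈ B i j :=
    fun i hi j hj p h1 h2 => ⟨p, ⟨h1, by omega⟩, rfl⟩
  have hB : ∀ i < k, ∀ j < 2 * k, ∀ z ∈ B i j, ∃ p ≤ len i, T i j ≤ p ∧ p < T i (j + 1) ∧ z = R i p := by
    rintro i hi j hj _ ⟨p, hp, rfl⟩
    have := hTs i hi j hj
    have := hTl i hi j hj
    have := hp.1
    have := hp.2
    exact ⟨p, by omega, by omega, by omega, rfl⟩
  have hBB : ∀ i < k, ∀ j < 2 * k, ∀ i' < k, ∀ j' < 2 * k, ∀ z ∈ B i j, z ∈ B i' j' →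
      i = i' ∧ j = j' := by
    intro i hi j hj i' hi' j' hj' z hz hz'
    obtain ⟨p, hp, h1, h2, rfl⟩ := hB i hi j hj z hz
    obtain ⟨p', hp', h1', h2', he⟩ := hB i' hi' j' hj' _ hz'
    obtain ⟨rfl, rfl⟩ := h.inj i hi i' hi' p hp p' hp' he
    refine ⟨rfl, ?_⟩
    rcases lt_trichotomy j j' with hh | hh | hh
    · have := hTm i hi (show j + 1 ≤ j' from hh); omega
    · exact hh
    · have := hTm i hi (show j' + 1 ≤ j from hh); omega
  let C : ℕ → ℕ → Set V := fun i j => if i + 1 < k then D (j * k + i) i else ∅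
  have hCB : ∀ i < k, ∀ j < 2 * k, ∀ i' < k, ∀ j' < 2 * k, ∀ z ∈ C i j, z ∈ B i' j' →
      i = i' ∧ j = j' := by
    intro i hi j hj i' hi' j' hj' z hz hz'
    simp only [C] at hz
    split_ifs at hz with hik
    · obtain ⟨d1, -, -, d2, -⟩ := hD _ i (hjk j i hj hi) hik
      obtain ⟨p, hp, h1, h2, rfl⟩ := hB i' hi' j' hj' z hz'
      have hii : i = i' := by
        by_contra hne
        exact Set.disjoint_left.1 (d2 i' hi' (Ne.symm hne)) hz ⟨p, ⟨Nat.zero_le _, hp⟩, rfl⟩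
      subst hii
      have := hT i hi j hj i hi p hp (d1 hz)
      exact hBB i hi j hj i hi j' hj' _ (hBmem i hi j hj p this.1 this.2) hz'
    · exact hz.elim
  have hCC : ∀ i < k, ∀ j < 2 * k, ∀ i' < k, ∀ j' < 2 * k, ∀ z ∈ C i j, z ∈ C i' j' →
      i = i' ∧ j = j' := by
    intro i hi j hj i' hi' j' hj' z hz hz'
    simp only [C] at hz hz'
    split_ifs at hz hz' with hik hik'
    · have hz := (hD _ i (hjk j i hj hi) hik).1 hz
      have hz' := (hD _ i' (hjk j' i' hj' hi') hik').1 hz'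
      have he : j * k + i = j' * k + i' := by
        by_contra hne
        exact Set.disjoint_left.1 (h.dis _ (hjk j i hj hi) _ (hjk j' i' hj' hi') hne) hz hz'
      have h1 : (j * k + i) % k = i := by rw [Nat.mul_add_mod']; exact Nat.mod_eq_of_lt hi
      have h2 : (j' * k + i') % k = i' := by rw [Nat.mul_add_mod']; exact Nat.mod_eq_of_lt hi'
      have : i = i' := by rw [← h1, he, h2]
      subst this
      exact ⟨rfl, Nat.eq_of_mul_eq_mul_right hk (by omega)⟩
    all_goals first | exact absurd hz (Set.notMem_empty _) | exact absurd hz' (Set.notMem_empty _)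
  have key : ∀ w w' : Fin k × Fin (2 * k), ((w.1 = w'.1 ∧ w.2.val + 1 = w'.2.val) ∨
      (w.2 = w'.2 ∧ w.1.val + 1 = w'.1.val ∧ (w.1.val + w.2.val) % 2 = 0)) →
      ∃ x ∈ B w.1 w.2 ∪ C w.1 w.2, ∃ y ∈ B w'.1 w'.2 ∪ C w'.1 w'.2, G.Adj x y := by
    rintro ⟨⟨i, hi⟩, ⟨j, hj⟩⟩ ⟨⟨i', hi'⟩, ⟨j', hj'⟩⟩ (⟨h1, h2⟩ | ⟨h1, h2, -⟩)
    · simp only [Fin.mk.injEq] at h1 h2 ⊢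
      subst h1 h2
      have a1 := hTs i hi j hj
      have a2 := hTs i hi (j + 1) hj'
      refine ⟨R i (T i (j + 1) - 1), Or.inl (hBmem i hi j hj _ (by omega) (by omega)),
        R i (T i (j + 1)), Or.inl (hBmem i hi _ hj' _ le_rfl a2), ?_⟩
      have a3 := hTl i hi (j + 1) hj'
      convert h.chn i hi (T i (j + 1) - 1) (by omega) using 2; omega
    · simp only [Fin.mk.injEq] at h1 h2 ⊢
      subst h1 h2
      obtain ⟨d1, -, -, d2, x, hx, y, hy, ⟨p, hp, rfl⟩, hxy⟩ := hD _ i (hjk j i hj hi) hi'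
      have := hT (i + 1) hi' j hj i hi p hp.2 hy
      refine ⟨x, Or.inr ?_, _, Or.inl (hBmem _ hi' j hj p this.1 this.2), hxy⟩
      simp only [C, hi', if_true]; exact hx
  refine ⟨fun w => B w.1 w.2 ∪ C w.1 w.2, ?_, ?_, ?_⟩
  · rintro ⟨⟨i, hi⟩, ⟨j, hj⟩⟩
    have a1 := hTs i hi j hj
    have a2 := hTl i hi j hj
    have hBc : Conn G (B i j) := (h.chn i hi).seg (by omega) (by omega)
    show Conn G (B i j ∪ C i j)
    simp only [C]
    split_ifs with hik
    · obtain ⟨d1, d2, ⟨z, hz, p, hp, rfl⟩, -, -⟩ := hD _ i (hjk j i hj hi) hik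
      have := hT i hi j hj i hi p hp.2 (d1 hz)
      exact hBc.union d2 ⟨_, hBmem i hi j hj p this.1 this.2, hz⟩
    · simpa using hBc
  · rintro ⟨⟨i, hi⟩, ⟨j, hj⟩⟩ ⟨⟨i', hi'⟩, ⟨j', hj'⟩⟩ hne
    rw [Set.disjoint_left]
    intro z hz hz'
    apply hne
    have : i = i' ∧ j = j' := by
      rcases hz with hz | hz <;> rcases hz' with hz' | hz'
      · exact hBB i hi j hj i' hi' j' hj' z hz hz'
      · have := hCB i' hi' j' hj' i hi j hj z hz' hz; exact ⟨this.1.symm, this.2.symm⟩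
      · exact hCB i hi j hj i' hi' j' hj' z hz hz'
      · exact hCC i hi j hj i' hi' j' hj' z hz hz'
    obtain ⟨rfl, rfl⟩ := this
    rfl
  · intro w w' hw
    rcases hw.2 with hh | hh
    · exact key w w' hh
    · obtain ⟨x, hx, y, hy, hxy⟩ := key w' w hh
      exact ⟨y, hy, x, hx, hxy.symm⟩


/-- ball of radius `r` -/
def bl (G : SimpleGraph V) (v : V) : ℕ → Set V
  | 0 => {v}
  | r + 1 => {u | ∃ x ∈ bl G v r, x = u ∨ G.Adj x u}

theorem bl_mono (v : V) {r r' : ℕ} (h : r ≤ r') : bl G v r ⊆ bl G v r' := by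
  induction r', h using Nat.le_induction with
  | base => exact subset_rfl
  | succ n _ ih => exact fun z hz => ⟨z, ih hz, Or.inl rfl⟩

theorem bl_chn {f : ℕ → V} {n : ℕ} (h : Chn G f n) {i : ℕ} (hi : i ≤ n) : f i ∈ bl G (f 0) i := by
  induction i with
  | zero => rfl
  | succ i ih => exact ⟨f i, ih (by omega), Or.inr (h i (by omega))⟩

theorem bl_card [Finite V] {d : ℕ} (hd : ∀ v, (G.neighborSet v).ncard ≤ d) (v : V) (r : ℕ) :
    (bl G v r).ncard ≤ (d + 1) ^ r := by
  induction r with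
  | zero => simp [bl]
  | succ r ih =>
    have : bl G v (r + 1) ⊆ ⋃ x ∈ (Set.toFinite (bl G v r)).toFinset, Insert.insert x (G.neighborSet x) := by
      rintro u ⟨x, hx, h⟩
      simp only [Set.mem_iUnion, Set.Finite.mem_toFinset]
      refine ⟨x, hx, ?_⟩
      rcases h with rfl | h
      · exact Or.inl rfl
      · exact Or.inr h
    refine (Set.ncard_le_ncard this (Set.toFinite _)).trans ?_
    refine (Finset.set_ncard_biUnion_le _ _).trans ?_
    refine (Finset.sum_le_card_nsmul _ _ (d + 1) fun x _ => ?_).trans ?_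
    · exact (Set.ncard_insert_le _ _).trans (Nat.succ_le_succ (hd x))
    · rw [smul_eq_mul, ← Set.ncard_eq_toFinset_card, pow_succ]
      exact Nat.mul_le_mul_right _ ih

theorem path_or_star [Finite V] (hG : Conn G Set.univ) {k : ℕ} (hk : 1 ≤ k)
    (hc : k ^ k < Nat.card V) : (∃ a : ℕ → V, Chn G a k ∧ ∀ i ≤ k, ∀ j ≤ k, a i = a j → i = j) ∨
      ∃ v, k ≤ (G.neighborSet v).ncard := by
  by_cases h : ∃ v, k ≤ (G.neighborSet v).ncard
  · exact Or.inr h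
  push Not at h
  left
  obtain ⟨v, -⟩ := hG.1
  have := bl_card (G := G) (d := k - 1) (fun v => by have := h v; omega) v k
  rw [Nat.sub_add_cancel hk] at this
  obtain ⟨u, hu⟩ : ∃ u, u ∉ bl G v k := by
    by_contra hh
    push Not at hh
    rw [Set.eq_univ_of_forall hh, Set.ncard_univ] at this
    omega
  obtain ⟨f, n, hf⟩ := hG.tp (A := {v}) (B := {u}) ⟨v, trivial, rfl⟩ ⟨u, trivial, rfl⟩
  have h0 : f 0 = v := hf.fst
  have h1 : f n = u := hf.lst
  have hn : k ≤ n := by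
    by_contra hh
    exact hu (bl_mono v (show n ≤ k by omega) (h0 ▸ h1 ▸ bl_chn hf.chn le_rfl : u ∈ bl G v n))
  exact ⟨f, fun i hi => hf.chn i (by omega), fun i hi j hj => hf.inj i (by omega) j (by omega)⟩

/-- layer graph -/
def layG (G : SimpleGraph V) (R : ℕ → ℕ → V) (len : ℕ → ℕ) (q : ℕ) (C : Set V) :
    SimpleGraph (Fin q) where
  Adj a b := a ≠ b ∧ ∃ s ⊆ C, Conn G s ∧ (s ∩ rw_ R len a).Nonempty ∧ (s ∩ rw_ R len b).Nonempty ∧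
    ∀ l < q, l ≠ a → l ≠ b → Disjoint s (rw_ R len l)
  symm := ⟨fun _ _ ⟨h, s, h1, h2, h3, h4, h5⟩ =>
    ⟨h.symm, s, h1, h2, h4, h3, fun l hl h h' => h5 l hl h' h⟩⟩
  loopless := ⟨fun _ h => h.1 rfl⟩

theorem RowLad.layG {R : ℕ → ℕ → V} {len : ℕ → ℕ} {E : ℕ → Set V} {q M : ℕ}
    (h : RowLad G R len E q M) (hq : 0 < q) {n : ℕ} (hn : n < M) (hc : Conn G (E n)) :
    Conn (layG G R len q (E n)) Set.univ := by
  refine ⟨⟨⟨0, hq⟩, trivial⟩, fun t _ ht hcl => ?_⟩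
  by_contra hne
  obtain ⟨b, -, hb⟩ := Set.not_subset.1 hne
  obtain ⟨a, ha⟩ := ht
  let T : Set (Fin q) → Set V := fun t => ⋃ j ∈ t, rw_ R len j
  have hT : ∀ (t : Set (Fin q)) j, j ∈ t → (E n ∩ T t).Nonempty := fun t j hj => by
    obtain ⟨p, hp, hpE⟩ := h.meet n hn j j.2
    exact ⟨_, hpE, Set.mem_biUnion hj ⟨p, ⟨Nat.zero_le _, hp⟩, rfl⟩⟩
  obtain ⟨f, m, hf⟩ := hc.tp (hT t a ha) (hT tᶜ b hb)
  obtain ⟨a', ha', hfa⟩ := Set.mem_iUnion₂.1 hf.fst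
  obtain ⟨b', hb', hfb⟩ := Set.mem_iUnion₂.1 hf.lst
  have hab : a' ≠ b' := fun h => hb' (h ▸ ha')
  have hrow : ∀ i i' : Fin q, ∀ z, z ∈ rw_ R len i → z ∈ rw_ R len i' → i = i' := by
    rintro i i' _ ⟨p, hp, rfl⟩ ⟨p', hp', he⟩
    exact Fin.ext (h.inj _ i'.2 _ i.2 _ hp'.2 _ hp.2 he).1.symm
  refine hb' (hcl a' ha' b' trivial ⟨hab, f '' Set.Icc 0 m, ?_, hf.chn.seg (Nat.zero_le _) le_rfl,
    ⟨_, ⟨0, by simp, rfl⟩, hfa⟩, ⟨_, ⟨m, by simp, rfl⟩, hfb⟩, ?_⟩)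
  · rintro _ ⟨i, hi, rfl⟩; exact hf.mem i hi.2
  · intro l hl hla hlb
    rw [Set.disjoint_left]
    rintro _ ⟨i, hi, rfl⟩ hz
    by_cases hlt : (⟨l, hl⟩ : Fin q) ∈ t
    · have := hf.fst' i hi.2 (Set.mem_biUnion hlt hz)
      subst this
      exact hla (congrArg Fin.val (hrow ⟨l, hl⟩ a' _ hz hfa))
    · have := hf.lst' i hi.2 (Set.mem_biUnion (show _ ∈ tᶜ from hlt) hz)
      subst this
      exact hlb (congrArg Fin.val (hrow ⟨l, hl⟩ b' _ hz hfb))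

theorem ladder_wall (k : ℕ) : ∃ q N : ℕ, 0 < q ∧ 0 < N ∧ ∀ (V : Type) (G : SimpleGraph V)
    (R : ℕ → ℕ → V) (len : ℕ → ℕ) (E : ℕ → Set V), RowLad G R len E q N →
    (∀ n < N, Conn G (E n)) → HasMinor (Wall k) G := by
  classical
  let r := k + 1
  let q := r ^ r + 1
  let g := Nat.card (SimpleGraph (Fin q))
  refine ⟨q, g * (2 * k * k) + 1, by omega, by omega, ?_⟩
  intro V G R len E h hc
  -- pigeonhole
  obtain ⟨L, σ, hσ, hσN, hσL⟩ : ∃ (L : SimpleGraph (Fin q)) (σ : ℕ → ℕ),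
      (∀ n n', n < n' → n' < 2 * k * k → σ n < σ n') ∧
      (∀ n < 2 * k * k, σ n < g * (2 * k * k) + 1) ∧
      ∀ n < 2 * k * k, layG G R len q (E (σ n)) = L := by
    have := Fintype.ofFinite (SimpleGraph (Fin q))
    obtain ⟨L, -, hL⟩ := Finset.exists_lt_card_fiber_of_mul_lt_card_of_maps_to
      (s := Finset.range (g * (2 * k * k) + 1)) (t := Finset.univ)
      (f := fun n => layG G R len q (E n)) (n := 2 * k * k) (fun _ _ => Finset.mem_univ _)
      (by rw [Finset.card_range, Finset.card_univ, ← Nat.card_eq_fintype_card]; exact Nat.lt_succ_self _)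
    set S := {x ∈ Finset.range (g * (2 * k * k) + 1) | layG G R len q (E x) = L}
    refine ⟨L, fun n => if hn : n < S.card then S.orderEmbOfFin rfl ⟨n, hn⟩ else 0, ?_, ?_, ?_⟩
    · intro n n' hn hn'
      beta_reduce
      rw [dif_pos (by omega), dif_pos (by omega)]
      exact (S.orderEmbOfFin rfl).strictMono hn
    · intro n hn
      beta_reduce
      rw [dif_pos (by omega)]
      have := S.orderEmbOfFin_mem rfl ⟨n, by omega⟩
      exact Finset.mem_range.1 (Finset.mem_filter.1 this).1
    · intro n hn
      beta_reduce
      rw [dif_pos (by omega)]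
      exact (Finset.mem_filter.1 (S.orderEmbOfFin_mem rfl ⟨n, by omega⟩)).2
  have hdisE : ∀ n < 2 * k * k, ∀ n' < 2 * k * k, n ≠ n' → Disjoint (E (σ n)) (E (σ n')) := by
    intro n hn n' hn' hne
    refine h.dis _ (hσN _ hn) _ (hσN _ hn') ?_
    rcases lt_or_gt_of_ne hne with h' | h'
    · exact (hσ n n' h' hn').ne
    · exact (hσ n' n h' hn).ne'
  rcases Nat.eq_zero_or_pos k with rfl | hk
  · exact ⟨fun _ => ∅, fun w => w.1.elim0, fun w => w.1.elim0, fun w => w.1.elim0⟩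
  have hkk : 0 < 2 * k * k := by positivity
  have hLc : Conn L Set.univ := by
    rw [← hσL 0 hkk]
    exact h.layG (by omega) (hσN 0 hkk) (hc _ (hσN 0 hkk))
  rcases path_or_star hLc (k := r) (by omega) (by simp [q]) with ⟨a, ha, hai⟩ | ⟨v, hv⟩
  · have hR : RowLad G (fun i => R (a i)) (fun i => len (a i)) (fun n => E (σ n)) k (2 * k * k) := by
      refine ⟨fun i _ => h.chn _ (a i).2, fun i hi i' hi' p hp p' hp' he => ?_, hdisE,
        fun n hn i _ => h.meet _ (hσN n hn) _ (a i).2, fun n n' h1 h2 i _ => 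
          h.ord _ _ (hσ n n' h1 h2) (hσN _ h2) _ (a i).2⟩
      have := h.inj _ (a i).2 _ (a i').2 p hp p' hp' he
      exact ⟨hai i (by omega) i' (by omega) (Fin.ext this.1), this.2⟩
    refine hR.wall fun n hn i hi => ?_
    have := ha i (by omega)
    rw [← hσL n hn] at this
    obtain ⟨-, s, h1, h2, h3, h4, h5⟩ := this
    refine ⟨s, h1, h2, h3, h4, fun l hl hli hli' => h5 (a l) (a l).2 ?_ ?_⟩
    · exact fun he => hli (hai _ (by omega) _ (by omega) (Fin.ext he))
    · exact fun he => hli' (hai _ (by omega) _ (by omega) (Fin.ext he))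
  · -- star
    let hull : ℕ → Set V := fun n => {z | ∃ p p₁ p₂, p₁ ≤ p ∧ p ≤ p₂ ∧ p₂ ≤ len v ∧ R v p₁ ∈ E n ∧
      R v p₂ ∈ E n ∧ R v p = z}
    have hhr : ∀ n, hull n ⊆ rw_ R len v := by
      rintro n _ ⟨p, p₁, p₂, h1, h2, h3, -, -, rfl⟩
      exact ⟨p, ⟨Nat.zero_le _, by omega⟩, rfl⟩
    obtain ⟨a, haL, hai⟩ : ∃ a : ℕ → Fin q, (∀ i < r, L.Adj v (a i)) ∧
        ∀ i < r, ∀ j < r, a i = a j → i = j := by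
      set S := (L.neighborSet v).toFinset
      have hS : r ≤ S.card := by rwa [Set.ncard_eq_toFinset_card'] at hv
      refine ⟨fun n => if hn : n < S.card then S.orderEmbOfFin rfl ⟨n, hn⟩ else v, ?_, ?_⟩
      · intro i hi
        beta_reduce
        rw [dif_pos (by omega)]
        have := S.orderEmbOfFin_mem rfl ⟨i, by omega⟩
        exact Set.mem_toFinset.1 this
      · intro i hi j hj he
        beta_reduce at he
        rw [dif_pos (by omega), dif_pos (by omega)] at he
        simpa using (S.orderEmbOfFin rfl).injective he
    have hav : ∀ i < r, ((a i : Fin q) : ℕ) ≠ v := fun i hi he => (haL i hi).ne (Fin.ext he.symm)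
    have hrow : ∀ i < q, ∀ i' < q, i ≠ i' → Disjoint (rw_ R len i) (rw_ R len i') := by
      intro i hi i' hi' hne
      rw [Set.disjoint_left]
      rintro _ ⟨p, hp, rfl⟩ ⟨p', hp', he⟩
      exact hne (h.inj _ hi' _ hi _ hp'.2 _ hp.2 he).1.symm
    have hEa : ∀ n, ∀ i < k, ∀ p ≤ len (a i), R (a i) p ∈ E n ∪ hull n → R (a i) p ∈ E n := by
      rintro n i hi p hp (h' | h')
      · exact h'
      · exact (Set.disjoint_left.1 (hrow _ (a i).2 _ v.2 (hav i (by omega)))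
          ⟨p, ⟨Nat.zero_le _, hp⟩, rfl⟩ (hhr n h')).elim
    have hhE : ∀ n < 2 * k * k, ∀ n' < 2 * k * k, n ≠ n' → ∀ z ∈ hull (σ n),
        z ∈ E (σ n') ∪ hull (σ n') → False := by
      rintro n hn n' hn' hne _ ⟨p, p₁, p₂, h1, h2, h3, h4, h5, rfl⟩ hz
      have hz : ∃ p₁ p₂, p₁ ≤ p ∧ p ≤ p₂ ∧ p₂ ≤ len v ∧ R v p₁ ∈ E (σ n') ∧ R v p₂ ∈ E (σ n') := by
        rcases hz with hz | ⟨p', p₁', p₂', h1', h2', h3', h4', h5', he⟩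
        · exact ⟨p, p, le_rfl, le_rfl, by omega, hz, hz⟩
        · have := (h.inj _ v.2 _ v.2 _ (by omega) _ (by omega) he).2
          exact ⟨p₁', p₂', by omega, by omega, h3', h4', h5'⟩
      obtain ⟨p₁', p₂', h1', h2', h3', h4', h5'⟩ := hz
      rcases lt_or_gt_of_ne hne with h' | h'
      · have := h.ord _ _ (hσ _ _ h' hn') (hσN _ hn') v v.2 p₂ h3 p₁' (by omega) h5 h4'; omega
      · have := h.ord _ _ (hσ _ _ h' hn) (hσN _ hn) v v.2 p₂' h3' p₁ (by omega) h5' h4; omega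
    have hR : RowLad G (fun i => R (a i)) (fun i => len (a i)) (fun n => E (σ n) ∪ hull (σ n)) k
        (2 * k * k) := by
      refine ⟨fun i _ => h.chn _ (a i).2, fun i hi i' hi' p hp p' hp' he => ?_,
        fun n hn n' hn' hne => ?_,
        fun n hn i _ => ?_, fun n n' h1 h2 i hi p hp p' hp' hpn hpn' => 
          h.ord _ _ (hσ n n' h1 h2) (hσN _ h2) _ (a i).2 p hp p' hp' (hEa _ i hi p hp hpn)
            (hEa _ i hi p' hp' hpn')⟩
      · have := h.inj _ (a i).2 _ (a i').2 p hp p' hp' he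
        exact ⟨hai i (by omega) i' (by omega) (Fin.ext this.1), this.2⟩
      · rw [Set.disjoint_left]
        rintro z (hz | hz) hz'
        · rcases hz' with hz' | hz'
          · exact Set.disjoint_left.1 (hdisE n hn n' hn' hne) hz hz'
          · exact hhE n' hn' n hn hne.symm z hz' (Or.inl hz)
        · exact hhE n hn n' hn' hne z hz hz'
      · obtain ⟨p, hp, hpE⟩ := h.meet _ (hσN n hn) _ (a i).2
        exact ⟨p, hp, Or.inl hpE⟩
    refine hR.wall fun n hn i hi => ?_
    have e1 := haL i (by omega)
    have e2 := haL (i + 1) (by omega)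
    rw [← hσL n hn] at e1 e2
    obtain ⟨-, s, h1, h2, ⟨x, hxs, px, hpx, rfl⟩, h4, h5⟩ := e1
    obtain ⟨-, s', h1', h2', ⟨y, hys, py, hpy, rfl⟩, h4', h5'⟩ := e2
    obtain ⟨I, hI, hIE, hxI, hyI⟩ : ∃ I, Conn G I ∧ I ⊆ hull (σ n) ∧ R v px ∈ I ∧ R v py ∈ I := by
      rcases le_total px py with hh | hh
      · refine ⟨R v '' Set.Icc px py, (h.chn v v.2).seg hh hpy.2, ?_, ⟨px, ⟨le_rfl, hh⟩, rfl⟩,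
          ⟨py, ⟨hh, le_rfl⟩, rfl⟩⟩
        rintro _ ⟨p, hp, rfl⟩
        exact ⟨p, px, py, hp.1, hp.2, hpy.2, h1 hxs, h1' hys, rfl⟩
      · refine ⟨R v '' Set.Icc py px, (h.chn v v.2).seg hh hpx.2, ?_, ⟨px, ⟨hh, le_rfl⟩, rfl⟩,
          ⟨py, ⟨le_rfl, hh⟩, rfl⟩⟩
        rintro _ ⟨p, hp, rfl⟩
        exact ⟨p, py, px, hp.1, hp.2, hpx.2, h1' hys, h1 hxs, rfl⟩
    refine ⟨(s ∪ I) ∪ s', ?_, (h2.union hI ⟨_, hxs, hxI⟩).union h2' ⟨_, Or.inr hyI, hys⟩,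
      h4.mono fun z hz => ⟨Or.inl (Or.inl hz.1), hz.2⟩, h4'.mono fun z hz => ⟨Or.inr hz.1, hz.2⟩,
      fun l hl hli hli' => ?_⟩
    · rintro z ((hz | hz) | hz)
      exacts [Or.inl (h1 hz), Or.inr (hIE hz), Or.inl (h1' hz)]
    · have b1 : ((a l : Fin q) : ℕ) ≠ a i := fun he =>
        hli (hai l (by omega) i (by omega) (Fin.ext he))
      have b2 : ((a l : Fin q) : ℕ) ≠ a (i + 1) := fun he =>
        hli' (hai l (by omega) (i + 1) (by omega) (Fin.ext he))
      have b3 := hav l (by omega)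
      rw [Set.disjoint_union_left, Set.disjoint_union_left]
      refine ⟨⟨h5 _ (a l).2 b3 b1, ?_⟩, h5' _ (a l).2 b3 b2⟩
      exact (hrow _ v.2 _ (a l).2 b3.symm).mono_left (hIE.trans (hhr _))

end
end Paper

namespace Paper
section
variable {V W : Type} {G H : SimpleGraph V} {s t : Set V}

theorem cut [Finite V] {X Y : Set V} {k i : ℕ} {ι : Type} {P : ι → Set V}
    (f : Fin k → ℕ → V) (len : Fin k → ℕ) (hc : ∀ t, Chn H (f t) (len t)) (hX : ∀ t, f t 0 ∈ X)
    (hY : ∀ t, f t (len t) ∈ Y)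
    (hi : ∀ t t' p p', p ≤ len t → p' ≤ len t' → f t p = f t' p' → t = t' ∧ p = p')
    (hP : ∀ j, Conn H (P j)) (t0 : Fin k) (hil : i < len t0)
    (hfree : ∀ j, ¬ (f t0 i ∈ P j ∧ f t0 (i + 1) ∈ P j))
    (hmin : ¬ Linked (H.deleteEdges {s(f t0 i, f t0 (i + 1))}) X Y k) :
    ∃ S U : Set V, S.ncard < k ∧ (∀ j, Disjoint (P j) S → ∀ v ∈ P j, ∀ w ∈ P j, v ∈ U → w ∈ U) ∧
      (∀ p ≤ len t0, f t0 p ∈ U ↔ p ≤ i) ∧ ∀ t, ∃ θ, ∀ p ≤ len t, f t p ∈ U ↔ p < θ := by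
  classical
  set H' := H.deleteEdges {s(f t0 i, f t0 (i + 1))} with hH'
  obtain ⟨S, hSk, hS⟩ := (menger H' X Y k).resolve_right hmin
  have hadj : ∀ t p, p < len t → (t = t0 → p ≠ i) → H'.Adj (f t p) (f t (p + 1)) := by
    intro t p hp hne
    rw [hH', SimpleGraph.deleteEdges_adj]
    refine ⟨hc t p hp, ?_⟩
    rw [Set.mem_singleton_iff, Sym2.eq_iff]
    rintro (⟨h1, h2⟩ | ⟨h1, h2⟩)
    · have := hi _ _ _ _ hp.le hil.le h1; exact hne this.1 this.2
    · have a := hi _ _ _ _ hp.le hil h1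
      have b := hi _ _ _ _ hp hil.le h2
      omega
  have hseg : ∀ t a b, a ≤ b → b ≤ len t → (t = t0 → b ≤ i ∨ i < a) →
      Conn H' (f t '' Set.Icc a b) := by
    intro t a b hab hb hne
    have h1 : Chn H' (fun p => f t (p + a)) (b - a) := fun p hp => by
      have := hadj t (p + a) (by omega) (fun h => by have := hne h; omega)
      convert this using 2; omega
    have := h1.seg (Nat.zero_le _) le_rfl
    convert this using 1
    ext z; constructor
    · rintro ⟨p, hp, rfl⟩
      exact ⟨p - a, ⟨Nat.zero_le _, by have := hp.2; omega⟩, by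
        have := hp.1; beta_reduce; congr 1; omega⟩
    · rintro ⟨p, hp, rfl⟩
      exact ⟨p + a, ⟨by omega, by have := hp.2; omega⟩, rfl⟩
  have hσ : ∀ t, ∃ p, t ≠ t0 → p ≤ len t ∧ f t p ∈ S := by
    intro t
    by_cases ht : t = t0
    · exact ⟨0, fun h => absurd ht h⟩
    · obtain ⟨z, ⟨p, hp, rfl⟩, hz⟩ := hS _ (hseg t 0 (len t) (Nat.zero_le _) le_rfl fun h => absurd h ht)
        ⟨_, ⟨0, by simp, rfl⟩, hX t⟩ ⟨_, ⟨len t, by simp, rfl⟩, hY t⟩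
      exact ⟨p, fun _ => ⟨hp.2, hz⟩⟩
  choose σ hσ using hσ
  have hSeq : ∀ z ∈ S, ∃ t, t ≠ t0 ∧ z = f t (σ t) := by
    let A := (Finset.univ.erase t0).image fun t => f t (σ t)
    have hA : A.card = k - 1 := by
      rw [Finset.card_image_of_injOn, Finset.card_erase_of_mem (Finset.mem_univ _), Finset.card_univ,
        Fintype.card_fin]
      intro t ht t' ht' he
      exact (hi _ _ _ _ (hσ t (by simpa using ht)).1 (hσ t' (by simpa using ht')).1 he).1
    have hAS : (A : Set V) ⊆ S := by
      intro z hz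
      obtain ⟨t, ht, rfl⟩ := Finset.mem_image.1 (Finset.mem_coe.1 hz)
      exact (hσ t (by simpa using ht)).2
    have := Set.eq_of_subset_of_ncard_le hAS (by rw [Set.ncard_coe_finset]; omega)
    intro z hz
    rw [← this] at hz
    obtain ⟨t, ht, rfl⟩ := Finset.mem_image.1 (Finset.mem_coe.1 hz)
    exact ⟨t, by simpa using ht, rfl⟩
  let U : Set V := {v | ∃ s, Conn H' s ∧ Disjoint s S ∧ (s ∩ X).Nonempty ∧ v ∈ s}
  have hSn : ∀ t p, p ≤ len t → (t ≠ t0 → p ≠ σ t) → f t p ∉ S := by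
    intro t p hp hne hz
    obtain ⟨t', ht', he⟩ := hSeq _ hz
    obtain ⟨rfl, rfl⟩ := hi _ _ _ _ hp (hσ t' ht').1 he
    exact hne ht' rfl
  have U1 : ∀ t p, p ≤ len t → (t = t0 → p ≤ i) → (t ≠ t0 → p < σ t) → f t p ∈ U := by
    intro t p hp h1 h2
    refine ⟨_, hseg t 0 p (Nat.zero_le _) hp fun h => Or.inl (h1 h), ?_, ⟨_, ⟨0, by simp, rfl⟩, hX t⟩,
      ⟨p, by simp, rfl⟩⟩
    rw [Set.disjoint_left]
    rintro _ ⟨p', hp', rfl⟩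
    exact hSn t p' (hp'.2.trans hp) fun h => by have := h2 h; have := hp'.2; omega
  have U2 : ∀ t p, p ≤ len t → (t = t0 → i < p) → (t ≠ t0 → σ t ≤ p) → f t p ∉ U := by
    rintro t p hp h1 h2 ⟨s, hs, hsS, hsX, hps⟩
    by_cases hpS : f t p ∈ S
    · exact Set.disjoint_left.1 hsS hps hpS
    have := hS _ (hs.union (hseg t p (len t) hp le_rfl fun h => Or.inr (h1 h))
      ⟨_, hps, p, ⟨le_rfl, hp⟩, rfl⟩) (hsX.mono fun z hz => ⟨Or.inl hz.1, hz.2⟩)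
      ⟨_, Or.inr ⟨len t, ⟨hp, le_rfl⟩, rfl⟩, hY t⟩
    obtain ⟨z, hz | ⟨p', hp', rfl⟩, hzS⟩ := this
    · exact Set.disjoint_left.1 hsS hz hzS
    · refine hSn t p' hp'.2 (fun h he => ?_) hzS
      have := h2 h
      have h3 := hp'.1
      have : p = p' := by omega
      exact hpS (this ▸ hzS)
  refine ⟨S, U, hSk, ?_, ?_, fun t => ?_⟩
  · rintro j hj v hv w hw ⟨s, h1, h2, h3, h4⟩
    refine ⟨s ∪ P j, h1.union ((hP j).mono' ?_) ⟨v, h4, hv⟩, by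
      rw [Set.disjoint_union_left]; exact ⟨h2, hj⟩, h3.mono fun z hz => ⟨Or.inl hz.1, hz.2⟩, Or.inr hw⟩
    intro x hx y hy hxy
    rw [hH', SimpleGraph.deleteEdges_adj]
    refine ⟨hxy, fun he => hfree j ?_⟩
    rw [Set.mem_singleton_iff, Sym2.eq_iff] at he
    rcases he with ⟨rfl, rfl⟩ | ⟨rfl, rfl⟩
    exacts [⟨hx, hy⟩, ⟨hy, hx⟩]
  · intro p hp
    refine ⟨fun h => ?_, fun h => U1 t0 p hp (fun _ => h) fun h => absurd rfl h⟩
    by_contra hh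
    exact U2 t0 p hp (fun _ => by omega) (fun h => absurd rfl h) h
  · refine ⟨if t = t0 then i + 1 else σ t, fun p hp => ?_⟩
    by_cases ht : t = t0
    · rw [if_pos ht]
      refine ⟨fun h => ?_, fun h => U1 t p hp (fun _ => by omega) fun h => absurd ht h⟩
      by_contra hh
      exact U2 t p hp (fun _ => by omega) (fun h => absurd ht h) h
    · rw [if_neg ht]
      refine ⟨fun h => ?_, fun h' => U1 t p hp (fun h => absurd h ht) fun _ => h'⟩
      by_contra hh
      exact U2 t p hp (fun h => absurd h ht) (fun _ => by omega) h

theorem core [Finite V] {X Y : Set V} {k q N : ℕ} {ι : Type} [Nonempty ι] {P : ι → Set V}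
    (f : Fin k → ℕ → V) (len : Fin k → ℕ) (hc : ∀ t, Chn H (f t) (len t)) (hX : ∀ t, f t 0 ∈ X)
    (hY : ∀ t, f t (len t) ∈ Y)
    (hi : ∀ t t' p p', p ≤ len t → p' ≤ len t' → f t p = f t' p' → t = t' ∧ p = p')
    (hP : ∀ j, Conn H (P j)) (hPd : ∀ j j', j ≠ j' → Disjoint (P j) (P j'))
    (hmin : ∀ x y, H.Adj x y → (∀ j, ¬ (x ∈ P j ∧ y ∈ P j)) →
      ¬ Linked (H.deleteEdges {s(x, y)}) X Y k)
    (T : Finset (Fin k)) (hq : 0 < q) (hT : q ≤ T.card) (J : Finset ι)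
    (hJ : N * (N * k + 1) ≤ J.card) (hm : ∀ j ∈ J, ∀ t ∈ T, ∃ p ≤ len t, f t p ∈ P j) :
    ∃ R len' E, RowLad H R len' E q N ∧ ∀ n < N, Conn H (E n) := by
  classical
  obtain ⟨t1, ht1⟩ : T.Nonempty := Finset.card_pos.1 (by omega)
  obtain ⟨ρ, hρT, hρi⟩ : ∃ ρ : ℕ → Fin k, (∀ i < q, ρ i ∈ T) ∧ ∀ i < q, ∀ i' < q, ρ i = ρ i' → i = i' := by
    refine ⟨fun i => if h : i < T.card then T.orderEmbOfFin rfl ⟨i, h⟩ else t1, ?_, ?_⟩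
    · intro i hi
      beta_reduce
      rw [dif_pos (by omega)]; exact T.orderEmbOfFin_mem rfl _
    · intro i hi i' hi' he
      beta_reduce at he
      rw [dif_pos (by omega), dif_pos (by omega)] at he
      simpa using (T.orderEmbOfFin rfl).injective he
  set t0 := ρ 0
  have hPu : ∀ j j' z, z ∈ P j → z ∈ P j' → j = j' := fun j j' z h h' => by
    by_contra hne
    exact Set.disjoint_left.1 (hPd j j' hne) h h'
  have hpos : ∀ j, ∃ p, j ∈ J → p ≤ len t0 ∧ f t0 p ∈ P j := fun j => by
    by_cases hj : j ∈ J
    · obtain ⟨p, hp⟩ := hm j hj t0 (hρT 0 hq)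
      exact ⟨p, fun _ => hp⟩
    · exact ⟨0, fun h => absurd h hj⟩
  choose pos hpos using hpos
  set g := N * k + 1 with hg
  obtain ⟨τ, hτJ, hτm⟩ : ∃ τ : ℕ → ι, (∀ i < N * g, τ i ∈ J) ∧
      ∀ i i', i < i' → i' < N * g → pos (τ i) < pos (τ i') := by
    have hinj : Set.InjOn pos J := by
      intro j hj j' hj' he
      exact hPu j j' _ (hpos j hj).2 (he ▸ (hpos j' hj').2)
    have hcard := Finset.card_image_of_injOn hinj
    set S := J.image pos
    have : ∀ i, ∃ j, ∀ h : i < S.card, j ∈ J ∧ pos j = S.orderEmbOfFin rfl ⟨i, h⟩ := by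
      intro i
      by_cases h : i < S.card
      · obtain ⟨j, hj, hj'⟩ := Finset.mem_image.1 (S.orderEmbOfFin_mem rfl ⟨i, h⟩)
        exact ⟨j, fun _ => ⟨hj, hj'⟩⟩
      · exact ⟨Classical.arbitrary ι, fun h'' => absurd h'' h⟩
    choose τ hτ using this
    refine ⟨τ, fun i hi => (hτ i (by omega)).1, fun i i' h h' => ?_⟩
    rw [(hτ i (by omega)).2, (hτ i' (by omega)).2]
    exact (S.orderEmbOfFin rfl).strictMono h
  have hτi : ∀ i < N * g, ∀ i' < N * g, τ i = τ i' → i = i' := by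
    intro i h i' h' he
    rcases lt_trichotomy i i' with hh | hh | hh
    · have := hτm i i' hh h'; rw [he] at this; omega
    · exact hh
    · have := hτm i' i hh h; rw [he] at this; omega
  have hcut : ∀ n, ∃ (S U : Set V) (i : ℕ), S.ncard ≤ k ∧ (1 ≤ n → n < N →
      pos (τ (n * g - 1)) ≤ i ∧ i < pos (τ (n * g)) ∧
      (∀ j, Disjoint (P j) S → ∀ v ∈ P j, ∀ w ∈ P j, v ∈ U → w ∈ U) ∧
      (∀ p ≤ len t0, f t0 p ∈ U ↔ p ≤ i) ∧ ∀ t, ∃ θ, ∀ p ≤ len t, f t p ∈ U ↔ p < θ) := by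
    intro n
    by_cases hn : 1 ≤ n ∧ n < N
    · have hng : 1 * g ≤ n * g := Nat.mul_le_mul_right _ hn.1
      have hng' : (n + 1) * g ≤ N * g := Nat.mul_le_mul_right _ hn.2
      rw [Nat.succ_mul] at hng'
      have hab := hτm (n * g - 1) (n * g) (by omega) (by omega)
      obtain ⟨hbl, hb⟩ := hpos _ (hτJ (n * g) (by omega))
      obtain ⟨hal, ha⟩ := hpos _ (hτJ (n * g - 1) (by omega))
      obtain ⟨i, h1, h2, h3⟩ : ∃ i, pos (τ (n * g - 1)) ≤ i ∧ i < pos (τ (n * g)) ∧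
          ∀ j, ¬ (f t0 i ∈ P j ∧ f t0 (i + 1) ∈ P j) := by
        by_contra hno
        push Not at hno
        have : ∀ p, pos (τ (n * g - 1)) ≤ p → p ≤ pos (τ (n * g)) → f t0 p ∈ P (τ (n * g - 1)) := by
          intro p hp
          induction p, hp using Nat.le_induction with
          | base => exact fun _ => ha
          | succ p hp ih =>
            intro hp'
            obtain ⟨j, h1, h2⟩ := hno p hp (by omega)
            rw [hPu _ _ _ (ih (by omega)) h1]; exact h2
        have := hτi _ (by omega) _ (by omega) (hPu _ _ _ (this _ hab.le le_rfl) hb)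
        omega
      obtain ⟨S, U, hS, hU1, hU2, hU3⟩ := cut f len hc hX hY hi hP t0 (i := i) (by omega) h3
        (hmin _ _ (hc t0 i (by omega)) h3)
      exact ⟨S, U, i, hS.le, fun _ _ => ⟨h1, h2, hU1, hU2, hU3⟩⟩
    · exact ⟨∅, ∅, 0, by simp, fun h1 h2 => absurd ⟨h1, h2⟩ hn⟩
  choose S U ii hSk hcut using hcut
  have hl : ∀ m, ∃ l, m < N → l < g ∧ ∀ n < N, Disjoint (P (τ (m * g + l))) (S n) := by
    intro m
    by_contra hno
    push Not at hno
    have hmN : m < N := (hno 0).1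
    have hng' : (m + 1) * g ≤ N * g := Nat.mul_le_mul_right _ hmN
    rw [Nat.succ_mul] at hng'
    have hz : ∀ l : Fin g, ∃ z ∈ P (τ (m * g + l)), ∃ n < N, z ∈ S n := fun l => by
      obtain ⟨n, hn, h⟩ := (hno l).2 l.2
      obtain ⟨z, h1, h2⟩ := Set.not_disjoint_iff.1 h
      exact ⟨z, h1, n, hn, h2⟩
    choose z hzP nn hnn hzS using hz
    have hzi : Function.Injective z := fun l l' he => by
      have := hτi _ (by omega) _ (by omega) (hPu _ _ _ (hzP l) (he ▸ hzP l'))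
      exact Fin.ext (by omega)
    have h1 : (Set.range z).ncard = g := by
      rw [← Set.image_univ, Set.ncard_image_of_injective _ hzi]; simp
    have h2 : Set.range z ⊆ ⋃ n ∈ Finset.range N, S n := by
      rintro _ ⟨l, rfl⟩
      exact Set.mem_biUnion (Finset.mem_coe.2 (Finset.mem_range.2 (hnn l))) (hzS l)
    have h3 := Set.ncard_le_ncard h2 (Set.toFinite _)
    have h4 := (Finset.set_ncard_biUnion_le (Finset.range N) S).trans
      (Finset.sum_le_card_nsmul _ _ k fun x _ => hSk x)
    rw [Finset.card_range, smul_eq_mul] at h4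
    omega
  choose l hl using hl
  have hidx : ∀ m, m < N → m * g + l m < N * g := fun m hmN => by
    have hng' : (m + 1) * g ≤ N * g := Nat.mul_le_mul_right _ hmN
    rw [Nat.succ_mul] at hng'
    have := (hl m hmN).1
    omega
  refine ⟨fun i => f (ρ i), fun i => len (ρ i), fun m => P (τ (m * g + l m)), ⟨fun i _ => hc _,
    fun i h i' h' p hp p' hp' he => ?_, fun n hn n' hn' hne => ?_,
    fun n hn i hi => hm _ (hτJ _ (hidx n hn)) _ (hρT i hi), ?_⟩, fun n _ => hP _⟩
  · have := hi _ _ _ _ hp hp' he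
    exact ⟨hρi i h i' h' this.1, this.2⟩
  · refine hPd _ _ fun he => hne ?_
    have := hτi _ (hidx n hn) _ (hidx n' hn') he
    have h1 := (hl n hn).1
    have h2 := (hl n' hn').1
    rcases lt_trichotomy n n' with hh | hh | hh
    · have := Nat.mul_le_mul_right g (show n + 1 ≤ n' from hh); rw [Nat.succ_mul] at this; omega
    · exact hh
    · have := Nat.mul_le_mul_right g (show n' + 1 ≤ n from hh); rw [Nat.succ_mul] at this; omega
  · intro n n' hnn hn' i hiq p hp p' hp' hpE hpE'
    have hn : n < N := by omega
    obtain ⟨h1, h2, h3, h4, h5⟩ := hcut n' (by omega) hn'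
    obtain ⟨θ, hθ⟩ := h5 (ρ i)
    have a1 := hpos _ (hτJ _ (hidx n hn))
    have a2 := hpos _ (hτJ _ (hidx n' hn'))
    have b1 : pos (τ (n * g + l n)) ≤ ii n' := by
      have := Nat.mul_le_mul_right g (show n + 1 ≤ n' from hnn)
      rw [Nat.succ_mul] at this
      have h1' := (hl n hn).1
      rcases Nat.lt_or_ge (n * g + l n) (n' * g - 1) with hh | hh
      · have := hτm _ _ hh (by have := hidx n' hn'; omega); omega
      · have : n * g + l n = n' * g - 1 := by omega
        rw [this]; exact h1
    have b2 : ii n' < pos (τ (n' * g + l n')) := by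
      rcases Nat.eq_zero_or_pos (l n') with hh | hh
      · rw [hh]; exact h2
      · have := hτm (n' * g) (n' * g + l n') (by omega) (hidx n' hn'); omega
    have c1 : f (ρ i) p ∈ U n' := h3 _ ((hl n hn).2 n' hn') _ a1.2 _ hpE ((h4 _ a1.1).2 b1)
    have c2 : f (ρ i) p' ∉ U n' := fun hU => by
      have := (h4 _ a2.1).1 (h3 _ ((hl n' hn').2 n' hn') _ hpE' _ a2.2 hU); omega
    rw [hθ p hp] at c1
    rw [hθ p' hp'] at c2
    omega

theorem linkage (k M : ℕ) : ∃ p, ∀ (V : Type) [Finite V] (G : SimpleGraph V) (X Y : Fin M → Set V),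
    (∀ e, Linked G (X e) (Y e) p) → (∃ R : Fin M → Set V, (∀ e, Conn G (R e) ∧
      (R e ∩ X e).Nonempty ∧ (R e ∩ Y e).Nonempty) ∧ ∀ e e', e ≠ e' → Disjoint (R e) (R e')) ∨
      HasMinor (Wall k) G := by
  classical
  induction M with
  | zero => exact ⟨0, fun V _ G X Y _ => Or.inl ⟨fun _ => ∅, fun e => e.elim0, fun e => e.elim0⟩⟩
  | succ M ih =>
  obtain ⟨p0, hp0⟩ := ih
  obtain ⟨q, N, hq, hN, hlad⟩ := ladder_wall k
  set k' := p0 + q with hk'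
  set p := k' + (M * 2 ^ k') * (N * (N * k' + 1)) + 1 with hp
  refine ⟨p, fun V _ G X Y hL => ?_⟩
  obtain ⟨c, hc, hcd⟩ := hL (Fin.last M)
  let F : SimpleGraph V := { Adj := fun x y => G.Adj x y ∧ ∃ j, x ∈ c j ∧ y ∈ c j
                             symm := ⟨fun _ _ h => ⟨h.1.symm, h.2.imp fun _ h => ⟨h.2, h.1⟩⟩⟩
                             loopless := ⟨fun _ h => G.irrefl h.1⟩ }
  have hFG : F ≤ G := fun _ _ h => h.1
  have hH : ∀ e : Fin M, ∃ H, (F ≤ H ∧ H ≤ G ∧ Linked H (X e.castSucc) (Y e.castSucc) k') ∧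
      ∀ H', F ≤ H' → H' ≤ G → Linked H' (X e.castSucc) (Y e.castSucc) k' → ¬ H' < H := by
    intro e
    obtain ⟨H, h1, h2⟩ := (wellFounded_lt (α := SimpleGraph V)).has_min
      {H | F ≤ H ∧ H ≤ G ∧ Linked H (X e.castSucc) (Y e.castSucc) k'}
      ⟨G, hFG, le_rfl, (hL e.castSucc).mono (by omega) le_rfl⟩
    exact ⟨H, h1, fun H' a b c => h2 H' ⟨a, b, c⟩⟩
  choose H hH hHm using hH
  have hd := fun e => (hH e).2.2
  choose d hd hdd using hd
  have hf : ∀ e t, ∃ f n, TP (H e) (d e t) (X e.castSucc) (Y e.castSucc) f n := fun e t =>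
    (hd e t).1.tp (hd e t).2.1 (hd e t).2.2
  choose f len hf using hf
  let T : Fin p → Fin M → Finset (Fin k') := fun j e =>
    Finset.univ.filter fun t => ∃ p ≤ len e t, f e t p ∈ c j
  by_cases hgood : ∃ j, ∀ e, (T j e).card ≤ q
  · obtain ⟨j, hj⟩ := hgood
    have := hp0 V (res G (c j)ᶜ) (fun e => X e.castSucc ∩ (c j)ᶜ) (fun e => Y e.castSucc ∩ (c j)ᶜ) ?_
    · rcases this with ⟨R, hR, hRd⟩ | h
      · left
        have hRc : ∀ e, Disjoint (R e) (c j) := fun e => by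
          have := (hR e).1.res_sub (by obtain ⟨z, hz, hz'⟩ := (hR e).2.1; exact ⟨z, hz, hz'.2⟩)
          rw [← Set.subset_compl_iff_disjoint_right]; exact this
        refine ⟨Fin.lastCases (c j) R, fun e => ?_, fun e e' => ?_⟩
        · induction e using Fin.lastCases with
          | last => simpa using hc j
          | cast e =>
            simp only [Fin.lastCases_castSucc]
            exact ⟨(hR e).1.mono (res_le _ _), (hR e).2.1.mono fun z hz => ⟨hz.1, hz.2.1⟩,
              (hR e).2.2.mono fun z hz => ⟨hz.1, hz.2.1⟩⟩
        · induction e using Fin.lastCases with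
          | last =>
            induction e' using Fin.lastCases with
            | last => exact fun h => absurd rfl h
            | cast e' => intro _; simpa using (hRc e').symm
          | cast e =>
            induction e' using Fin.lastCases with
            | last => intro _; simpa using hRc e
            | cast e' => intro h; simpa using hRd e e' fun h' => h (by rw [h'])
      · exact Or.inr (h.mono (res_le _ _))
    · intro e
      have hcard : p0 ≤ ((T j e)ᶜ).card := by
        rw [Finset.card_compl, Fintype.card_fin]; have := hj e; omega
      let em := Finset.orderEmbOfCardLe _ hcard
      have hem : ∀ i, ∀ p ≤ len e (em i), f e (em i) p ∈ (c j)ᶜ := fun i p hp h => by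
        have := Finset.orderEmbOfCardLe_mem _ hcard i
        rw [Finset.mem_compl] at this
        exact this (Finset.mem_filter.2 ⟨Finset.mem_univ _, p, hp, h⟩)
      refine ⟨fun i => f e (em i) '' Set.Icc 0 (len e (em i)), fun i => ⟨?_, ?_, ?_⟩, fun i i' hne => ?_⟩
      · refine conn_res (((hf e _).chn.seg (Nat.zero_le _) le_rfl).mono (hH e).2.1) ?_
        rintro _ ⟨p, hp, rfl⟩; exact hem i p hp.2
      · exact ⟨_, ⟨0, by simp, rfl⟩, (hf e _).fst, hem i 0 (Nat.zero_le _)⟩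
      · exact ⟨_, ⟨_, ⟨Nat.zero_le _, le_rfl⟩, rfl⟩, (hf e _).lst, hem i _ le_rfl⟩
      · refine (hdd e (em i) (em i') fun h => hne (em.injective h)).mono ?_ ?_ <;>
        · rintro _ ⟨p, hp, rfl⟩; exact (hf e _).mem p hp.2
  · push Not at hgood
    choose ef hef using hgood
    right
    obtain ⟨⟨e, T0⟩, -, hlt⟩ := Finset.exists_lt_card_fiber_of_mul_lt_card_of_maps_to
      (s := (Finset.univ : Finset (Fin p))) (t := (Finset.univ : Finset (Fin M × Finset (Fin k'))))
      (f := fun j => (ef j, T j (ef j))) (n := N * (N * k' + 1)) (fun _ _ => Finset.mem_univ _)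
      (by
        rw [Finset.card_univ, Finset.card_univ, Fintype.card_prod, Fintype.card_finset,
          Fintype.card_fin, Fintype.card_fin, Fintype.card_fin]; omega)
    set J := Finset.univ.filter fun j => (ef j, T j (ef j)) = (e, T0)
    have hJ : ∀ j ∈ J, ef j = e ∧ T j e = T0 := fun j hj => by
      have := (Finset.mem_filter.1 hj).2
      rw [Prod.mk.injEq] at this
      refine ⟨this.1, ?_⟩
      rw [← this.1]; exact this.2
    obtain ⟨j0, hj0⟩ : J.Nonempty := Finset.card_pos.1 (by omega)
    have : Nonempty (Fin p) := ⟨j0⟩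
    obtain ⟨R, len', E, hRL, hE⟩ := core (H := H e) (q := q) (N := N) (P := c) (f e) (len e)
      (fun t => (hf e t).chn) (fun t => (hf e t).fst) (fun t => (hf e t).lst)
      (fun t t' p p' hp hp' he => by
        have : t = t' := by
          by_contra hne
          exact Set.disjoint_left.1 (hdd e t t' hne) ((hf e t).mem p hp) (he ▸ (hf e t').mem p' hp')
        subst this
        exact ⟨rfl, (hf e t).inj p hp p' hp' he⟩)
      (fun j => (hc j).1.mono' fun x hx y hy h => (hH e).1 ⟨h, j, hx, hy⟩) hcd
      (fun x y hxy hfree hlink => by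
        refine hHm e _ ?_ ((SimpleGraph.deleteEdges_le _).trans (hH e).2.1) hlink ?_
        · intro a b hab
          rw [SimpleGraph.deleteEdges_adj]
          refine ⟨(hH e).1 hab, fun he => ?_⟩
          rw [Set.mem_singleton_iff, Sym2.eq_iff] at he
          obtain ⟨-, j, h1, h2⟩ := hab
          rcases he with ⟨rfl, rfl⟩ | ⟨rfl, rfl⟩
          exacts [hfree j ⟨h1, h2⟩, hfree j ⟨h2, h1⟩]
        · refine lt_of_le_of_ne (SimpleGraph.deleteEdges_le _) fun he => ?_
          rw [← he, SimpleGraph.deleteEdges_adj] at hxy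
          exact hxy.2 rfl)
      T0 hq (by
        have := hef j0
        rw [(hJ j0 hj0).1, (hJ j0 hj0).2] at this
        exact this.le) J hlt.le (fun j hj t ht => by
        rw [← (hJ j hj).2] at ht
        exact (Finset.mem_filter.1 ht).2)
    exact (hlad V (H e) R len' E hRL hE).mono (hH e).2.1

/-- the excluded grid theorem -/
theorem grid (k : ℕ) : ∃ n, ∀ (V : Type) [Finite V] (G : SimpleGraph V), HasBramble G n →
    HasMinor (Wall k) G := by
  classical
  let W := Fin k × Fin (2 * k)
  let m := Fintype.card W + 2
  choose p hp using linkage k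
  let P := ∑ M ∈ Finset.range (m * m + 1), p M
  refine ⟨2 * (m * (P + 1)) + (P + 1), fun V _ G hB => ?_⟩
  obtain ⟨K, A, hA, hAK, hAd, hAA⟩ := mesh m (P + 1) (by omega) (by omega) hB le_rfl
  let S : Finset (Fin m × Fin m) := Finset.univ.filter fun e => e.1 < e.2 ∧
    ¬ ∃ x ∈ A e.1, ∃ y ∈ A e.2, G.Adj x y
  have hSc : S.card < m * m + 1 := by
    have := Finset.card_le_univ S
    simp only [Fintype.card_prod, Fintype.card_fin] at this; omega
  have hpP : p S.card ≤ P := Finset.single_le_sum (f := p) (fun _ _ => Nat.zero_le _)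
    (Finset.mem_range.2 hSc)
  let ε := S.equivFin
  have hS : ∀ e : S, e.1.1 < e.1.2 ∧ ¬ ∃ x ∈ A e.1.1, ∃ y ∈ A e.1.2, G.Adj x y := fun e =>
    (Finset.mem_filter.1 e.2).2
  rcases hp S.card V (res G K) (fun e => Nb G (A (ε.symm e).1.1) ∩ K)
    (fun e => Nb G (A (ε.symm e).1.2) ∩ K) (fun e => by
      have := hS (ε.symm e)
      exact ((hAA _ _ this.1.ne).resolve_left this.2).mono (by omega) le_rfl) with ⟨R, hR, hRd⟩ | h
  swap
  · exact h.mono (res_le _ _)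
  have hRK : ∀ e, R e ⊆ K := fun e => (hR e).1.res_sub
    (by obtain ⟨z, hz, hz'⟩ := (hR e).2.1; exact ⟨z, hz, hz'.2⟩)
  have hminor : HasMinor (⊤ : SimpleGraph (Fin m)) G := by
    have key : ∀ i j : Fin m, i < j →
        ∃ x ∈ A i ∪ ⋃ e : {e // (ε.symm e).1.1 = i}, R e.1, ∃ y ∈ A j, G.Adj x y := by
      intro i j hij
      by_cases h : ∃ x ∈ A i, ∃ y ∈ A j, G.Adj x y
      · obtain ⟨x, hx, y, hy, hxy⟩ := h
        exact ⟨x, Or.inl hx, y, hy, hxy⟩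
      · let e : S := ⟨(i, j), Finset.mem_filter.2 ⟨Finset.mem_univ _, hij, h⟩⟩
        obtain ⟨y, hy, hy', -⟩ := (hR (ε e)).2.2
        rw [ε.symm_apply_apply] at hy'
        obtain ⟨-, c, hc, hcy⟩ := hy'
        exact ⟨y, Or.inr (Set.mem_iUnion.2 ⟨⟨ε e, by rw [ε.symm_apply_apply]⟩, hy⟩), c, hc, hcy.symm⟩
    refine ⟨fun i => A i ∪ ⋃ e : {e // (ε.symm e).1.1 = i}, R e.1, fun i => ?_, ?_, ?_⟩
    · refine (hA i).iUnion (fun e => (hR e.1).1.mono (res_le _ _)) fun e => Or.inr ?_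
      obtain ⟨y, hy, hy', -⟩ := (hR e.1).2.1
      obtain ⟨-, c, hc, hcy⟩ := hy'
      exact ⟨y, hy, c, e.2 ▸ hc, hcy.symm⟩
    · intro i j hij
      rw [Set.disjoint_left]
      rintro z (hz | hz) (hz' | hz')
      · exact Set.disjoint_left.1 (hAd i j hij) hz hz'
      · obtain ⟨e, he⟩ := Set.mem_iUnion.1 hz'
        exact Set.disjoint_left.1 (hAK i) hz (hRK _ he)
      · obtain ⟨e, he⟩ := Set.mem_iUnion.1 hz
        exact Set.disjoint_left.1 (hAK j) hz' (hRK _ he)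
      · obtain ⟨e, he⟩ := Set.mem_iUnion.1 hz
        obtain ⟨e', he'⟩ := Set.mem_iUnion.1 hz'
        refine Set.disjoint_left.1 (hRd e.1 e'.1 fun h => hij ?_) he he'
        rw [← e.2, ← e'.2, h]
    · intro i j hij
      rcases lt_or_gt_of_ne hij.ne with h | h
      · obtain ⟨x, hx, y, hy, hxy⟩ := key i j h
        exact ⟨x, hx, y, Or.inl hy, hxy⟩
      · obtain ⟨x, hx, y, hy, hxy⟩ := key j i h
        exact ⟨y, Or.inl hy, x, hx, hxy.symm⟩
  refine hminor.sub (fun w => Fin.castLE (by omega) (Fintype.equivFin W w)) ?_ ?_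
  · intro a b h
    exact (Fintype.equivFin W).injective (by simpa using h)
  · intro a b h
    rw [SimpleGraph.top_adj]
    intro h'
    exact h.ne ((Fintype.equivFin W).injective (by simpa using h'))

end
end Paper

namespace Paper
section
variable {V W : Type} {G H : SimpleGraph V} {s t : Set V}

theorem exists_avoid [Finite V] {m : ℕ} (R : Fin m → Set V)
    (dR : ∀ i j, i ≠ j → Disjoint (R i) (R j)) {X : Set V} (hX : X.ncard < m) :
    ∃ i, Disjoint (R i) X := by
  by_contra hc
  push Not at hc
  have : ∀ i, ∃ x, x ∈ R i ∧ x ∈ X := fun i => Set.not_disjoint_iff.1 (hc i)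
  choose f h1 h2 using this
  have hi : Function.Injective f := by
    intro i j hij
    by_contra h
    exact Set.disjoint_left.1 (dR i j h) (h1 i) (hij ▸ h1 j)
  have : (Set.range f).ncard ≤ X.ncard :=
    Set.ncard_le_ncard (by rintro _ ⟨i, rfl⟩; exact h2 i) (Set.toFinite _)
  rw [← Set.image_univ, Set.ncard_image_of_injective _ hi] at this
  simp at this; omega

theorem cross_bramble [Finite V] {m : ℕ} (R C : Fin m → Set V) (hR : ∀ i, Conn G (R i))
    (hC : ∀ i, Conn G (C i)) (dR : ∀ i j, i ≠ j → Disjoint (R i) (R j))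
    (dC : ∀ i j, i ≠ j → Disjoint (C i) (C j)) (hm : ∀ i j, (R i ∩ C j).Nonempty) :
    HasBramble G m := by
  refine ⟨{b | ∃ i j, b = R i ∪ C j}, ?_, fun X hX => ?_⟩
  · rintro _ ⟨i, j, rfl⟩ _ ⟨i', j', rfl⟩
    have h1 := (hR i).union (hC j) (hm i j)
    have h2 := (hR i').union (hC j') (hm i' j')
    obtain ⟨x, hx, hx'⟩ := hm i j'
    exact h1.union h2 ⟨x, Or.inl hx, Or.inr hx'⟩
  · obtain ⟨i, hi⟩ := exists_avoid R dR hX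
    obtain ⟨j, hj⟩ := exists_avoid C dC hX
    exact ⟨_, ⟨i, j, rfl⟩, Set.disjoint_union_left.2 ⟨hi, hj⟩⟩

theorem Conn.meet_sub {U : Set V} (h : Conn G s) (hc : ∀ x ∈ t, ∀ y ∈ U, G.Adj x y → y ∈ t)
    (hs : s ⊆ U) (hm : (s ∩ t).Nonempty) : s ⊆ t := by
  by_contra hn
  obtain ⟨a, ha, hat, b, hb, hbt, hab⟩ := h.cross hm hn
  exact hbt (hc a hat b (hs hb) hab)

theorem Conn.bags {K : SimpleGraph W} {b : Set W} (hb : Conn K b) {μ : W → Set V}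
    (hμ : ∀ w ∈ b, Conn G (μ w))
    (ha : ∀ w ∈ b, ∀ w' ∈ b, K.Adj w w' → ∃ x ∈ μ w, ∃ y ∈ μ w', G.Adj x y) :
    Conn G (⋃ w ∈ b, μ w) := by
  obtain ⟨w0, hw0⟩ := hb.1
  obtain ⟨x0, hx0⟩ := (hμ w0 hw0).1
  have hsub : ∀ w ∈ b, μ w ⊆ ⋃ w ∈ b, μ w := fun w hw => Set.subset_biUnion_of_mem (u := μ) hw
  refine ⟨⟨x0, hsub _ hw0 hx0⟩, fun t ht ⟨z, hz⟩ hc => ?_⟩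
  have key : ∀ w ∈ b, (μ w ∩ t).Nonempty → μ w ⊆ t := fun w hw hm =>
    (hμ w hw).meet_sub hc (hsub w hw) hm
  have := hb.2 {w ∈ b | μ w ⊆ t} (fun _ h => h.1) ?_ ?_
  · exact Set.iUnion₂_subset fun w hw => (this hw).2
  · obtain ⟨w, hw, hzw⟩ := Set.mem_iUnion₂.1 (ht hz)
    exact ⟨w, hw, key w hw ⟨z, hzw, hz⟩⟩
  · rintro w ⟨hw, hwt⟩ w' hw' hww
    obtain ⟨x, hx, y, hy, hxy⟩ := ha w hw w' hw' hww
    exact ⟨hw', key w' hw' ⟨y, hy, hc x (hwt hx) y (hsub w' hw' hy) hxy⟩⟩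

theorem bags_bramble [Finite V] [Finite W] {K : SimpleGraph W} {n : ℕ} (h : HasBramble K n)
    {μ : W → Set V} (hμ : ∀ w, Conn G (μ w)) (hd : ∀ w w', w ≠ w' → Disjoint (μ w) (μ w'))
    (ha : ∀ w w', K.Adj w w' → ∃ x ∈ μ w, ∃ y ∈ μ w', G.Adj x y) : HasBramble G n := by
  obtain ⟨β, h1, h2⟩ := h
  refine ⟨(fun b => ⋃ w ∈ b, μ w) '' β, ?_, fun X hX => ?_⟩
  · rintro _ ⟨b, hb, rfl⟩ _ ⟨b', hb', rfl⟩
    have := (h1 b hb b' hb').bags (fun w _ => hμ w) (fun w _ w' _ => ha w w')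
    rwa [Set.biUnion_union] at this
  · have hc : {w | ¬ Disjoint (μ w) X}.ncard ≤ X.ncard := by
      have : ∀ w, ∃ x, ¬ Disjoint (μ w) X → x ∈ μ w ∧ x ∈ X := fun w => by
        by_cases h : Disjoint (μ w) X
        · exact ⟨(hμ w).1.some, fun h' => (h' h).elim⟩
        · obtain ⟨x, hx⟩ := Set.not_disjoint_iff.1 h; exact ⟨x, fun _ => hx⟩
      choose f hf using this
      refine Set.ncard_le_ncard_of_injOn f (fun w hw => (hf w hw).2) ?_ (Set.toFinite _)
      intro w hw w' hw' hww
      by_contra hne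
      exact Set.disjoint_left.1 (hd _ _ hne) (hf w hw).1 (hww ▸ (hf w' hw').1)
    obtain ⟨b, hb, hbX⟩ := h2 _ (lt_of_le_of_lt hc hX)
    refine ⟨_, ⟨b, hb, rfl⟩, ?_⟩
    simp only [Set.disjoint_iUnion_left]
    intro w hw
    by_contra h
    exact Set.disjoint_left.1 hbX hw h

/-- contraction along `π` -/
def quo (G : SimpleGraph V) (π : V → V) : SimpleGraph V where
  Adj x y := x ≠ y ∧ ∃ a b, π a = x ∧ π b = y ∧ G.Adj a b
  symm := ⟨fun _ _ ⟨h, a, b, h1, h2, h3⟩ => ⟨h.symm, b, a, h2, h1, h3.symm⟩⟩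
  loopless := ⟨fun _ h => h.1 rfl⟩

theorem quo_bramble [Finite V] {π : V → V} {c n n' : ℕ} (hc : ∀ x, (π ⁻¹' {x}).ncard ≤ c)
    (hc0 : 0 < c) (hn : c * n' ≤ n) (h : HasBramble G n) : HasBramble (quo G π) n' := by
  obtain ⟨β, h1, h2⟩ := h
  refine ⟨(fun b => π '' b) '' β, ?_, fun X hX => ?_⟩
  · rintro _ ⟨b, hb, rfl⟩ _ ⟨b', hb', rfl⟩
    rw [← Set.image_union]
    refine (h1 b hb b' hb').image π fun x _ y _ hxy => ?_
    by_cases h : π x = π y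
    · exact Or.inl h
    · exact Or.inr ⟨h, x, y, rfl, rfl, hxy⟩
  · have : (π ⁻¹' X).ncard ≤ c * X.ncard := by
      classical
      have e : π ⁻¹' X = ⋃ x ∈ (Set.toFinite X).toFinset, π ⁻¹' {x} := by
        ext z; simp
      rw [e, mul_comm, Set.ncard_eq_toFinset_card X (Set.toFinite X)]
      exact (Finset.set_ncard_biUnion_le _ _).trans (Finset.sum_le_card_nsmul _ _ _ fun x _ => hc x)
    have h3 : c * X.ncard < c * n' := Nat.mul_lt_mul_of_pos_left hX hc0
    obtain ⟨b, hb, hbX⟩ := h2 (π ⁻¹' X) (by omega)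
    refine ⟨_, ⟨b, hb, rfl⟩, Set.disjoint_left.2 ?_⟩
    rintro _ ⟨z, hz, rfl⟩ hz'
    exact Set.disjoint_left.1 hbX hz hz'

/-- minimal model with ports -/
structure Tight (K : SimpleGraph W) (G : SimpleGraph V) (μ : W → Set V) (p : W → W → V) : Prop where
  conn : ∀ w, Conn G (μ w)
  dis : ∀ w w', w ≠ w' → Disjoint (μ w) (μ w')
  port : ∀ w w', K.Adj w w' → p w w' ∈ μ w
  adj : ∀ w w', K.Adj w w' → G.Adj (p w w') (p w' w)
  min : ∀ w F, F ⊆ μ w → Conn G F → (∀ w', K.Adj w w' → p w w' ∈ F) → F = μ w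

theorem tighten [Finite V] {K : SimpleGraph W} {μ : W → Set V} {p : W → W → V}
    (h1 : ∀ w, Conn G (μ w)) (h2 : ∀ w w', w ≠ w' → Disjoint (μ w) (μ w'))
    (h3 : ∀ w w', K.Adj w w' → p w w' ∈ μ w) (h4 : ∀ w w', K.Adj w w' → G.Adj (p w w') (p w' w)) :
    ∃ F : W → Set V, (∀ w, F w ⊆ μ w) ∧ Tight K G F p := by
  have : ∀ w, ∃ F ⊆ μ w, (Conn G F ∧ ∀ w', K.Adj w w' → p w w' ∈ F) ∧
      ∀ F' ⊆ F, Conn G F' → (∀ w', K.Adj w w' → p w w' ∈ F') → F' = F := by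
    intro w
    obtain ⟨F, ⟨hF, hF'⟩, hm⟩ := (wellFounded_lt (α := Set V)).has_min
      {F | F ⊆ μ w ∧ Conn G F ∧ ∀ w', K.Adj w w' → p w w' ∈ F} ⟨μ w, subset_rfl, h1 w, h3 w⟩
    refine ⟨F, hF, hF', fun F' h5 h6 h7 => ?_⟩
    by_contra hne
    exact hm F' ⟨h5.trans hF, h6, h7⟩ (lt_of_le_of_ne h5 hne)
  choose F hF hF' hm using this
  exact ⟨F, hF, fun w => (hF' w).1, fun w w' h => (h2 w w' h).mono (hF w) (hF w'),
    fun w => (hF' w).2, h4, fun w F' h5 h6 h7 => hm w F' h5 h6 h7⟩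

theorem ports {K : SimpleGraph W} {μ : W → Set V} [Nonempty V]
    (h3 : ∀ w w', K.Adj w w' → ∃ x ∈ μ w, ∃ y ∈ μ w', G.Adj x y) :
    ∃ p : W → W → V, ∀ w w', K.Adj w w' → p w w' ∈ μ w ∧ G.Adj (p w w') (p w' w) := by
  classical
  let _ : LinearOrder W := linearOrderOfSTO (WellOrderingRel (α := W))
  choose! X hX Y hY hXY using h3
  refine ⟨fun w w' => if w < w' then X w w' else Y w' w, fun w w' h => ?_⟩
  beta_reduce
  rcases lt_or_gt_of_ne h.ne with h' | h'
  · rw [if_pos h', if_neg h'.not_gt]; exact ⟨hX _ _ h, hXY _ _ h⟩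
  · rw [if_neg h'.not_gt, if_pos h']; exact ⟨hY _ _ h.symm, (hXY _ _ h.symm).symm⟩

theorem sat [Finite V] {K : SimpleGraph W} (hK : ∀ w, ∃ w', K.Adj w w') {π : V → V}
    (hπ : ∀ x, Conn G (π ⁻¹' {π x})) (h : HasMinor K (quo G π)) [Nonempty V] :
    ∃ (ν μ : W → Set V) (p : W → W → V), Tight K G μ p ∧ (∀ w, μ w ⊆ ν w) ∧ (∀ w w', w ≠ w' → Disjoint (ν w) (ν w')) ∧
      ∀ w x y, π x = π y → x ∈ ν w → y ∈ ν w := by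
  obtain ⟨μ, h1, h2, h3⟩ := h
  have hr : ∀ w, ∀ x ∈ μ w, ∃ a, π a = x := by
    intro w
    obtain ⟨w', hw⟩ := hK w
    obtain ⟨x, hx, y, hy, -, a, b, ha, -⟩ := h3 w w' hw
    by_contra hc
    push Not at hc
    obtain ⟨z, hz, hz'⟩ := hc
    obtain ⟨u, hu, hu', v, hv, hv', -, c, d, hc, hd, -⟩ := (h1 w).cross (A := Set.range π)
      ⟨x, hx, a, ha⟩ (fun h => (h hz).elim hz')
    exact hv' ⟨d, hd⟩
  have hc : ∀ w, Conn G (π ⁻¹' μ w) := by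
    intro w
    have := (h1 w).bags (G := G) (μ := fun x => π ⁻¹' {x}) (fun x hx => ?_) ?_
    · convert this using 1; ext z; simp
    · obtain ⟨a, rfl⟩ := hr w x hx; exact hπ a
    · rintro x _ y _ ⟨-, a, b, ha, hb, hab⟩
      exact ⟨a, ha, b, hb, hab⟩
  have hd : ∀ w w', w ≠ w' → Disjoint (π ⁻¹' μ w) (π ⁻¹' μ w') := fun w w' h =>
    (h2 w w' h).preimage π
  obtain ⟨p, hp⟩ := ports (G := G) (K := K) (μ := fun w => π ⁻¹' μ w) (by
    intro w w' hw
    obtain ⟨x, hx, y, hy, -, a, b, rfl, rfl, hab⟩ := h3 w w' hw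
    exact ⟨a, hx, b, hy, hab⟩)
  obtain ⟨F, hF, hT⟩ := tighten hc hd (fun w w' h => (hp w w' h).1) (fun w w' h => (hp w w' h).2)
  exact ⟨_, F, p, hT, hF, hd, fun w x y hxy hx => by
    rw [Set.mem_preimage] at hx ⊢; exact hxy ▸ hx⟩

/-- infinite wall -/
def IW : SimpleGraph (ℕ × ℕ) := SimpleGraph.fromRel (fun a b =>
    (a.1 = b.1 ∧ a.2 + 1 = b.2) ∨ (a.2 = b.2 ∧ a.1 + 1 = b.1 ∧ (a.1 + a.2) % 2 = 0))

def em {N : ℕ} (w : Fin N × Fin (2 * N)) : ℕ × ℕ := (w.1.val, w.2.val)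

theorem em_inj {N : ℕ} : Function.Injective (em (N := N)) := by
  rintro ⟨a, b⟩ ⟨c, d⟩ h
  simp only [em, Prod.mk.injEq] at h
  exact Prod.ext (Fin.ext h.1) (Fin.ext h.2)

theorem wall_iw {N : ℕ} (w w' : Fin N × Fin (2 * N)) : (Wall N).Adj w w' ↔ IW.Adj (em w) (em w') := by
  simp only [Wall, IW, SimpleGraph.fromRel_adj, em, Fin.ext_iff, ne_eq, Prod.ext_iff]

theorem conn_wall {N : ℕ} {b : Set (ℕ × ℕ)} (h : Conn IW b) (hb : ∀ x ∈ b, x.1 < N ∧ x.2 < 2 * N) :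
    Conn (Wall N) (em ⁻¹' b) := by
  have hs : ∀ x ∈ b, ∃ w : Fin N × Fin (2 * N), em w = x := fun x hx =>
    ⟨(⟨x.1, (hb x hx).1⟩, ⟨x.2, (hb x hx).2⟩), rfl⟩
  obtain ⟨x, hx⟩ := h.1
  obtain ⟨w, rfl⟩ := hs x hx
  refine ⟨⟨w, hx⟩, fun t ht hn hc => ?_⟩
  have := h.2 (em '' t) (by rintro _ ⟨z, hz, rfl⟩; exact ht hz) (hn.image _) ?_
  · intro z hz
    obtain ⟨z', hz', e⟩ := this hz
    exact em_inj e ▸ hz'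
  · rintro _ ⟨z, hz, rfl⟩ y hy hzy
    obtain ⟨w', rfl⟩ := hs y hy
    exact ⟨w', hc z hz w' hy ((wall_iw _ _).2 hzy), rfl⟩

def gz (b n : ℕ) : ℕ × ℕ := (n / 2, 2 * b + (n + n / 2 + 1) % 2)

theorem row_chn (r n : ℕ) : Chn IW (fun c => (r, c)) n := by
  intro i _; simp [IW]

theorem gz_chn (b n : ℕ) : Chn IW (gz b) n := by
  intro i _
  simp only [IW, SimpleGraph.fromRel_adj, gz, ne_eq, Prod.mk.injEq]
  omega

theorem wall_bramble (N : ℕ) : HasBramble (Wall N) N := by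
  refine cross_bramble (fun i => em ⁻¹' ((fun c => (i.val, c)) '' Set.Icc 0 (2 * N - 1)))
    (fun j => em ⁻¹' (gz j.val '' Set.Icc 0 (2 * N - 1))) ?_ ?_ ?_ ?_ ?_
  · intro i
    refine conn_wall ((row_chn _ _).seg (by omega) le_rfl) ?_
    rintro _ ⟨c, hc, rfl⟩
    have := i.2; have := hc.2
    exact ⟨i.2, by dsimp only; omega⟩
  · intro i
    refine conn_wall ((gz_chn _ _).seg (by omega) le_rfl) ?_
    rintro _ ⟨c, hc, rfl⟩
    have := i.2; have := hc.2
    simp only [gz]; omega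
  · intro i j hij
    refine Disjoint.preimage _ (Set.disjoint_left.2 ?_)
    rintro _ ⟨c, hc, rfl⟩ ⟨d, hd, h⟩
    simp only [Prod.mk.injEq] at h
    exact hij (Fin.ext h.1.symm)
  · intro i j hij
    refine Disjoint.preimage _ (Set.disjoint_left.2 ?_)
    rintro _ ⟨c, hc, rfl⟩ ⟨d, hd, h⟩
    simp only [gz, Prod.mk.injEq] at h
    exact hij (Fin.ext (by omega))
  · intro i j
    have := i.2; have := j.2
    refine ⟨(i, ⟨2 * j.val + (2 * i.val + i.val + 1) % 2, by omega⟩), ⟨_, ⟨Nat.zero_le _, ?_⟩, rfl⟩,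
      ⟨2 * i.val, ⟨Nat.zero_le _, by omega⟩, ?_⟩⟩
    · dsimp only; omega
    · simp only [gz, em, Prod.mk.injEq]; omega

theorem wall_nbr {N : ℕ} (w : Fin N × Fin (2 * N)) : ∃ w', (Wall N).Adj w w' := by
  obtain ⟨⟨i, hi⟩, ⟨j, hj⟩⟩ := w
  by_cases h : j = 0
  · exact ⟨(⟨i, hi⟩, ⟨j + 1, by omega⟩), by rw [wall_iw]; simp [IW, em]⟩
  · exact ⟨(⟨i, hi⟩, ⟨j - 1, by omega⟩), by
      rw [wall_iw]; simp only [IW, em, SimpleGraph.fromRel_adj, ne_eq, Prod.mk.injEq, true_and]; omega⟩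

theorem iw_nbr {x y : ℕ × ℕ} (h : IW.Adj x y) : y = (x.1, x.2 + 1) ∨ (x.2 ≠ 0 ∧ y = (x.1, x.2 - 1)) ∨
    ((x.1 + x.2) % 2 = 0 ∧ y = (x.1 + 1, x.2)) ∨ ((x.1 + x.2) % 2 = 1 ∧ x.1 ≠ 0 ∧ y = (x.1 - 1, x.2)) := by
  simp only [IW, SimpleGraph.fromRel_adj] at h
  obtain ⟨a, b⟩ := x
  obtain ⟨c, d⟩ := y
  simp only [Prod.mk.injEq] at *
  omega

theorem HasMinor.bramble [Finite V] {N : ℕ} (h : HasMinor (Wall N) G) : HasBramble G N := by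
  obtain ⟨μ, h1, h2, h3⟩ := h
  exact bags_bramble (wall_bramble N) h1 h2 h3

theorem HasBramble.mono {n m : ℕ} (h : HasBramble G n) (hm : m ≤ n) : HasBramble G m := by
  obtain ⟨β, h1, h2⟩ := h
  exact ⟨β, h1, fun X hX => h2 X (by omega)⟩

theorem HasBramble.ne {n : ℕ} (h : HasBramble G (n + 1)) : Nonempty V := by
  obtain ⟨β, h1, h2⟩ := h
  obtain ⟨b, hb, -⟩ := h2 ∅ (by simp)
  obtain ⟨x, _⟩ := (h1 b hb b hb).1
  exact ⟨x⟩

theorem res_res (G : SimpleGraph V) (U U' : Set V) : res (res G U) U' = res G (U ∩ U') := by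
  ext x y; simp only [res, Set.mem_inter_iff]; tauto

/-- grid + lift + tighten -/
theorem satW (N c : ℕ) (hc0 : 0 < c) : ∃ n, ∀ (V : Type) [Finite V] (G : SimpleGraph V) (π : V → V),
    (∀ x, (π ⁻¹' {x}).ncard ≤ c) → (∀ x, Conn G (π ⁻¹' {π x})) → HasBramble G n →
    ∃ (ν μ : Fin N × Fin (2 * N) → Set V) (p : _ → _ → V), Tight (Wall N) G μ p ∧ (∀ w, μ w ⊆ ν w) ∧ (∀ w w', w ≠ w' → Disjoint (ν w) (ν w')) ∧
      ∀ w x y, π x = π y → x ∈ ν w → y ∈ ν w := by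
  obtain ⟨n, hn⟩ := grid N
  refine ⟨c * n + 1, fun V _ G π h1 h2 hb => ?_⟩
  have := hb.ne
  exact sat wall_nbr h2 (hn V _ (quo_bramble h1 hc0 (by omega) hb))

theorem Tight.bramble [Finite V] {N : ℕ} {μ : Fin N × Fin (2 * N) → Set V} {p}
    (h : Tight (Wall N) G μ p) : HasBramble (res G (⋃ w, μ w)) N :=
  bags_bramble (wall_bramble N) (fun w => conn_res (h.conn w) (Set.subset_iUnion _ w)) h.dis
    fun w w' hw => ⟨_, h.port w w' hw, _, h.port w' w hw.symm, h.adj w w' hw,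
      Set.mem_iUnion.2 ⟨w, h.port w w' hw⟩, Set.mem_iUnion.2 ⟨w', h.port w' w hw.symm⟩⟩
end
end Paper

namespace Paper
section
variable {V W : Type} {G H : SimpleGraph V} {s t F : Set V} {v : V}

theorem geo (hF : Conn G F) (hv : v ∈ F) : ∃ d : V → ℕ,
    (∀ x ∈ F, ∀ y ∈ F, G.Adj x y → d y ≤ d x + 1) ∧ ∀ u ∈ F, ∃ f : ℕ → V, f 0 = v ∧ f (d u) = u ∧
      (∀ j ≤ d u, f j ∈ F ∧ d (f j) = j) ∧ Chn G f (d u) := by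
  have hF' := conn_res hF subset_rfl
  have hne : ∀ x ∈ F, {r | x ∈ bl (res G F) v r}.Nonempty := by
    intro x hx
    obtain ⟨f, n, h1, rfl, rfl, -⟩ := hF'.chn hv hx
    exact ⟨n, bl_chn h1 le_rfl⟩
  set d : V → ℕ := fun x => sInf {r | x ∈ bl (res G F) v r} with hd
  have hdm : ∀ x ∈ F, x ∈ bl (res G F) v (d x) := fun x hx => Nat.sInf_mem (hne x hx)
  have hdl : ∀ x r, x ∈ bl (res G F) v r → d x ≤ r := fun x r h => Nat.sInf_le h
  have hlev : ∀ x ∈ F, ∀ y ∈ F, G.Adj x y → d y ≤ d x + 1 := fun x hx y hy h =>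
    hdl _ _ ⟨x, hdm x hx, Or.inr ⟨h, hx, hy⟩⟩
  refine ⟨d, hlev, ?_⟩
  have : ∀ r, ∀ u ∈ F, d u = r → ∃ f : ℕ → V, f 0 = v ∧ f r = u ∧
      (∀ j ≤ r, f j ∈ F ∧ d (f j) = j) ∧ Chn G f r := by
    intro r
    induction r with
    | zero =>
      intro u hu hr
      have := hdm u hu
      rw [hr] at this
      obtain rfl : u = v := this
      exact ⟨fun _ => u, rfl, rfl, fun j hj => ⟨hu, by rw [hr]; omega⟩, fun i hi => by omega⟩
    | succ r ih =>
      intro u hu hr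
      have := hdm u hu
      rw [hr] at this
      obtain ⟨x, hx, rfl | hxu⟩ := this
      · have := hdl _ _ hx; omega
      have h1 := hlev x hxu.2.1 u hu hxu.1
      have h2 := hdl _ _ hx
      obtain ⟨f, h3, h4, h5, h6⟩ := ih x hxu.2.1 (by omega)
      refine ⟨fun j => if j ≤ r then f j else u, by simpa using h3, by simp, ?_, ?_⟩
      · intro j hj
        beta_reduce
        split_ifs with h
        · exact h5 j h
        · exact ⟨hu, by omega⟩
      · intro j hj
        beta_reduce
        rw [if_pos (by omega)]
        split_ifs with h
        · exact h6 j (by omega)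
        · rw [show j = r by omega, h4]; exact hxu.1
  exact fun u hu => this _ u hu rfl

structure Geo3 (G : SimpleGraph V) (F : Set V) (v : V) (q : Fin 3 → V) (d : V → ℕ)
    (f : Fin 3 → ℕ → V) (n : Fin 3 → ℕ) : Prop where
  lev : ∀ x ∈ F, ∀ y ∈ F, G.Adj x y → d y ≤ d x + 1
  zero : ∀ x ∈ F, d x = 0 → x = v
  st : ∀ i, f i 0 = v
  en : ∀ i, f i (n i) = q i
  mem : ∀ i, ∀ j ≤ n i, f i j ∈ F
  dl : ∀ i, ∀ j ≤ n i, d (f i j) = j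
  chn : ∀ i, Chn G (f i) (n i)
  min : ∀ F' ⊆ F, Conn G F' → (∀ i, q i ∈ F') → F' = F
  all : ∀ x ∈ F, ∃ i, x = f i (d x) ∧ d x ≤ n i

theorem geo3 (hF : Conn G F) (hv : v ∈ F) {q : Fin 3 → V} (hq : ∀ i, q i ∈ F)
    (hm : ∀ F' ⊆ F, Conn G F' → (∀ i, q i ∈ F') → F' = F) : ∃ d f n, Geo3 G F v q d f n := by
  obtain ⟨d, h1, h2⟩ := geo hF hv
  choose! f h3 h4 h5 h6 using h2
  have hall : (⋃ i, f (q i) '' Set.Icc 0 (d (q i))) = F := by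
    refine hm _ (Set.iUnion_subset fun i => ?_) ?_ fun i => Set.mem_iUnion.2 ⟨i, d (q i), ⟨by simp, le_rfl⟩, h4 _ (hq i)⟩
    · rintro _ ⟨j, hj, rfl⟩; exact (h5 _ (hq i) j hj.2).1
    · have := (Conn.single (G := G) v).iUnion (f := fun i => f (q i) '' Set.Icc 0 (d (q i)))
        (fun i => (h6 _ (hq i)).seg (by simp) le_rfl) fun i => Or.inl ⟨v, ⟨0, by simp, h3 _ (hq i)⟩, rfl⟩
      rwa [Set.union_eq_right.2] at this
      rintro _ rfl
      exact Set.mem_iUnion.2 ⟨0, 0, by simp, h3 _ (hq 0)⟩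
  refine ⟨d, fun i => f (q i), fun i => d (q i), h1, ?_, fun i => h3 _ (hq i), fun i => h4 _ (hq i),
    fun i j hj => (h5 _ (hq i) j hj).1, fun i j hj => (h5 _ (hq i) j hj).2, fun i => h6 _ (hq i), hm, ?_⟩
  · intro x hx h0
    have := h4 x hx
    rw [h0, h3 x hx] at this
    exact this.symm
  · intro x hx
    rw [← hall] at hx
    obtain ⟨i, j, hj, rfl⟩ := Set.mem_iUnion.1 hx
    have := (h5 _ (hq i) j hj.2).2
    exact ⟨i, by rw [this], by rw [this]; exact hj.2⟩

variable {q : Fin 3 → V} {d : V → ℕ} {f : Fin 3 → ℕ → V} {n : Fin 3 → ℕ}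

theorem fin3 : ∀ i j k : Fin 3, i ≠ j → i ≠ k → j ≠ k → ∀ l, l = i ∨ l = j ∨ l = k := by decide

theorem Geo3.geo (g : Geo3 G F v q d f n) {i j k : Fin 3} (hl : ∀ l, l = i ∨ l = j ∨ l = k)
    (hij : f i 1 ≠ f j 1) (hk : n k = 0 ∨ f k 1 ≠ f j 1) {s t : ℕ} (hs : s ≤ n i)
    (ht : t ≤ n j) (ht1 : 1 ≤ t) (h : f i s = f j t ∨ G.Adj (f i s) (f j t)) : t = 1 := by
  by_contra hne
  have c1 : Conn G (f i '' Set.Icc 0 (n i) ∪ f j '' Set.Icc t (n j)) := by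
    have h1 := (g.chn i).seg (Nat.zero_le (n i)) le_rfl
    have h2 := (g.chn j).seg ht le_rfl
    rcases h with h | h
    · exact h1.union h2 ⟨f i s, ⟨s, ⟨by omega, hs⟩, rfl⟩, ⟨t, ⟨le_rfl, ht⟩, h.symm⟩⟩
    · exact h1.union_adj h2 ⟨s, ⟨by omega, hs⟩, rfl⟩ ⟨t, ⟨le_rfl, ht⟩, rfl⟩ h
  have c2 := c1.union ((g.chn k).seg (Nat.zero_le (n k)) le_rfl)
    ⟨v, Or.inl ⟨0, by simp, g.st i⟩, ⟨0, by simp, g.st k⟩⟩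
  have e := g.min _ ?_ c2 ?_
  · have := g.mem j 1 (by omega)
    have hd := g.dl j 1 (by omega)
    rw [← e] at this
    rcases this with (⟨u, hu, e⟩ | ⟨u, hu, e⟩) | ⟨u, hu, e⟩
    · have := g.dl i u hu.2
      rw [e, hd] at this; subst this
      exact hij e
    · have := g.dl j u hu.2
      rw [e, hd] at this; have := hu.1; omega
    · have := g.dl k u hu.2
      rw [e, hd] at this; subst this
      rcases hk with h | h
      · have := hu.2; omega
      · exact h e
  · rintro _ ((⟨u, hu, rfl⟩ | ⟨u, hu, rfl⟩) | ⟨u, hu, rfl⟩)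
    · exact g.mem _ _ hu.2
    · exact g.mem _ _ hu.2
    · exact g.mem _ _ hu.2
  · intro l
    rw [← g.en]
    rcases hl l with rfl | rfl | rfl
    · exact Or.inl (Or.inl ⟨_, by simp, rfl⟩)
    · exact Or.inl (Or.inr ⟨_, ⟨ht, le_rfl⟩, rfl⟩)
    · exact Or.inr ⟨_, by simp, rfl⟩

theorem Geo3.vmem (g : Geo3 G F v q d f n) : v ∈ F := g.st 0 ▸ g.mem 0 0 (by omega)

theorem Geo3.nbr (g : Geo3 G F v q d f n) {x : V} (hx : x ∈ F) (h : G.Adj v x) :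
    ∃ i, x = f i 1 ∧ 1 ≤ n i := by
  have h1 := g.lev v g.vmem x hx h
  have h2 : d v = 0 := by have := g.dl 0 0 (by omega); rwa [g.st] at this
  have h3 : d x ≠ 0 := fun h' => h.ne (g.zero x hx h').symm
  obtain ⟨i, hi, hi'⟩ := g.all x hx
  rw [show d x = 1 by omega] at hi hi'
  exact ⟨i, hi, hi'⟩

/-- in-bag neighbours -/
theorem Geo3.pos (g : Geo3 G F v q d f n) {i : Fin 3} {s : ℕ} (hs : s ≤ n i) {x : V} (hx : x ∈ F)
    (h : G.Adj (f i s) x) : ∃ j t, x = f j t ∧ t ≤ n j ∧ d x = t ∧ t ≤ s + 1 ∧ s ≤ t + 1 := by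
  obtain ⟨j, hj, hj'⟩ := g.all x hx
  have h1 := g.lev _ (g.mem i s hs) x hx h
  have h2 := g.lev x hx _ (g.mem i s hs) h.symm
  rw [g.dl i s hs] at h1 h2
  exact ⟨j, d x, hj, hj', rfl, h1, h2⟩

theorem Geo3.link (g : Geo3 G F v q d f n) {i j k : Fin 3} (hl : ∀ l, l = i ∨ l = j ∨ l = k)
    (hi : 1 ≤ n i) (hj : 1 ≤ n j) (hk : 1 ≤ n k) (h1 : G.Adj (f i 1) (f j 1))
    (h2 : f j 1 = f k 1 ∨ f i 1 = f k 1 ∨ G.Adj (f j 1) (f k 1)) : False := by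
  have c : ∀ l, 1 ≤ n l → Conn G (f l '' Set.Icc 1 (n l)) := fun l h => (g.chn l).seg h le_rfl
  have m : ∀ l, 1 ≤ n l → f l 1 ∈ f l '' Set.Icc 1 (n l) := fun l h => ⟨1, ⟨le_rfl, h⟩, rfl⟩
  have c1 := (c i hi).union_adj (c j hj) (m i hi) (m j hj) h1
  have c2 : Conn G ((f i '' Set.Icc 1 (n i) ∪ f j '' Set.Icc 1 (n j)) ∪ f k '' Set.Icc 1 (n k)) := by
    rcases h2 with h2 | h2 | h2
    · exact c1.union (c k hk) ⟨_, Or.inr (m j hj), h2 ▸ m k hk⟩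
    · exact c1.union (c k hk) ⟨_, Or.inl (m i hi), h2 ▸ m k hk⟩
    · exact c1.union_adj (c k hk) (Or.inr (m j hj)) (m k hk) h2
  have e := g.min _ ?_ c2 ?_
  · have := g.vmem
    have h0 : d v = 0 := by have := g.dl 0 0 (by omega); rwa [g.st] at this
    rw [← e] at this
    rcases this with (⟨u, hu, e⟩ | ⟨u, hu, e⟩) | ⟨u, hu, e⟩ <;>
    · have h3 := g.dl _ u hu.2
      rw [e, h0] at h3
      have := hu.1; omega
  · rintro _ ((⟨u, hu, rfl⟩ | ⟨u, hu, rfl⟩) | ⟨u, hu, rfl⟩)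
    · exact g.mem _ _ hu.2
    · exact g.mem _ _ hu.2
    · exact g.mem _ _ hu.2
  · intro l
    rw [← g.en]
    rcases hl l with rfl | rfl | rfl
    · exact Or.inl (Or.inl ⟨_, ⟨hi, le_rfl⟩, rfl⟩)
    · exact Or.inl (Or.inr ⟨_, ⟨hj, le_rfl⟩, rfl⟩)
    · exact Or.inr ⟨_, ⟨hk, le_rfl⟩, rfl⟩

def Clean (G : SimpleGraph V) (v : V) : Prop := ∀ a b c, G.Adj v a → G.Adj v b → G.Adj v c →
  a ≠ b → a ≠ c → b ≠ c → (∀ e, G.Adj v e → e = a ∨ e = b ∨ e = c) ∧ ¬(G.Adj a b ∧ G.Adj b c) ∧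
    (¬G.Adj a b → ¬G.Adj a c → ∀ x y, G.Adj a x → G.Adj a y → x ≠ v → y ≠ v → x = y)

theorem Clean.res (h : Clean G v) (U : Set V) : Clean (res G U) v := by
  intro a b c ha hb hc h1 h2 h3
  obtain ⟨h4, h5, h6⟩ := h a b c ha.1 hb.1 hc.1 h1 h2 h3
  exact ⟨fun e he => h4 e he.1, fun h => h5 ⟨h.1.1, h.2.1⟩, fun h7 h8 x y hx hy =>
    h6 (fun h => h7 ⟨h, ha.2.2, hb.2.2⟩) (fun h => h8 ⟨h, ha.2.2, hc.2.2⟩) x y hx.1 hy.1⟩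

theorem Geo3.clean (g : Geo3 G F v q d f n) {U : Set V} (h1 : ∀ a ∈ U, G.Adj v a → a ∈ F)
    (h2 : ∀ a ∈ U, G.Adj v a → ∀ x ∈ U, G.Adj a x → x ∈ F) : Clean (res G U) v := by
  intro a b c ha hb hc hab hac hbc
  obtain ⟨i, rfl, hi⟩ := g.nbr (h1 a ha.2.2 ha.1) ha.1
  obtain ⟨j, rfl, hj⟩ := g.nbr (h1 b hb.2.2 hb.1) hb.1
  obtain ⟨k, rfl, hk⟩ := g.nbr (h1 c hc.2.2 hc.1) hc.1
  have hl := fin3 i j k (fun h => hab (by rw [h])) (fun h => hac (by rw [h])) (fun h => hbc (by rw [h]))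
  refine ⟨fun e he => ?_, fun ⟨h3, h4⟩ => g.link hl hi hj hk h3.1 (Or.inr (Or.inr h4.1)), ?_⟩
  · obtain ⟨l, rfl, -⟩ := g.nbr (h1 e he.2.2 he.1) he.1
    rcases hl l with rfl | rfl | rfl <;> simp
  · intro h3 h4
    have key : ∀ x, (Paper.res G U).Adj (f i 1) x → x ≠ v → x = f i 2 := by
      intro x hx hxv
      have hxF := h2 _ ha.2.2 ha.1 x hx.2.2 hx.1
      obtain ⟨l, t, rfl, ht, hdt, ht1, -⟩ := g.pos hi hxF hx.1
      have t0 : t ≠ 0 := fun h => hxv (by rw [h, g.st])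
      rcases hl l with rfl | rfl | rfl
      · have : t ≠ 1 := fun h => hx.1.ne (by rw [h])
        rw [show t = 2 by omega]
      · have := g.geo hl hab (Or.inr hbc.symm) hi ht (by omega) (Or.inr hx.1)
        subst this; exact (h3 hx).elim
      · have := g.geo (k := j) (fun l' => by have := hl l'; tauto) hac (Or.inr hbc) hi ht (by omega) (Or.inr hx.1)
        subst this; exact (h4 hx).elim
    intro x y hx hy hxv hyv
    rw [key x hx hxv, key y hy hyv]

def Sub3 (K : SimpleGraph W) : Prop := ∀ w, ∃ a : Fin 3 → W, ∀ w', K.Adj w w' → ∃ i, w' = a i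

theorem Tight.geo {K : SimpleGraph W} {μ : W → Set V} {p : W → W → V} (h : Tight K G μ p) {w : W}
    (hv : v ∈ μ w) {a : Fin 3 → W} (ha : ∀ w', K.Adj w w' → ∃ i, w' = a i) :
    ∃ q d f n, Geo3 G (μ w) v q d f n ∧ ∀ i, (K.Adj w (a i) ∧ q i = p w (a i)) ∨ (¬K.Adj w (a i) ∧ q i = v) := by
  classical
  have hq : ∀ i, ∃ x, (K.Adj w (a i) ∧ x = p w (a i)) ∨ (¬K.Adj w (a i) ∧ x = v) := fun i => by
    by_cases hi : K.Adj w (a i)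
    · exact ⟨_, Or.inl ⟨hi, rfl⟩⟩
    · exact ⟨_, Or.inr ⟨hi, rfl⟩⟩
  choose q hq using hq
  obtain ⟨d, f, n, g⟩ := geo3 (h.conn w) hv (q := q) (fun i => by
    rcases hq i with ⟨h1, h2⟩ | ⟨h1, h2⟩
    · rw [h2]; exact h.port w _ h1
    · rw [h2]; exact hv) (fun F' h1 h2 h3 => h.min w F' h1 h2 fun w' hw => by
    obtain ⟨i, rfl⟩ := ha w' hw
    rcases hq i with ⟨h1, h2⟩ | ⟨h1, h2⟩
    · rw [← h2]; exact h3 i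
    · exact (h1 hw).elim)
  exact ⟨q, d, f, n, g, hq⟩

theorem Conn.leaf (hs : Conn G s) {x y0 : V} (h : ∀ y ∈ s, G.Adj x y → y = y0)
    (hne : ∃ y ∈ s, y ≠ x) : Conn G (s \ {x}) := by
  obtain ⟨y, hy, hyx⟩ := hne
  refine ⟨⟨y, hy, hyx⟩, fun t ht hn hc => ?_⟩
  have h1 := hs.2 (t ∪ {z | z = x ∧ z ∈ s ∧ y0 ∈ t}) ?_ (hn.mono Set.subset_union_left) ?_
  · intro z hz
    rcases h1 hz.1 with h | h
    · exact h
    · exact (hz.2 h.1).elim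
  · rintro z (hz | hz)
    · exact (ht hz).1
    · exact hz.2.1
  · rintro a (ha | ⟨rfl, has, ha⟩) b hb hab
    · by_cases hbx : b = x
      · subst hbx
        exact Or.inr ⟨rfl, hb, h a (ht ha).1 hab.symm ▸ ha⟩
      · exact Or.inl (hc a ha b ⟨hb, hbx⟩ hab)
    · exact Or.inl (h b hb hab ▸ ha)

theorem Tight.deg2 {K : SimpleGraph W} {μ : W → Set V} {p : W → W → V} (h : Tight K G μ p) {w : W}
    {x : V} (hx : x ∈ μ w) : μ w = {x} ∨ (∃ y ∈ μ w, ∃ z ∈ μ w, y ≠ z ∧ G.Adj x y ∧ G.Adj x z) ∨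
      ∃ y ∈ μ w, G.Adj x y ∧ ∃ w', K.Adj w w' ∧ x = p w w' := by
  by_cases h1 : ∃ y ∈ μ w, y ≠ x
  · right
    obtain ⟨y, hy, hxy⟩ := (h.conn w).nbr hx h1
    by_contra hc
    push Not at hc
    have := h.min w _ Set.sdiff_subset ((h.conn w).leaf (x := x) (y0 := y) (fun z hz hxz => by
      by_contra hne
      exact hc.1 z hz y hy hne hxz hxy) h1) fun w' hw => ⟨h.port w w' hw, fun e => hc.2 y hy hxy w' hw e.symm⟩
    rw [← this] at hx
    exact hx.2 rfl
  · push Not at h1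
    exact Or.inl (Set.eq_singleton_iff_unique_mem.2 ⟨hx, h1⟩)
end
end Paper

namespace Paper
section
variable {V W : Type} {G H : SimpleGraph V} {s t : Set V} {v : V}

theorem sub3_wall (N : ℕ) : Sub3 (Wall N) := by
  intro w
  have : ∃ a : Fin 3 → ℕ × ℕ, ∀ y, IW.Adj (em w) y → ∃ i, y = a i := by
    refine ⟨![((em w).1, (em w).2 + 1), ((em w).1, (em w).2 - 1),
      (if ((em w).1 + (em w).2) % 2 = 0 then (em w).1 + 1 else (em w).1 - 1, (em w).2)], fun y hy => ?_⟩
    rcases iw_nbr hy with h | ⟨-, h⟩ | ⟨h1, h⟩ | ⟨h1, -, h⟩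
    · exact ⟨0, h⟩
    · exact ⟨1, h⟩
    · exact ⟨2, by simp [h, h1]⟩
    · exact ⟨2, by simp [h, h1]⟩
  obtain ⟨a, ha⟩ := this
  have : ∀ i, ∃ z : Fin N × Fin (2 * N), ∀ w', em w' = a i → w' = z := fun i => by
    by_cases h : ∃ z : Fin N × Fin (2 * N), em z = a i
    · obtain ⟨z, hz⟩ := h
      exact ⟨z, fun w' hw => em_inj (hw.trans hz.symm)⟩
    · exact ⟨w, fun w' hw => (h ⟨w', hw⟩).elim⟩
  choose z hz using this
  exact ⟨z, fun w' hw => (ha _ ((wall_iw _ _).1 hw)).imp fun i hi => hz i w' hi⟩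

theorem wall_corner {N : ℕ} (hN : 0 < N) : ∃ cr : Fin 3 → Fin N × Fin (2 * N), ∀ w, (∃ i, w = cr i) ∨
    ∃ w1 w2, w1 ≠ w2 ∧ (Wall N).Adj w w1 ∧ (Wall N).Adj w w2 := by
  refine ⟨![(⟨0, hN⟩, ⟨2 * N - 1, by omega⟩), (⟨N - 1, by omega⟩, ⟨0, by omega⟩),
    (⟨N - 1, by omega⟩, ⟨2 * N - 1, by omega⟩)], ?_⟩
  rintro ⟨⟨i, hi⟩, ⟨j, hj⟩⟩
  by_contra hc
  push Not at hc
  obtain ⟨h1, h2⟩ := hc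
  have e0 := h1 0
  have e1 := h1 1
  have e2 := h1 2
  simp [Fin.ext_iff] at e0 e1 e2
  have L : ∀ h : 0 < j, (Wall N).Adj (⟨i, hi⟩, ⟨j, hj⟩) (⟨i, hi⟩, ⟨j - 1, by omega⟩) := fun h => by
    simp [Wall, Fin.ext_iff]; omega
  have R : ∀ h : j + 1 < 2 * N, (Wall N).Adj (⟨i, hi⟩, ⟨j, hj⟩) (⟨i, hi⟩, ⟨j + 1, h⟩) := fun h => by
    simp [Wall, Fin.ext_iff]
  have D : ∀ (h : i + 1 < N) (_ : (i + j) % 2 = 0), (Wall N).Adj (⟨i, hi⟩, ⟨j, hj⟩) (⟨i + 1, h⟩, ⟨j, hj⟩) := fun h h' => by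
    simp [Wall, Fin.ext_iff, h']
  have T : ∀ (h : 0 < i) (_ : (i + j) % 2 = 1), (Wall N).Adj (⟨i, hi⟩, ⟨j, hj⟩) (⟨i - 1, by omega⟩, ⟨j, hj⟩) := fun h h' => by
    simp [Wall, Fin.ext_iff]; omega
  by_cases hj0 : j = 0
  · have hR := R (by omega)
    rcases Nat.mod_two_eq_zero_or_one (i + j) with h | h
    · exact h2 _ _ (by simp [Fin.ext_iff]) hR (D (by omega) h)
    · exact h2 _ _ (by simp [Fin.ext_iff]) hR (T (by omega) h)
  · have hL := L (by omega)
    by_cases hj1 : j + 1 < 2 * N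
    · exact h2 _ _ (by simp [Fin.ext_iff]) hL (R hj1)
    · rcases Nat.mod_two_eq_zero_or_one (i + j) with h | h
      · exact h2 _ _ (by simp [Fin.ext_iff]) hL (D (by omega) h)
      · exact h2 _ _ (by simp [Fin.ext_iff]; omega) hL (T (by omega) h)

theorem Tight.ext {K : SimpleGraph W} {μ : W → Set V} {p : W → W → V} (h : Tight K G μ p) {w w' : W} {u : V}
    (hv : v ∈ μ w) (hu : u ∈ μ w') (hne : w ≠ w') (hvu : G.Adj v u)
    (hd : ∀ a b c, G.Adj u a → G.Adj u b → G.Adj u c → a = b ∨ a = c ∨ b = c)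
    (hK : μ w' = {u} → ∃ w1 w2, w1 ≠ w2 ∧ K.Adj w' w1 ∧ K.Adj w' w2) : K.Adj w' w ∧ u = p w' w ∧ v = p w w' := by
  have D : ∀ {a b x}, x ∈ μ a → x ∈ μ b → a = b := fun {a b x} h1 h2 => by
    by_contra h3
    exact Set.disjoint_left.1 (h.dis a b h3) h1 h2
  rcases h.deg2 hu with h1 | ⟨y, hy, z, hz, h1, h2, h3⟩ | ⟨y, hy, h1, w1, h2, h3⟩
  · obtain ⟨w1, w2, h12, k1, k2⟩ := hK h1
    have P : ∀ w1, K.Adj w' w1 → u = p w' w1 ∧ G.Adj u (p w1 w') ∧ p w1 w' ∈ μ w1 := fun w1 k => by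
      have := h.port w' w1 k
      rw [h1] at this
      exact ⟨this.symm, this ▸ h.adj w' w1 k, h.port w1 w' k.symm⟩
    obtain ⟨a1, a2, a3⟩ := P w1 k1
    obtain ⟨b1, b2, b3⟩ := P w2 k2
    rcases hd v (p w1 w') (p w2 w') hvu.symm a2 b2 with e | e | e
    · obtain rfl := D hv (e ▸ a3)
      exact ⟨k1, a1, e⟩
    · obtain rfl := D hv (e ▸ b3)
      exact ⟨k2, b1, e⟩
    · exact (h12 (D a3 (e ▸ b3))).elim
  · rcases hd v y z hvu.symm h2 h3 with e | e | e
    · exact (hne (D hv (e ▸ hy))).elim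
    · exact (hne (D hv (e ▸ hz))).elim
    · exact (h1 e).elim
  · have h4 := h.adj w' w1 h2
    have h5 := h.port w1 w' h2.symm
    rw [← h3] at h4
    rcases hd v y (p w1 w') hvu.symm h1 h4 with e | e | e
    · exact (hne (D hv (e ▸ hy))).elim
    · obtain rfl := D hv (e ▸ h5)
      exact ⟨h2, h3, e⟩
    · exact (h2.ne (D hy (e ▸ h5))).elim

theorem deg_le2 [Finite V] {u : V} (h : ¬3 ≤ deg G u) : ∀ a b c, G.Adj u a → G.Adj u b → G.Adj u c → a = b ∨ a = c ∨ b = c := by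
  intro a b c ha hb hc
  by_contra hn
  push Not at hn
  exact h ((Set.two_lt_ncard_iff (Set.toFinite _)).2 ⟨a, b, c, ha, hb, hc, hn.1, hn.2.1, hn.2.2⟩)

theorem ncard_rng (f : Fin 3 → V) : (Set.range f).ncard ≤ 3 := by
  rw [← Set.image_univ]
  exact (Set.ncard_image_le).trans (by simp)

theorem stageA (N γ : ℕ) (hN : 0 < N) : ∃ n, ∀ (V : Type) [Finite V] (G : SimpleGraph V),
    (∀ v, 3 ≤ deg G v → (G.neighborSet v ∩ {u | 3 ≤ deg G u}).ncard ≤ γ) → HasBramble G n →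
    ∃ U, HasBramble (res G U) N ∧ ∀ v, ((res G U).neighborSet v).ncard ≤ γ + 9 := by
  obtain ⟨n, hn⟩ := satW N 1 (by omega)
  refine ⟨n, fun V _ G hG hb => ?_⟩
  obtain ⟨ν, μ, p, h, -⟩ := hn V G id (fun x => by simp) (fun x => by simpa using Conn.single x) hb
  refine ⟨_, h.bramble, fun v => ?_⟩
  by_cases hv3 : 3 ≤ deg G v
  swap
  · refine (Set.ncard_le_ncard (fun x hx => hx.1) (Set.toFinite _)).trans ((not_le.1 hv3).le.trans (by omega))
  obtain ⟨cr, hcr⟩ := wall_corner hN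
  by_cases hv : v ∈ ⋃ w, μ w
  swap
  · have : (res G (⋃ w, μ w)).neighborSet v = ∅ := by
      ext x; simp only [Set.mem_empty_iff_false, iff_false]
      exact fun hx => hv hx.2.1
    simp [this]
  obtain ⟨w, hv⟩ := Set.mem_iUnion.1 hv
  obtain ⟨a, ha⟩ := sub3_wall N w
  obtain ⟨q, d, f, m, g, -⟩ := h.geo hv ha
  choose e he using fun w => (h.conn w).1
  have hsub : (res G (⋃ w, μ w)).neighborSet v ⊆ (((G.neighborSet v ∩ {u | 3 ≤ deg G u}) ∪
      Set.range fun i => f i 1) ∪ Set.range fun i => p (a i) w) ∪ Set.range fun i => e (cr i) := by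
    rintro u ⟨hu, -, hu'⟩
    obtain ⟨w', hu'⟩ := Set.mem_iUnion.1 hu'
    by_cases hww : w = w'
    · subst hww
      obtain ⟨i, rfl, -⟩ := g.nbr hu' hu
      exact Or.inl (Or.inl (Or.inr ⟨i, rfl⟩))
    by_cases hu3 : 3 ≤ deg G u
    · exact Or.inl (Or.inl (Or.inl ⟨hu, hu3⟩))
    by_cases hk : μ w' = {u} → ∃ w1 w2, w1 ≠ w2 ∧ (Wall N).Adj w' w1 ∧ (Wall N).Adj w' w2
    · obtain ⟨h1, rfl, -⟩ := h.ext hv hu' hww hu (deg_le2 hu3) hk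
      obtain ⟨i, rfl⟩ := ha _ h1.symm
      exact Or.inl (Or.inr ⟨i, rfl⟩)
    · push Not at hk
      have h1 := he w'
      rw [hk.1] at h1
      rcases hcr w' with ⟨i, rfl⟩ | ⟨w1, w2, h2⟩
      · exact Or.inr ⟨i, h1⟩
      · exact (hk.2 w1 w2 h2.1 h2.2.1 h2.2.2).elim
  refine (Set.ncard_le_ncard hsub (Set.toFinite _)).trans ((Set.ncard_union_le _ _).trans ?_)
  have := Set.ncard_union_le ((G.neighborSet v ∩ {u | 3 ≤ deg G u}) ∪ Set.range fun i => f i 1) (Set.range fun i => p (a i) w)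
  have := Set.ncard_union_le (G.neighborSet v ∩ {u | 3 ≤ deg G u}) (Set.range fun i => f i 1)
  have := ncard_rng fun i => f i 1
  have := ncard_rng fun i => p (a i) w
  have := ncard_rng fun i => e (cr i)
  have := hG v hv3
  omega
end
end Paper

namespace Paper
section
variable {V W : Type} {G H : SimpleGraph V} {s t : Set V} {v : V}

theorem greedy [Finite V] {D : ℕ} (R : V → V → Prop) (hs : ∀ x y, R x y → R y x) (hR : ∀ v, {x | R v x}.ncard ≤ D) :
    ∃ c : V → ℕ, (∀ x, c x < D + 1) ∧ ∀ x y, x ≠ y → R x y → c x ≠ c y := by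
  classical
  have := Fintype.ofFinite V
  suffices h : ∀ S : Finset V, ∃ c : V → ℕ, (∀ x, c x < D + 1) ∧ ∀ x ∈ S, ∀ y ∈ S, x ≠ y → R x y → c x ≠ c y by
    obtain ⟨c, h1, h2⟩ := h Finset.univ
    exact ⟨c, h1, fun x y => h2 x (Finset.mem_univ x) y (Finset.mem_univ y)⟩
  intro S
  induction S using Finset.induction_on with
  | empty => exact ⟨fun _ => 0, fun x => by simp, by simp⟩
  | insert a S ha ih =>
    obtain ⟨c, h1, h2⟩ := ih
    obtain ⟨m, hm, hm'⟩ : ∃ m ∈ (↑(Finset.range (D + 1)) : Set ℕ), m ∉ c '' {x | R a x} := by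
      refine Set.exists_mem_notMem_of_ncard_lt_ncard ?_ (Set.toFinite _)
      rw [Set.ncard_coe_finset, Finset.card_range]
      exact Nat.lt_succ_of_le ((Set.ncard_image_le (Set.toFinite _)).trans (hR a))
    refine ⟨Function.update c a m, fun x => ?_, ?_⟩
    · by_cases hx : x = a
      · subst hx; simpa using hm
      · simpa [hx] using h1 x
    · have key : ∀ y ∈ S, R a y → m ≠ c y := fun y _ hr e => hm' ⟨y, hr, e.symm⟩
      have hne : ∀ y ∈ S, y ≠ a := fun y hy e => ha (e ▸ hy)
      intro x hx y hy hxy hr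
      rcases Finset.mem_insert.1 hx with rfl | hx' <;> rcases Finset.mem_insert.1 hy with rfl | hy'
      · exact (hxy rfl).elim
      · simpa [hne y hy'] using key y hy' hr
      · simpa [hne x hx'] using (key x hx' (hs _ _ hr)).symm
      · simpa [hne y hy', hne x hx'] using h2 x hx' y hy' hxy hr

theorem bl_conn (v : V) (r : ℕ) : Conn G (bl G v r) := by
  induction r with
  | zero => exact Conn.single v
  | succ r ih =>
    refine ⟨ih.1.mono (bl_mono v (by omega)), fun t ht ⟨z, hz⟩ hc => ?_⟩
    have h1 : bl G v r ⊆ t := by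
      obtain ⟨x, hx, hxz⟩ := ht hz
      have hxt : x ∈ t := by
        rcases hxz with rfl | h
        · exact hz
        · exact hc z hz x (bl_mono v (by omega) hx) h.symm
      have := ih.2 (t ∩ bl G v r) Set.inter_subset_right ⟨x, hxt, hx⟩ fun y hy y' hy' h =>
        ⟨hc y hy.1 y' (bl_mono v (by omega) hy') h, hy'⟩
      exact this.trans Set.inter_subset_left
    rintro u ⟨x, hx, rfl | h⟩
    · exact h1 hx
    · exact hc x (h1 hx) u ⟨x, hx, Or.inr h⟩ h

theorem bl_le (h : G ≤ H) (v : V) (r : ℕ) : bl G v r ⊆ bl H v r := by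
  induction r with
  | zero => exact subset_rfl
  | succ r ih => exact fun z ⟨x, hx, h'⟩ => ⟨x, ih hx, h'.imp_right fun h' => h h'⟩

theorem clean_out {U : Set V} (h : v ∉ U) : Clean (res G U) v := fun _ _ _ ha => (h ha.2.1).elim

theorem cleanStep (N Δ : ℕ) : ∃ n, ∀ (V : Type) [Finite V] (G : SimpleGraph V),
    (∀ v, (G.neighborSet v).ncard ≤ Δ) → ∀ I : Set V,
    (∀ v ∈ I, ∀ v' ∈ I, v ≠ v' → Disjoint (bl G v 2) (bl G v' 2)) → HasBramble G n →
    ∃ U, HasBramble (res G U) N ∧ ∀ v ∈ I, Clean (res G U) v := by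
  classical
  obtain ⟨n, hn⟩ := satW N ((Δ + 1) ^ 2) (by positivity)
  refine ⟨n, fun V _ G hΔ I hI hb => ?_⟩
  let π : V → V := fun x => if h : ∃ v ∈ I, x ∈ bl G v 2 then h.choose else x
  have hvv : ∀ v, v ∈ bl G v 2 := fun v => bl_mono v (by omega : 0 ≤ 2) rfl
  have p1 : ∀ v ∈ I, ∀ x ∈ bl G v 2, π x = v := fun v hv x hx => by
    have h : ∃ v ∈ I, x ∈ bl G v 2 := ⟨v, hv, hx⟩
    have e : π x = h.choose := dif_pos h
    rw [e]
    by_contra hne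
    exact Set.disjoint_left.1 (hI _ h.choose_spec.1 v hv hne) h.choose_spec.2 hx
  have p2 : ∀ x, (¬∃ v ∈ I, x ∈ bl G v 2) → π x = x := fun x hx => dif_neg hx
  have p3 : ∀ v ∈ I, π ⁻¹' {v} = bl G v 2 := fun v hv => by
    ext x
    refine ⟨fun h => ?_, fun h => p1 v hv x h⟩
    by_cases hx : ∃ v ∈ I, x ∈ bl G v 2
    · obtain ⟨v', h1, h2⟩ := hx
      rw [← (h : π x = v), p1 v' h1 x h2]; exact h2
    · rw [← (h : π x = v), p2 x hx]; exact hvv x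
  have p4 : ∀ x, x ∉ I → π ⁻¹' {x} ⊆ {x} := fun x hx y hy => by
    by_cases h : ∃ v ∈ I, y ∈ bl G v 2
    · obtain ⟨v', h1, h2⟩ := h
      exact (hx ((hy : π y = x) ▸ (p1 v' h1 y h2).symm ▸ h1)).elim
    · rw [← (hy : π y = x), p2 y h]; rfl
  obtain ⟨ν, μ, p, h, h1, h2, h3⟩ := hn V G π (fun x => by
    by_cases hx : x ∈ I
    · rw [p3 x hx]; exact bl_card hΔ x 2
    · exact (Set.ncard_le_ncard (p4 x hx)).trans (by simpa using Nat.one_le_pow _ _ (by omega))) (fun x => by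
    by_cases hx : π x ∈ I
    · rw [p3 _ hx]; exact bl_conn _ _
    · have : π ⁻¹' {π x} = {π x} := (p4 _ hx).antisymm (by
        rintro _ rfl
        have : x = π x := p4 _ hx rfl
        exact congrArg π this.symm)
      rw [this]; exact Conn.single _) hb
  refine ⟨_, h.bramble, fun v hv => ?_⟩
  by_cases hvU : v ∈ ⋃ w, μ w
  swap
  · exact clean_out hvU
  obtain ⟨w, hw⟩ := Set.mem_iUnion.1 hvU
  obtain ⟨a, ha⟩ := sub3_wall N w
  obtain ⟨q, d, f, m, g, -⟩ := h.geo hw ha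
  have key : ∀ x ∈ ⋃ w, μ w, x ∈ bl G v 2 → x ∈ μ w := fun x hx hxb => by
    obtain ⟨w', hw'⟩ := Set.mem_iUnion.1 hx
    have h4 := h3 w v x ((p1 v hv v (hvv v)).trans (p1 v hv x hxb).symm) (h1 w hw)
    by_cases e : w = w'
    · exact e ▸ hw'
    · exact (Set.disjoint_left.1 (h2 w w' e) h4 (h1 w' hw')).elim
  have b1 : ∀ a, G.Adj v a → a ∈ bl G v 1 := fun a h => ⟨v, rfl, Or.inr h⟩
  exact g.clean (fun a ha hva => key a ha (bl_mono v (by omega) (b1 a hva)))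
    fun a _ hva x hx hax => key x hx ⟨a, b1 a hva, Or.inr hax⟩

theorem stageB (N Δ : ℕ) : ∃ n, ∀ (V : Type) [Finite V] (G : SimpleGraph V),
    (∀ v, (G.neighborSet v).ncard ≤ Δ) → HasBramble G n →
    ∃ U, HasBramble (res G U) N ∧ ∀ v, Clean (res G U) v := by
  have main : ∀ j, ∃ n, ∀ (V : Type) [Finite V] (G : SimpleGraph V) (c : V → ℕ),
      (∀ v, (G.neighborSet v).ncard ≤ Δ) →
      (∀ v v', c v = c v' → v ≠ v' → Disjoint (bl G v 2) (bl G v' 2)) → HasBramble G n →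
      ∃ U, HasBramble (res G U) N ∧ ∀ v, c v < j → Clean (res G U) v := by
    intro j
    induction j with
    | zero => exact ⟨N, fun V _ G c _ _ hb => ⟨Set.univ, by
        have : res G Set.univ = G := by ext; simp [res]
        rwa [this], by simp⟩⟩
    | succ j ih =>
      obtain ⟨n, hn⟩ := ih
      obtain ⟨n', hn'⟩ := cleanStep n Δ
      refine ⟨n', fun V _ G c h1 h2 hb => ?_⟩
      obtain ⟨U, hU, hc⟩ := hn' V G h1 {v | c v = j} (fun v hv v' hv' => h2 v v' (hv.trans hv'.symm)) hb
      obtain ⟨U', hU', hc'⟩ := hn V (res G U) c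
        (fun v => (Set.ncard_le_ncard (fun x hx => hx.1) (Set.toFinite _)).trans (h1 v))
        (fun v v' e hne => (h2 v v' e hne).mono (bl_le (res_le _ _) v 2) (bl_le (res_le _ _) v' 2)) hU
      rw [res_res] at hU'
      refine ⟨_, hU', fun v hv => ?_⟩
      rw [← res_res]
      by_cases e : c v = j
      · exact (hc v e).res U'
      · exact hc' v (by omega)
  obtain ⟨n, hn⟩ := main ((Δ + 1) ^ 4 + 1)
  refine ⟨n, fun V _ G h1 hb => ?_⟩
  obtain ⟨c, hc, hc'⟩ := greedy (D := (Δ + 1) ^ 4) (fun v v' => ¬Disjoint (bl G v 2) (bl G v' 2))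
    (fun x y h h' => h h'.symm) (fun v => by
      refine (Set.ncard_le_ncard ?_ (Set.toFinite _)).trans (bl_card h1 v 4)
      intro v' h
      obtain ⟨y, hy, x, ⟨z, rfl, hz⟩, hx⟩ := Set.not_disjoint_iff.1 h
      exact ⟨x, ⟨y, hy, hx.imp Eq.symm fun h => h.symm⟩, hz.imp Eq.symm fun h => h.symm⟩)
  obtain ⟨U, hU, hU'⟩ := hn V G c h1 (fun v v' e hne => by
    by_contra h
    exact hc' v v' hne h e) hb
  exact ⟨U, hU, fun v => hU' v (hc v)⟩
end
end Paper

namespace Paper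
section
variable {V W : Type} {G H : SimpleGraph V} {s t : Set V} {v : V}

def Tri (G : SimpleGraph V) (x y z : V) : Prop := G.Adj x y ∧ G.Adj y z ∧ G.Adj x z

theorem tri_uniq {a b c d e : V} (h : Clean G a) (h1 : Tri G a b c) (h2 : Tri G a d e) : d = b ∨ d = c := by
  obtain ⟨ab, bc, ac⟩ := h1
  obtain ⟨ad, de, ae⟩ := h2
  by_contra hc
  push Not at hc
  obtain ⟨k1, k2, k3⟩ := h b c d ab ac ad bc.ne hc.1.symm hc.2.symm
  rcases k1 e ae with rfl | rfl | rfl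
  · exact (h d e c ad ae ac de.ne hc.2 bc.ne).2.1 ⟨de.symm.symm, bc⟩
  · exact k2 ⟨bc, de.symm⟩
  · exact de.ne rfl

def TR (G : SimpleGraph V) (x y : V) : Prop := x = y ∨ ∃ z, Tri G x y z

theorem TR.symm {x y : V} (h : TR G x y) : TR G y x := by
  rcases h with h | ⟨z, h1, h2, h3⟩
  · exact Or.inl h.symm
  · exact Or.inr ⟨z, h1.symm, h3, h2⟩

theorem TR.trans (hG : ∀ v, Clean G v) {x y z : V} (h : TR G x y) (h' : TR G y z) : TR G x z := by
  rcases h with rfl | ⟨u, h1, h2, h3⟩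
  · exact h'
  rcases h' with rfl | ⟨u', h4⟩
  · exact Or.inr ⟨u, h1, h2, h3⟩
  rcases tri_uniq (hG y) ⟨h1.symm, h3, h2⟩ h4 with rfl | rfl
  · exact Or.inl rfl
  · exact Or.inr ⟨y, h3, h2.symm, h1⟩

theorem conn_clique (hs : s.Nonempty) (h : ∀ x ∈ s, ∀ y ∈ s, x ≠ y → G.Adj x y) : Conn G s := by
  refine ⟨hs, fun t ht ⟨x, hx⟩ hc y hy => ?_⟩
  by_cases e : x = y
  · exact e ▸ hx
  · exact hc x hx y hy (h x (ht hx) y hy e)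

theorem triQuo [Finite V] (hG : ∀ v, Clean G v) : ∃ π : V → V, (∀ x, (π ⁻¹' {x}).ncard ≤ 3) ∧
    (∀ x, Conn G (π ⁻¹' {π x})) ∧ ∀ x y z, Tri G x y z → π x = π y := by
  let S : Setoid V := ⟨TR G, fun x => Or.inl rfl, fun h => h.symm, fun h h' => h.trans hG h'⟩
  let π : V → V := fun x => (Quotient.mk S x).out
  have e : ∀ x y, π x = π y ↔ TR G x y := fun x y => by
    refine ⟨fun h => ?_, fun h => by simp only [π]; rw [Quotient.sound (s := S) h]⟩
    have h1 : TR G (π x) x := Quotient.mk_out (s := S) x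
    have h2 : TR G (π y) y := Quotient.mk_out (s := S) y
    rw [h] at h1
    exact h1.symm.trans hG h2
  refine ⟨π, fun x => ?_, fun x => conn_clique ⟨x, rfl⟩ fun a ha b hb hne => ?_, fun x y z h => (e x y).2 (Or.inr ⟨z, h⟩)⟩
  · by_cases hx : ∃ y, π y = x
    · obtain ⟨y, rfl⟩ := hx
      by_cases hy : ∃ b c, Tri G y b c
      · obtain ⟨b, c, h⟩ := hy
        have : π ⁻¹' {π y} ⊆ {y, b, c} := fun z hz => by
          rcases (e z y).1 hz with rfl | ⟨u, h1, h2, h3⟩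
          · simp
          · rcases tri_uniq (hG y) h ⟨h1.symm, h3, h2⟩ with rfl | rfl <;> simp
        exact (Set.ncard_le_ncard this).trans ((Set.ncard_insert_le _ _).trans (Nat.succ_le_succ ((Set.ncard_insert_le _ _).trans (by simp))))
      · have : π ⁻¹' {π y} ⊆ {y} := fun z hz => by
          rcases (e z y).1 hz with rfl | ⟨u, h1, h2, h3⟩
          · simp
          · exact (hy ⟨z, u, h1.symm, h3, h2⟩).elim
        exact (Set.ncard_le_ncard this).trans (by simp)
    · have : π ⁻¹' {x} = ∅ := by
        ext z; simp only [Set.mem_preimage, Set.mem_singleton_iff, Set.mem_empty_iff_false, iff_false]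
        exact fun h => hx ⟨z, h⟩
      simp [this]
  · rcases (e a b).1 (ha.trans hb.symm) with h | ⟨u, h⟩
    · exact (hne h).elim
    · exact h.1

theorem Tight.noextra {K : SimpleGraph W} {μ : W → Set V} {p : W → W → V} (h : Tight K G μ p) (hG : ∀ v, Clean G v)
    (hT : ∀ w w' x y z, x ∈ μ w → y ∈ μ w' → Tri G x y z → w = w') {w w' : W} {x y : V}
    (hx : x ∈ μ w) (hy : y ∈ μ w') (hne : w ≠ w') (hxy : G.Adj x y)
    (hK : ∃ w1 w2, w1 ≠ w2 ∧ K.Adj w w1 ∧ K.Adj w w2)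
    (hK' : ∃ w1 w2, w1 ≠ w2 ∧ K.Adj w' w1 ∧ K.Adj w' w2) : K.Adj w w' ∧ x = p w w' ∧ y = p w' w := by
  by_cases hd : ∀ a b c, G.Adj y a → G.Adj y b → G.Adj y c → a = b ∨ a = c ∨ b = c
  · obtain ⟨h1, h2, h3⟩ := h.ext hx hy hne hxy hd fun _ => hK'
    exact ⟨h1.symm, h3, h2⟩
  by_cases hd' : ∀ a b c, G.Adj x a → G.Adj x b → G.Adj x c → a = b ∨ a = c ∨ b = c
  · exact h.ext hy hx hne.symm hxy.symm hd' fun _ => hK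
  push Not at hd hd'
  exfalso
  have key : ∀ b c, G.Adj x b → G.Adj x c → y ≠ b → y ≠ c → b ≠ c → False := fun b c hb hc h1 h2 h3 => by
    have nt : ∀ b, G.Adj x b → ¬G.Adj y b := fun b hb h => hne (hT w w' x y b hx hy ⟨hxy, h, hb⟩)
    have := (hG x y b c hxy hb hc h1 h2 h3).2.2 (nt b hb) (nt c hc)
    obtain ⟨d, e, f, d1, e1, f1, de, df, ef⟩ := hd
    by_cases hd2 : d = x
    · subst hd2; exact ef (this e f e1 f1 de.symm df.symm)
    by_cases he2 : e = x
    · subst he2; exact df (this d f d1 f1 hd2 ef.symm)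
    · exact de (this d e d1 e1 hd2 he2)
  obtain ⟨d, e, f, d1, e1, f1, de, df, ef⟩ := hd'
  by_cases hd2 : d = y
  · subst hd2; exact key e f e1 f1 de df ef
  by_cases he2 : e = y
  · subst he2; exact key d f d1 f1 de.symm ef df
  · exact key d e d1 e1 (Ne.symm hd2) (Ne.symm he2) de
end
end Paper

namespace Paper
section
variable {V W : Type} {G H : SimpleGraph V} {s t : Set V} {v : V}

theorem enum {M N : ℕ} (T : Finset ℕ) (hT : M ≤ T.card) (hN : ∀ x ∈ T, x < N) :
    ∃ a : ℕ → ℕ, StrictMono a ∧ ∀ i < M, a i ∈ T := by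
  let e := T.orderEmbOfCardLe hT
  have he : ∀ i, e i ∈ T := fun i => T.orderEmbOfCardLe_mem hT i
  refine ⟨fun i => if h : i < M then e ⟨i, h⟩ else N + i, fun i j hij => ?_, fun i hi => ?_⟩
  · by_cases hj : j < M
    · have hi : i < M := hij.trans hj
      simp only [hi, hj, dite_true]
      exact e.strictMono hij
    · by_cases hi : i < M
      · simp only [hi, hj, dite_true, dite_false]
        exact (hN _ (he _)).trans_le (by omega)
      · simp only [hi, hj, dite_false]; omega
  · simp only [hi, dite_true]; exact he _

theorem ramsey2 (M : ℕ) : ∃ N, ∀ col : ℕ → ℕ → Prop, ∃ a b : ℕ → ℕ, StrictMono a ∧ StrictMono b ∧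
    (∀ i < M, a i < N ∧ b i < N) ∧ ((∀ i < M, ∀ x < M, col (a i) (b x)) ∨ (∀ i < M, ∀ x < M, ¬col (a i) (b x))) := by
  classical
  refine ⟨2 ^ (2 * M) * M + 2 * M + 1, fun col => ?_⟩
  obtain ⟨S, hS, hc⟩ := Finset.exists_lt_card_fiber_of_mul_lt_card_of_maps_to
    (s := Finset.range (2 ^ (2 * M) * M + 1)) (t := (Finset.range (2 * M)).powerset) (n := M)
    (f := fun j => (Finset.range (2 * M)).filter (col j)) (fun j _ => by simp) (by simp)
  obtain ⟨a, ha, ha'⟩ := enum (M := M) (N := 2 ^ (2 * M) * M + 1) _ hc.le (fun x hx => by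
    simpa using (Finset.mem_filter.1 hx).1)
  have ha2 : ∀ i < M, a i < 2 ^ (2 * M) * M + 1 ∧ ∀ x < 2 * M, col (a i) x ↔ x ∈ S := fun i hi => by
    obtain ⟨h1, h2⟩ := Finset.mem_filter.1 (ha' i hi)
    refine ⟨by simpa using h1, fun x hx => ?_⟩
    rw [← h2]; simp [hx]
  rw [Finset.mem_powerset] at hS
  have hS2 : ∀ x ∈ S, x < 2 * M := fun x hx => by simpa using hS hx
  by_cases hM : M ≤ S.card
  · obtain ⟨b, hb, hb'⟩ := enum S hM hS2
    refine ⟨a, b, ha, hb, fun i hi => ⟨?_, ?_⟩, Or.inl fun i hi x hx => ?_⟩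
    · have := (ha2 i hi).1; omega
    · have := hS2 _ (hb' i hi); omega
    · exact ((ha2 i hi).2 _ (hS2 _ (hb' x hx))).2 (hb' x hx)
  · have h1 := Finset.card_sdiff_add_card_eq_card hS
    rw [Finset.card_range] at h1
    obtain ⟨b, hb, hb'⟩ := enum (M := M) (N := 2 * M) (Finset.range (2 * M) \ S) (by omega) (fun x hx => by
      simpa using (Finset.mem_sdiff.1 hx).1)
    have hb2 : ∀ x < M, b x < 2 * M ∧ b x ∉ S := fun x hx => by simpa using Finset.mem_sdiff.1 (hb' x hx)
    refine ⟨a, b, ha, hb, fun i hi => ⟨?_, ?_⟩, Or.inr fun i hi x hx h => ?_⟩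
    · have := (ha2 i hi).1; omega
    · have := (hb2 i hi).1; omega
    · exact (hb2 x hx).2 (((ha2 i hi).2 _ (hb2 x hx).1).1 h)

/-- bags of the pattern -/
def Bg (a b : ℕ → ℕ) (i y : ℕ) : Set (ℕ × ℕ) := {z |
  ((i + 2 * y) % 3 = 0 ∧ z.1 = 4 * a i + 1 ∧ 4 * b y < z.2 ∧ z.2 < 4 * b (y + 2)) ∨
  ((i + 2 * y) % 3 = 1 ∧ z.1 = 4 * a i + 1 ∧ (z.2 = 4 * b y ∨ z.2 = 4 * b y + 1)) ∨
  ((i + 2 * y) % 3 ≠ 2 ∧ 4 * a i + 1 < z.1 ∧ z.1 < 4 * a (i + 1) + 1 ∧ (z.2 = 4 * b y ∨ z.2 = 4 * b y + 1))}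

theorem Bg_conn {a b : ℕ → ℕ} (ha : StrictMono a) (hb : StrictMono b) {i y : ℕ} (h : (i + 2 * y) % 3 ≠ 2) :
    Conn IW (Bg a b i y) := by
  have h1 : a i < a (i + 1) := ha (by omega)
  have h2 : b y < b (y + 1) := hb (by omega)
  have h3 : b (y + 1) < b (y + 2) := hb (by omega)
  have hc := gz_chn (2 * b y) (8 * a (i + 1) + 1)
  by_cases h0 : (i + 2 * y) % 3 = 0
  · have e : Bg a b i y = ((fun c => (4 * a i + 1, c)) '' Set.Icc (4 * b y + 1) (4 * b (y + 2) - 1)) ∪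
        (gz (2 * b y) '' Set.Icc (8 * a i + 3) (8 * a (i + 1) + 1)) := by
      ext ⟨r, c⟩
      simp only [Bg, Set.mem_ofPred_eq, Set.mem_union, Set.mem_image, Set.mem_Icc, Prod.mk.injEq, gz]
      constructor
      · rintro (h | h | h)
        · exact Or.inl ⟨c, by omega⟩
        · omega
        · rcases (by omega : (c + r) % 2 = 1 ∨ (c + r) % 2 = 0) with h' | h'
          · exact Or.inr ⟨2 * r, by omega⟩
          · exact Or.inr ⟨2 * r + 1, by omega⟩
      · rintro (⟨c', h⟩ | ⟨n, h⟩)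
        · omega
        · rcases (by omega : r = 4 * a i + 1 ∨ 4 * a i + 1 < r) with h' | h'
          · exact Or.inl (by omega)
          · exact Or.inr (Or.inr (by omega))
    rw [e]
    refine Conn.union ((row_chn _ _).seg (by omega) le_rfl) (hc.seg (by omega) (by omega)) ?_
    refine ⟨(4 * a i + 1, 4 * b y + 1), ⟨_, ⟨le_rfl, by omega⟩, rfl⟩, 8 * a i + 3, ⟨le_rfl, by omega⟩, ?_⟩
    simp only [gz, Prod.mk.injEq]; omega
  · have e : Bg a b i y = gz (2 * b y) '' Set.Icc (8 * a i + 2) (8 * a (i + 1) + 1) := by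
      ext ⟨r, c⟩
      simp only [Bg, Set.mem_ofPred_eq, Set.mem_image, Set.mem_Icc, Prod.mk.injEq, gz]
      constructor
      · rintro (h | h | h)
        · omega
        all_goals
          rcases (by omega : (c + r) % 2 = 1 ∨ (c + r) % 2 = 0) with h' | h'
          · exact ⟨2 * r, by omega⟩
          · exact ⟨2 * r + 1, by omega⟩
      · rintro ⟨n, h⟩
        omega
    rw [e]
    exact hc.seg (by omega) (by omega)

theorem sm_mid {a : ℕ → ℕ} (ha : StrictMono a) {i j : ℕ} (h1 : a i < a j) (h2 : a j < a (i + 1)) : False := by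
  have := ha.lt_iff_lt.1 h1
  have := ha.lt_iff_lt.1 h2
  omega

theorem sm_eq {a : ℕ → ℕ} (ha : StrictMono a) {i j r : ℕ} (h1 : 4 * a i + 1 < r) (h2 : r < 4 * a (i + 1) + 1)
    (h3 : 4 * a j + 1 < r) (h4 : r < 4 * a (j + 1) + 1) : i = j := by
  have := ha.lt_iff_lt.1 (by omega : a i < a (j + 1))
  have := ha.lt_iff_lt.1 (by omega : a j < a (i + 1))
  omega

theorem Bg_dis {a b : ℕ → ℕ} (ha : StrictMono a) (hb : StrictMono b) {i y i' y' : ℕ} {z : ℕ × ℕ}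
    (h : z ∈ Bg a b i y) (h' : z ∈ Bg a b i' y') : i = i' ∧ y = y' := by
  have B1 : ∀ {x y}, b x = b y → x = y := fun h => hb.injective h
  have B2 : ∀ {x y}, b x < b y → x < y := fun h => hb.lt_iff_lt.1 h
  have B3 : ∀ {x y}, b x ≤ b y → x ≤ y := fun h => hb.le_iff_le.1 h
  have A1 : ∀ {x y}, a x = a y → x = y := fun h => ha.injective h
  simp only [Bg, Set.mem_ofPred_eq] at h h'
  rcases h with ⟨h, h1, h2, h3⟩ | ⟨h, h1, h2⟩ | ⟨h, h1, h2, h3⟩ <;>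
  rcases h' with ⟨h', h1', h2', h3'⟩ | ⟨h', h1', h2'⟩ | ⟨h', h1', h2', h3'⟩
  · obtain rfl := A1 (by omega : a i = a i')
    have := B2 (by omega : b y < b (y' + 2))
    have := B2 (by omega : b y' < b (y + 2))
    omega
  · obtain rfl := A1 (by omega : a i = a i')
    have := B3 (by omega : b y ≤ b y')
    have := B2 (by omega : b y' < b (y + 2))
    rcases (by omega : y' = y ∨ y' = y + 1) with rfl | rfl <;> omega
  · exact (sm_mid ha (i := i') (j := i) (by omega) (by omega)).elim
  · obtain rfl := A1 (by omega : a i = a i')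
    have := B3 (by omega : b y' ≤ b y)
    have := B2 (by omega : b y < b (y' + 2))
    rcases (by omega : y = y' ∨ y = y' + 1) with rfl | rfl <;> omega
  · exact ⟨A1 (by omega), B1 (by omega)⟩
  · exact (sm_mid ha (i := i') (j := i) (by omega) (by omega)).elim
  · exact (sm_mid ha (i := i) (j := i') (by omega) (by omega)).elim
  · exact (sm_mid ha (i := i) (j := i') (by omega) (by omega)).elim
  · exact ⟨sm_eq ha h1 h2 h1' h2', B1 (by omega)⟩

theorem Bg_deg {a b : ℕ → ℕ} (ha : StrictMono a) (hb : StrictMono b) {r c r' : ℕ} (hp : ∀ i y, (r, c) ∈ Bg a b i y → ¬(r = 4 * a i + 1 ∧ ∃ x ≤ y + 2, c = 4 * b x))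
    (hv : ((r + c) % 2 = 0 ∧ r' = r + 1) ∨ ((r + c) % 2 = 1 ∧ r = r' + 1))
    (h0 : ∃ i y, (r, c) ∈ Bg a b i y) (h1 : ∃ i y, (r, c + 1) ∈ Bg a b i y)
    (h2 : ∃ i y, (r, c - 1) ∈ Bg a b i y) (hc : c ≠ 0) (h3 : ∃ i y, (r', c) ∈ Bg a b i y) : False := by
  have B1 : ∀ {x y}, b x = b y → x = y := fun h => hb.injective h
  have B2 : ∀ {x y}, b x < b y → x < y := fun h => hb.lt_iff_lt.1 h
  have B3 : ∀ {x y}, b x ≤ b y → x ≤ y := fun h => hb.le_iff_le.1 h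
  have A1 : ∀ {x y}, a x = a y → x = y := fun h => ha.injective h
  have A2 : ∀ {x y}, a x < a y → x < y := fun h => ha.lt_iff_lt.1 h
  obtain ⟨i1, y1, h1⟩ := h1
  obtain ⟨i2, y2, h2⟩ := h2
  obtain ⟨i3, y3, h3⟩ := h3
  obtain ⟨i, y, h0⟩ := h0
  have hp0 := hp i y h0
  simp only [Bg, Set.mem_ofPred_eq] at h0 h1 h2 h3
  by_cases hr : r = 4 * a i + 1
  · obtain ⟨h, k1, k2, k3⟩ : (i3 + 2 * y3) % 3 ≠ 2 ∧ 4 * a i3 + 1 < r' ∧ r' < 4 * a (i3 + 1) + 1 ∧ (c = 4 * b y3 ∨ c = 4 * b y3 + 1) := by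
      omega
    have hy3 : y3 ≤ y + 2 := by
      rcases h0 with h0 | h0 | h0
      · have := B2 (by omega : b y3 < b (y + 2)); omega
      · have := B1 (by omega : b y3 = b y); omega
      · omega
    have k4 : c = 4 * b y3 + 1 := by
      rcases k3 with k3 | k3
      · exact (hp0 ⟨hr, y3, hy3, k3⟩).elim
      · exact k3
    have k5 : r' = r + 1 := by omega
    have e3 : i3 = i := by
      have := A2 (by omega : a i < a (i3 + 1))
      have := ha.le_iff_le.1 (by omega : a i3 ≤ a i)
      omega
    subst e3
    have l1 : (i3 + 2 * y3) % 3 = 1 := by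
      rcases h2 with ⟨g1, g2, g3, g4⟩ | ⟨g1, g2, g3⟩ | ⟨g1, g2, g3, g4⟩
      · obtain rfl := A1 (by omega : a i2 = a i3)
        have := B2 (by omega : b y2 < b y3)
        have := B2 (by omega : b y3 < b (y2 + 2))
        omega
      · obtain rfl := A1 (by omega : a i2 = a i3)
        obtain rfl := B1 (by omega : b y2 = b y3)
        omega
      · exact (sm_mid ha (i := i2) (j := i3) (by omega) (by omega)).elim
    rcases h1 with ⟨g1, g2, g3, g4⟩ | ⟨g1, g2, g3⟩ | ⟨g1, g2, g3, g4⟩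
    · obtain rfl := A1 (by omega : a i1 = a i3)
      have := B3 (by omega : b y1 ≤ b y3)
      have := B2 (by omega : b y3 < b (y1 + 2))
      omega
    · omega
    · omega
  · have k : 4 * a i + 1 < r ∧ r < 4 * a (i + 1) + 1 ∧ (c = 4 * b y ∨ c = 4 * b y + 1) := by omega
    have nr : ∀ j, r ≠ 4 * a j + 1 := fun j e => sm_mid ha (i := i) (j := j) (by omega) (by omega)
    have := nr i1
    have := nr i2
    omega
end
end Paper

namespace Paper
section
variable {V W : Type} {G H : SimpleGraph V} {s t : Set V} {v : V}

theorem three {α : Type} {x y z R L T : α} {Q : α → Prop} (h1 : x ≠ y) (h2 : x ≠ z) (h3 : y ≠ z)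
    (hx : x = R ∨ x = L ∨ x = T) (hy : y = R ∨ y = L ∨ y = T) (hz : z = R ∨ z = L ∨ z = T)
    (qx : Q x) (qy : Q y) (qz : Q z) : Q R ∧ Q L ∧ Q T := by
  rcases hx with rfl | rfl | rfl <;> rcases hy with rfl | rfl | rfl <;> rcases hz with rfl | rfl | rfl <;>
    first | exact (h1 rfl).elim | exact (h2 rfl).elim | exact (h3 rfl).elim | exact ⟨by assumption, by assumption, by assumption⟩

def Br (K : SimpleGraph W) (w : W) : Prop := ∃ x y z, x ≠ y ∧ x ≠ z ∧ y ≠ z ∧ K.Adj w x ∧ K.Adj w y ∧ K.Adj w z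

theorem pattern (m : ℕ) : ∃ N, ∀ col : Fin N × Fin (2 * N) → Prop, ∃ Ω : Set (Fin N × Fin (2 * N)),
    (∀ w ∈ Ω, ∃ w1 w2, w1 ≠ w2 ∧ (Wall N).Adj w w1 ∧ (Wall N).Adj w w2) ∧
    HasMinor (Wall m) (res (Wall N) Ω) ∧
    ((∀ w, Br (res (Wall N) Ω) w → col w) ∨ (∀ w, Br (res (Wall N) Ω) w → ¬col w)) := by
  obtain ⟨N0, hN0⟩ := ramsey2 (4 * m + 8)
  refine ⟨4 * N0 + 4, fun col => ?_⟩
  obtain ⟨a, b, ha, hb, hab, hcol⟩ := hN0 fun j x => ∃ w, em w = (4 * j + 1, 4 * x) ∧ col w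
  obtain ⟨f, hf⟩ : ∃ f : ℕ → ℕ → ℕ, ∀ r c, f r c = (3 * r + c) / 2 := ⟨_, fun _ _ => rfl⟩
  obtain ⟨g, hg⟩ : ∃ g : ℕ → ℕ → ℕ, ∀ r c, g r c = (c + 6 * m - 3 * r + 3 * ((r + c) % 2)) / 2 := ⟨_, fun _ _ => rfl⟩
  let O : Set (ℕ × ℕ) := {z | ∃ r c, r < m ∧ c < 2 * m ∧ z ∈ Bg a b (f r c) (g r c)}
  have hmod : ∀ r c, r < m → c < 2 * m → (f r c + 2 * g r c) % 3 = (r + c) % 2 := fun r c hr hc => by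
    rcases Nat.mod_two_eq_zero_or_one (r + c) with h | h
    · have : g r c + 3 * r = f r c + 3 * m := by simp only [hf, hg]; omega
      omega
    · have : g r c + 3 * r = f r c + 3 * m + 2 := by simp only [hf, hg]; omega
      omega
  have hfg : ∀ r c, r < m → c < 2 * m → f r c + 1 < 4 * m + 8 ∧ g r c + 2 < 4 * m + 8 ∧ 1 ≤ g r c := fun r c hr hc => by
    simp only [hf, hg]; omega
  have hO : ∀ z ∈ O, 1 ≤ z.1 ∧ z.1 + 1 < 4 * N0 + 4 ∧ 1 ≤ z.2 ∧ z.2 + 1 < 2 * (4 * N0 + 4) := by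
    rintro ⟨r', c'⟩ ⟨r, c, hr, hc, h⟩
    obtain ⟨h1, h2, h3⟩ := hfg r c hr hc
    have k1 := (hab _ h1).1
    have k2 := (hab _ h2).2
    have k3 := hb.le_apply (x := g r c)
    have k4 := hb (by omega : g r c < g r c + 2)
    have k5 := ha (by omega : f r c < f r c + 1)
    simp only [Bg, Set.mem_ofPred_eq] at h
    simp only
    omega
  have hOw : ∀ {z}, z ∈ O → ∃ w : Fin (4 * N0 + 4) × Fin (2 * (4 * N0 + 4)), em w = z := fun {z} hz => by
    obtain ⟨-, h1, -, h2⟩ := hO z hz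
    exact ⟨(⟨z.1, by omega⟩, ⟨z.2, by omega⟩), rfl⟩
  refine ⟨em ⁻¹' O, fun w hw => ?_, ?_, ?_⟩
  · obtain ⟨h1, h2, h3, h4⟩ := hO _ hw
    obtain ⟨⟨i, hi⟩, ⟨j, hj⟩⟩ := w
    simp only [em] at h1 h2 h3 h4
    refine ⟨(⟨i, hi⟩, ⟨j - 1, by omega⟩), (⟨i, hi⟩, ⟨j + 1, by omega⟩), ?_, ?_, ?_⟩
    · simp only [ne_eq, Prod.mk.injEq, Fin.mk.injEq, true_and]; omega
    · rw [wall_iw]; simp [em, IW]; omega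
    · rw [wall_iw]; simp [em, IW]
  · have key : ∀ w w' : Fin m × Fin (2 * m), ((em w).1 = (em w').1 ∧ (em w).2 + 1 = (em w').2) ∨
        ((em w).2 = (em w').2 ∧ (em w).1 + 1 = (em w').1 ∧ ((em w).1 + (em w).2) % 2 = 0) →
        ∃ x ∈ Bg a b (f (em w).1 (em w).2) (g (em w).1 (em w).2),
        ∃ y ∈ Bg a b (f (em w').1 (em w').2) (g (em w').1 (em w').2), IW.Adj x y := by
      rintro ⟨⟨r, hr⟩, ⟨c, hc⟩⟩ ⟨⟨r', hr'⟩, ⟨c', hc'⟩⟩ h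
      simp only [em] at h ⊢
      have hm := hmod r c hr hc
      have hm' := hmod r' c' hr' hc'
      have k5 := ha (by omega : f r c < f r c + 1)
      have k6 := hb (by omega : g r c < g r c + 1)
      have k7 := hb (by omega : g r c + 1 < g r c + 2)
      rcases h with ⟨rfl, rfl⟩ | ⟨rfl, rfl, h⟩
      · rcases Nat.mod_two_eq_zero_or_one (r + c) with h | h
        · have e1 : f r (c + 1) = f r c := by simp only [hf]; omega
          have e2 : g r (c + 1) = g r c + 2 := by simp only [hg]; omega
          rw [e1, e2] at hm' ⊢
          clear e1 e2; rw [h] at hm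
          refine ⟨(4 * a (f r c) + 1, 4 * b (g r c + 2) - 1), ?_, (4 * a (f r c) + 1, 4 * b (g r c + 2)), ?_, ?_⟩
          · simp only [Bg, Set.mem_ofPred_eq]; left; constructorm* _ ∧ _ <;> first | trivial | exact Or.inl trivial | omega
          · simp only [Bg, Set.mem_ofPred_eq]; right; left; constructorm* _ ∧ _ <;> first | trivial | exact Or.inl trivial | omega
          · simp [IW]; omega
        · have e1 : f r (c + 1) = f r c + 1 := by simp only [hf]; omega
          have e2 : g r c = g r (c + 1) + 1 := by simp only [hg]; omega
          have k8 := hb (by omega : g r (c + 1) < g r c)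
          rw [e1] at hm' ⊢
          rw [e2] at hm k6 k7 k8 ⊢
          have k9 := hb (by omega : g r (c + 1) + 1 < g r (c + 1) + 2)
          clear e1 e2; rw [h] at hm
          refine ⟨(4 * a (f r c + 1), 4 * b (g r (c + 1) + 1)), ?_, (4 * a (f r c + 1) + 1, 4 * b (g r (c + 1) + 1)), ?_, ?_⟩
          · simp only [Bg, Set.mem_ofPred_eq]; right; right; constructorm* _ ∧ _ <;> first | trivial | exact Or.inl trivial | omega
          · simp only [Bg, Set.mem_ofPred_eq]; left; constructorm* _ ∧ _ <;> first | trivial | exact Or.inl trivial | omega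
          · simp [IW]; omega
      · have e1 : f (r + 1) c = f r c + 1 := by simp only [hf]; omega
        have e2 : g (r + 1) c = g r c := by simp only [hg]; omega
        rw [e1, e2] at hm' ⊢
        clear e1 e2; rw [h] at hm
        refine ⟨(4 * a (f r c + 1), 4 * b (g r c)), ?_, (4 * a (f r c + 1) + 1, 4 * b (g r c)), ?_, ?_⟩
        · simp only [Bg, Set.mem_ofPred_eq]; right; right; constructorm* _ ∧ _ <;> first | trivial | exact Or.inl trivial | omega
        · simp only [Bg, Set.mem_ofPred_eq]; right; left; constructorm* _ ∧ _ <;> first | trivial | exact Or.inl trivial | omega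
        · simp [IW]; omega
    have lift : ∀ {x y}, x ∈ O → y ∈ O → IW.Adj x y → ∃ x' y' : Fin (4 * N0 + 4) × Fin (2 * (4 * N0 + 4)),
        em x' = x ∧ em y' = y ∧ (res (Wall (4 * N0 + 4)) (em ⁻¹' O)).Adj x' y' := fun {x y} hx hy h => by
      obtain ⟨x', rfl⟩ := hOw hx
      obtain ⟨y', rfl⟩ := hOw hy
      exact ⟨x', y', rfl, rfl, (wall_iw _ _).2 h, hx, hy⟩
    have hsub : ∀ w : Fin m × Fin (2 * m), Bg a b (f (em w).1 (em w).2) (g (em w).1 (em w).2) ⊆ O := fun w z hz =>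
      ⟨_, _, w.1.2, w.2.2, hz⟩
    refine ⟨fun w => em ⁻¹' Bg a b (f (em w).1 (em w).2) (g (em w).1 (em w).2), fun w => ?_, fun w w' hne => ?_, fun w w' h => ?_⟩
    · refine conn_res (conn_wall (Bg_conn ha hb ?_) fun x hx => ?_) fun x hx => hsub w hx
      · have := hmod (em w).1 (em w).2 w.1.2 w.2.2
        omega
      · have := hO x (hsub w hx)
        omega
    · rw [Set.disjoint_left]
      intro z h1 h2
      obtain ⟨h3, h4⟩ := Bg_dis ha hb h1 h2
      have k1 := hmod (em w).1 (em w).2 w.1.2 w.2.2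
      have k2 := hmod (em w').1 (em w').2 w'.1.2 w'.2.2
      rw [h3, h4, k2] at k1
      have k3 : (em w).1 < m := w.1.2
      have k4 : (em w').1 < m := w'.1.2
      refine hne (em_inj (Prod.ext ?_ ?_)) <;> simp only [hf, hg] at h3 h4 <;> omega
    · have h' := (wall_iw w w').1 h
      rcases h'.2 with h' | h'
      · obtain ⟨x, hx, y, hy, hxy⟩ := key w w' h'
        obtain ⟨x', y', rfl, rfl, h⟩ := lift (hsub w hx) (hsub w' hy) hxy
        exact ⟨x', hx, y', hy, h⟩
      · obtain ⟨x, hx, y, hy, hxy⟩ := key w' w h'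
        obtain ⟨x', y', rfl, rfl, h⟩ := lift (hsub w' hx) (hsub w hy) hxy
        exact ⟨y', hy, x', hx, h.symm⟩
  · have key : ∀ w, Br (res (Wall (4 * N0 + 4)) (em ⁻¹' O)) w → ∃ i < 4 * m + 8, ∃ x < 4 * m + 8, em w = (4 * a i + 1, 4 * b x) := by
      rintro w ⟨w1, w2, w3, n1, n2, n3, h1, h2, h3⟩
      by_contra hc
      push Not at hc
      have hw : em w ∈ O := h1.2.1
      obtain ⟨-, -, hc1, -⟩ := hO _ hw
      have N : ∀ w', (res (Wall (4 * N0 + 4)) (em ⁻¹' O)).Adj w w' → em w' = ((em w).1, (em w).2 + 1) ∨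
          em w' = ((em w).1, (em w).2 - 1) ∨ em w' = (if ((em w).1 + (em w).2) % 2 = 0 then (em w).1 + 1 else (em w).1 - 1, (em w).2) := fun w' h => by
        rcases iw_nbr ((wall_iw _ _).1 h.1) with h | ⟨-, h⟩ | ⟨h, h'⟩ | ⟨h, -, h'⟩
        · exact Or.inl h
        · exact Or.inr (Or.inl h)
        · rw [if_pos h]; exact Or.inr (Or.inr h')
        · rw [if_neg (by omega)]; exact Or.inr (Or.inr h')
      obtain ⟨q1, q2, q3⟩ := three (Q := (· ∈ O)) (fun e => n1 (em_inj e)) (fun e => n2 (em_inj e)) (fun e => n3 (em_inj e))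
        (N w1 h1) (N w2 h2) (N w3 h3) h1.2.2 h2.2.2 h3.2.2
      have ex : ∀ {z}, z ∈ O → ∃ i y, z ∈ Bg a b i y := fun ⟨r, c, _, _, h⟩ => ⟨_, _, h⟩
      refine Bg_deg ha hb (r := (em w).1) (c := (em w).2) (fun i y hiy => ?_) ?_ (ex hw) (ex q1) (ex q2) (by omega) (ex q3)
      · rintro ⟨e1, x, hx, e2⟩
        obtain ⟨r, c, hr, hc', hz⟩ := hw
        obtain ⟨rfl, rfl⟩ := Bg_dis ha hb hz hiy
        have := hfg r c hr hc'
        exact hc _ (by omega) x (by omega) (Prod.ext e1 e2)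
      · have := (hO _ hw).1
        split_ifs with h <;> omega
    rcases hcol with hcol | hcol
    · left
      intro w hw
      obtain ⟨i, hi, x, hx, e⟩ := key w hw
      obtain ⟨w', e', h⟩ := hcol i hi x hx
      rwa [em_inj (e.trans e'.symm)]
    · right
      intro w hw h
      obtain ⟨i, hi, x, hx, e⟩ := key w hw
      exact hcol i hi x hx ⟨w, e, h⟩
end
end Paper

namespace Paper
section
variable {V W : Type} {G H : SimpleGraph V} {s t : Set V} {v : V}

theorem Geo3.dv {F : Set V} {q d f n} (g : Geo3 G F v q d f n) : d v = 0 := by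
  have := g.dl 0 0 (by omega); rwa [g.st 0] at this

theorem Tight.path {K : SimpleGraph W} {F : W → Set V} {p : W → W → V} (h : Tight K G F p) {w a0 a1 : W} {U : Set V}
    (hw : ∀ w', K.Adj w w' → w' = a0 ∨ w' = a1)
    (hout : ∀ x ∈ F w, ∀ y ∈ U, y ∉ F w → G.Adj x y → ∃ w', K.Adj w w' ∧ x = p w w' ∧ y = p w' w) :
    (∀ x ∈ F w, ∃ A B, ∀ y ∈ U, G.Adj x y → y = A ∨ y = B) ∧ ∀ x ∈ F w, ∀ y ∈ F w, ∀ z ∈ F w, ¬Tri G x y z := by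
  obtain ⟨v, hv, hv0⟩ : ∃ v ∈ F w, K.Adj w a0 → v = p w a0 := by
    by_cases h0 : K.Adj w a0
    · exact ⟨_, h.port _ _ h0, fun _ => rfl⟩
    · obtain ⟨v, hv⟩ := (h.conn w).1
      exact ⟨v, hv, fun h => (h0 h).elim⟩
  obtain ⟨q, d, f, n, g, hq⟩ := h.geo hv (a := ![a0, a1, w]) fun w' hw' => by
    rcases hw w' hw' with rfl | rfl
    exacts [⟨0, rfl⟩, ⟨1, rfl⟩]
  have n0 : n 0 = 0 := by
    have h1 := g.dl 0 _ le_rfl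
    have : q 0 = v := by
      rcases hq 0 with ⟨h, h'⟩ | ⟨-, h⟩
      exacts [h'.trans (hv0 h).symm, h]
    rw [g.en, this, g.dv] at h1; exact h1.symm
  have n2 : n 2 = 0 := by
    have h1 := g.dl 2 _ le_rfl
    have : q 2 = v := by
      rcases hq 2 with ⟨h, h'⟩ | ⟨-, h⟩
      exacts [(K.irrefl h).elim, h]
    rw [g.en, this, g.dv] at h1; exact h1.symm
  have all : ∀ x ∈ F w, x = f 1 (d x) ∧ d x ≤ n 1 := fun x hx => by
    obtain ⟨i, h1, h2⟩ := g.all x hx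
    by_cases hi : i = 1
    · subst hi; exact ⟨h1, h2⟩
    · have h3 : d x = 0 := by
        have : i = 0 ∨ i = 2 := by omega
        rcases this with rfl | rfl <;> omega
      rw [h3, g.st] at h1 ⊢
      exact ⟨h1, by omega⟩
  have lv : ∀ x ∈ F w, ∀ y ∈ F w, G.Adj x y → d y = d x + 1 ∨ d x = d y + 1 := fun x hx y hy hxy => by
    have h1 := g.lev x hx y hy hxy
    have h2 := g.lev y hy x hx hxy.symm
    by_contra hc
    have h3 : d x = d y := by omega
    refine hxy.ne ?_
    rw [(all x hx).1, (all y hy).1, h3]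
  refine ⟨fun x hx => ?_, fun x hx y hy z hz ⟨h1, h2, h3⟩ => ?_⟩
  · classical
    refine ⟨if d x = 0 then p a0 w else f 1 (d x - 1), if d x = n 1 then p a1 w else f 1 (d x + 1), fun y hy hxy => ?_⟩
    by_cases hyF : y ∈ F w
    · have h1 := all y hyF
      rcases lv x hx y hyF hxy with h2 | h2
      · right; rw [if_neg (by omega), ← h2]; exact h1.1
      · left; rw [if_neg (by omega), h2]; exact h1.1
    · obtain ⟨w', hw', e1, e2⟩ := hout x hx y hy hyF hxy
      rcases hw w' hw' with rfl | rfl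
      · left; rw [if_pos, e2]; rw [e1, ← hv0 hw', g.dv]
      · right; rw [if_pos, e2]
        have : q 1 = p w w' := (hq 1).elim (fun h => h.2) fun h => (h.1 hw').elim
        rw [e1, ← this, ← g.en, g.dl 1 _ le_rfl]
  · have := lv x hx y hy h1
    have := lv y hy z hz h2
    have := lv x hx z hz h3
    omega

theorem Tight.tri {K : SimpleGraph W} {F : W → Set V} {p : W → W → V} (h : Tight K G F p) (hs : Sub3 K) {w : W} {U : Set V}
    (hout : ∀ x ∈ F w, ∀ y ∈ U, y ∉ F w → G.Adj x y → ∃ w', K.Adj w w' ∧ x = p w w' ∧ y = p w' w)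
    {a b c : V} (ha : a ∈ F w) (hb : b ∈ F w) (hc : c ∈ F w) (ht : Tri G a b c) :
    ∀ x ∈ F w, (x = a ∨ x = b ∨ x = c) ∨ ∃ A B, ∀ y ∈ U, G.Adj x y → y = A ∨ y = B := by
  obtain ⟨α, hα⟩ := hs w
  obtain ⟨q, d, f, n, g, hq⟩ := h.geo ha hα
  obtain ⟨i, rfl, hi⟩ := g.nbr hb ht.1
  obtain ⟨j, rfl, hj⟩ := g.nbr hc ht.2.2
  have hij : i ≠ j := fun e => ht.2.1.ne (by rw [e])
  have hbc := ht.2.1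
  have far : ∀ l, l ≠ i → l ≠ j → 1 ≤ n l → ∀ m, m ≠ l → f m 1 ≠ f l 1 ∧ ¬G.Adj (f m 1) (f l 1) := fun l hli hlj hl m hm => by
    have l1 := fun X => g.link (fin3 i j l hij hli.symm hlj.symm) hi hj hl hbc X
    have l2 := fun X => g.link (fin3 j i l hij.symm hlj.symm hli.symm) hj hi hl hbc.symm X
    rcases fin3 i j l hij hli.symm hlj.symm m with rfl | rfl | rfl
    · exact ⟨fun e => l1 (Or.inr (Or.inl e)), fun e => l2 (Or.inr (Or.inr e))⟩
    · exact ⟨fun e => l1 (Or.inl e), fun e => l1 (Or.inr (Or.inr e))⟩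
    · exact (hm rfl).elim
  have dist : ∀ l m, l ≠ m → 1 ≤ n l → 1 ≤ n m → f l 1 ≠ f m 1 := fun l m hlm hl hm => by
    by_cases h1 : m ≠ i ∧ m ≠ j
    · exact (far m h1.1 h1.2 hm l hlm).1
    by_cases h2 : l ≠ i ∧ l ≠ j
    · exact ((far l h2.1 h2.2 hl m hlm.symm).1).symm
    have : (l = i ∧ m = j) ∨ (l = j ∧ m = i) := by
      clear far hq hα
      by_cases h3 : l = i <;> by_cases h4 : m = i <;> simp_all
    rcases this with ⟨rfl, rfl⟩ | ⟨rfl, rfl⟩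
    exacts [hbc.ne, hbc.symm.ne]
  have geo : ∀ l m, l ≠ m → ∀ s t, s ≤ n l → t ≤ n m → 1 ≤ s → 1 ≤ t → (f l s = f m t ∨ G.Adj (f l s) (f m t)) → t = 1 := by
    intro l m hlm s t hs ht h1 h2 h3
    obtain ⟨k, hk1, hk2⟩ : ∃ k, l ≠ k ∧ m ≠ k := by clear * - hlm; revert l m; decide
    refine g.geo (fin3 l m k hlm hk1 hk2) (dist l m hlm (by omega) (by omega)) ?_ hs ht h2 h3
    by_cases h0 : n k = 0
    · exact Or.inl h0
    · exact Or.inr (dist k m hk2.symm (by omega) (by omega))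
  intro x hx
  by_cases hxa : x = a
  · exact Or.inl (Or.inl hxa)
  obtain ⟨l, h1, h2⟩ := g.all x hx
  have h0 : 1 ≤ d x := by
    by_contra h0
    exact hxa (g.zero x hx (by omega))
  by_cases hx1 : x = f i 1 ∨ x = f j 1
  · exact Or.inl (Or.inr hx1)
  right
  have uni : ∀ m t, t ≤ n m → 1 ≤ t → (f m t = x ∨ G.Adj (f m t) x) → m = l := fun m t ht ht1 h3 => by
    by_contra hml
    rw [h1] at h3
    have k1 := geo m l hml t (d x) ht h2 ht1 h0 h3
    have k2 := geo l m (Ne.symm hml) (d x) t h2 ht h0 ht1 (h3.imp Eq.symm fun h => h.symm)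
    rw [k1, k2] at h3
    rw [k1] at h1
    have h4 := h3.resolve_left (dist m l hml (by omega) (by omega))
    refine (far l ?_ ?_ (by omega) m hml).2 h4 <;> rintro rfl <;> simp_all
  classical
  refine ⟨f l (d x - 1), if d x = n l then p (α l) w else f l (d x + 1), fun y hy hxy => ?_⟩
  by_cases hyF : y ∈ F w
  · obtain ⟨m, h3, h4⟩ := g.all y hyF
    have k1 := g.lev x hx y hyF hxy
    have k2 := g.lev y hyF x hx hxy.symm
    by_cases h5 : d y = 0
    · left
      rw [g.zero y hyF h5, (by omega : d x - 1 = 0), g.st]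
    · have : m = l := uni m (d y) h4 (by omega) (Or.inr (h3 ▸ hxy.symm))
      subst this
      have h6 : d y ≠ d x := fun e => hxy.ne (by rw [h1, h3, e])
      by_cases h7 : d y = d x + 1
      · right; rw [if_neg (by omega), ← h7]; exact h3
      · left; rw [(by omega : d x - 1 = d y)]; exact h3
  · right
    obtain ⟨w', hw', e1, e2⟩ := hout x hx y hy hyF hxy
    obtain ⟨m, rfl⟩ := hα w' hw'
    have k1 : q m = x := ((hq m).elim (fun h => h.2) fun h => (h.1 hw').elim).trans e1.symm
    have k2 := g.dl m _ le_rfl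
    rw [g.en, k1] at k2
    have : m = l := uni m (n m) le_rfl (by omega) (Or.inl (by rw [g.en, k1]))
    subst this
    rw [if_pos k2, e2]

theorem not_br {x A B : V} (h : ∀ y, G.Adj x y → y = A ∨ y = B) : ¬Br G x := by
  rintro ⟨a, b, c, h1, h2, h3, ka, kb, kc⟩
  rcases h a ka with rfl | rfl <;> rcases h b kb with rfl | rfl <;> rcases h c kc with rfl | rfl <;> simp_all

theorem not_br_iff {K : SimpleGraph W} {w : W} (h : ¬Br K w) : ∃ a0 a1, ∀ w', K.Adj w w' → w' = a0 ∨ w' = a1 := by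
  by_contra! hc
  obtain ⟨x, hx, -, -⟩ := hc w w
  obtain ⟨y, hy, hxy, -⟩ := hc x x
  obtain ⟨z, hz, hxz, hyz⟩ := hc x y
  exact h ⟨x, y, z, hxy.symm, hxz.symm, hyz.symm, hx, hy, hz⟩

theorem stageC (m : ℕ) : ∃ n, ∀ (V : Type) [Finite V] (G : SimpleGraph V), (∀ v, Clean G v) → HasBramble G n →
    ∃ U : Set V, HasBramble (res G U) m ∧ ((∀ x y z, ¬Tri (res G U) x y z) ∨
      ∀ x, Br (res G U) x → ∃ y z, Tri (res G U) x y z) := by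
  obtain ⟨N, hN⟩ := pattern m
  obtain ⟨n, hn⟩ := satW N 3 (by omega)
  refine ⟨n, fun V _ G hG hb => ?_⟩
  obtain ⟨π, hπ1, hπ2, hπ3⟩ := triQuo hG
  obtain ⟨ν, μ, p, hT, hμν, hν, hνπ⟩ := hn V G π hπ1 hπ2 hb
  have hTr : ∀ w w' x y z, x ∈ μ w → y ∈ μ w' → Tri G x y z → w = w' := fun w w' x y z hx hy h => by
    by_contra hne
    exact Set.disjoint_left.1 (hν w w' hne) (hνπ w x y (hπ3 x y z h) (hμν w hx)) (hμν w' hy)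
  obtain ⟨Ω, hΩ, hmin, hcol⟩ := hN fun w => ∃ x ∈ μ w, ∃ y ∈ μ w, ∃ z ∈ μ w, Tri G x y z
  have hKs : Sub3 (res (Wall N) Ω) := fun w => by
    obtain ⟨a, ha⟩ := sub3_wall N w
    exact ⟨a, fun w' h => ha w' h.1⟩
  obtain ⟨F, hFμ, hF⟩ := tighten (K := res (Wall N) Ω) hT.conn hT.dis (fun w w' h => hT.port w w' h.1) (fun w w' h => hT.adj w w' h.1)
  let U : Set V := ⋃ w ∈ Ω, F w
  have hFU : ∀ w ∈ Ω, F w ⊆ U := fun w hw => Set.subset_biUnion_of_mem hw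
  have hU : ∀ {x}, x ∈ U → ∃ w ∈ Ω, x ∈ F w := fun {x} hx => by simpa [U] using hx
  have hout : ∀ w ∈ Ω, ∀ x ∈ F w, ∀ y ∈ U, y ∉ F w → G.Adj x y → ∃ w', (res (Wall N) Ω).Adj w w' ∧ x = p w w' ∧ y = p w' w := by
    intro w hw x hx y hy hyF hxy
    obtain ⟨w', hw', hy'⟩ := hU hy
    have hne : w ≠ w' := fun e => hyF (e ▸ hy')
    obtain ⟨h1, h2, h3⟩ := hT.noextra hG hTr (hFμ w hx) (hFμ w' hy') hne hxy (hΩ w hw) (hΩ w' hw')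
    exact ⟨w', ⟨h1, hw, hw'⟩, h2, h3⟩
  have hpath : ∀ w ∈ Ω, ¬Br (res (Wall N) Ω) w →
      (∀ x ∈ F w, ¬Br (res G U) x) ∧ ∀ x ∈ F w, ∀ y ∈ F w, ∀ z ∈ F w, ¬Tri G x y z := fun w hw hbr => by
    obtain ⟨a0, a1, ha⟩ := not_br_iff hbr
    obtain ⟨h1, h2⟩ := hF.path ha (hout w hw)
    refine ⟨fun x hx => ?_, h2⟩
    obtain ⟨A, B, h⟩ := h1 x hx
    exact not_br fun y hy => h y hy.2.2 hy.1
  refine ⟨U, bags_bramble hmin.bramble (μ := F) (fun w => ?_) hF.dis fun w w' h => ⟨_, hF.port w w' h, _, hF.port w' w h.symm,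
    hF.adj w w' h, hFU w h.2.1 (hF.port w w' h), hFU w' h.2.2 (hF.port w' w h.symm)⟩, ?_⟩
  · by_cases hw : w ∈ Ω
    · exact conn_res (hF.conn w) (hFU w hw)
    · obtain ⟨x, hx⟩ := (hF.conn w).1
      rw [← hF.min w {x} (by simpa using hx) (Conn.single x) fun w' h => (hw h.2.1).elim]
      exact Conn.single x
  · rcases hcol with hcol | hcol
    · right
      intro x hx
      have hx' := hx
      obtain ⟨y, _, _, _, _, _, hxy, _, _⟩ := hx'
      obtain ⟨w, hw, hxw⟩ := hU hxy.2.1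
      have hbr : Br (res (Wall N) Ω) w := by
        by_contra hbr
        exact (hpath w hw hbr).1 x hxw hx
      have hFw : F w = μ w := by
        refine hT.min w _ (hFμ w) (hF.conn w) fun w' hw' => ?_
        obtain ⟨a, ha⟩ := sub3_wall N w
        obtain ⟨x1, x2, x3, n1, n2, n3, k1, k2, k3⟩ := hbr
        have H : ∀ {z}, (Wall N).Adj w z → z = a 0 ∨ z = a 1 ∨ z = a 2 := fun {z} hz => by
          obtain ⟨i, rfl⟩ := ha z hz
          fin_cases i <;> simp
        obtain ⟨q0, q1, q2⟩ := three (Q := fun z => (res (Wall N) Ω).Adj w z) n1 n2 n3 (H k1.1) (H k2.1) (H k3.1) k1 k2 k3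
        rcases H hw' with rfl | rfl | rfl
        exacts [hF.port _ _ q0, hF.port _ _ q1, hF.port _ _ q2]
      obtain ⟨a, ha, b, hb, c, hc, ht⟩ := hcol w hbr
      rw [← hFw] at ha hb hc
      have S := hFU w hw
      rcases hF.tri hKs (hout w hw) ha hb hc ht x hxw with (rfl | rfl | rfl) | ⟨A, B, h⟩
      · exact ⟨b, c, ⟨ht.1, S ha, S hb⟩, ⟨ht.2.1, S hb, S hc⟩, ht.2.2, S ha, S hc⟩
      · exact ⟨a, c, ⟨ht.1.symm, S hb, S ha⟩, ⟨ht.2.2, S ha, S hc⟩, ht.2.1, S hb, S hc⟩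
      · exact ⟨a, b, ⟨ht.2.2.symm, S hc, S ha⟩, ⟨ht.1, S ha, S hb⟩, ht.2.1.symm, S hc, S hb⟩
      · exact (not_br (G := res G U) (fun y hy => h y hy.2.2 hy.1) hx).elim
    · left
      rintro x y z ⟨h1, h2, h3⟩
      have ht : Tri G x y z := ⟨h1.1, h2.1, h3.1⟩
      obtain ⟨w, hw, hx⟩ := hU h1.2.1
      obtain ⟨w', hw', hy⟩ := hU h1.2.2
      obtain ⟨w'', hw'', hz⟩ := hU h2.2.2
      obtain rfl := hTr w w' x y z (hFμ _ hx) (hFμ _ hy) ht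
      obtain rfl := hTr w w'' y z x (hFμ _ hy) (hFμ _ hz) ⟨ht.2.1, ht.2.2.symm, ht.1.symm⟩
      by_cases hbr : Br (res (Wall N) Ω) w
      · exact hcol w hbr ⟨x, hFμ w hx, y, hFμ w hy, z, hFμ w hz, ht⟩
      · exact (hpath w hw hbr).2 x hx y hy z hz ht
end
end Paper

namespace Paper
section
variable {V W : Type} {G H : SimpleGraph V} {s t : Set V} {v : V}

/-- edge-minimal minor model -/
structure Mod (K : SimpleGraph W) (S : SimpleGraph V) (μ : W → Set V) : Prop where
  conn : ∀ w, Conn S (μ w)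
  dis : ∀ w w', w ≠ w' → Disjoint (μ w) (μ w')
  adj : ∀ w w', K.Adj w w' → ∃ x ∈ μ w, ∃ y ∈ μ w', S.Adj x y
  min : ∀ S' < S, ¬HasMinor K S'

theorem HasMinor.mod [Finite V] {K : SimpleGraph W} (h : HasMinor K G) : ∃ S ≤ G, ∃ μ, Mod K S μ := by
  obtain ⟨S, ⟨h1, μ, k1, k2, k3⟩, h2⟩ := (wellFounded_lt (α := SimpleGraph V)).has_min {S | S ≤ G ∧ HasMinor K S} ⟨G, le_rfl, h⟩
  exact ⟨S, h1, μ, k1, k2, k3, fun S' hS' hm => h2 S' ⟨hS'.le.trans h1, hm⟩ hS'⟩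

variable {K : SimpleGraph W} {S : SimpleGraph V} {μ : W → Set V}

theorem Mod.bag (h : Mod K S μ) {x : V} {w w' : W} (h1 : x ∈ μ w) (h2 : x ∈ μ w') : w = w' := by
  by_contra hne
  exact Set.disjoint_left.1 (h.dis w w' hne) h1 h2

theorem del_adj {x y a b : V} : (S.deleteEdges {s(x, y)}).Adj a b ↔ S.Adj a b ∧ ¬((a = x ∧ b = y) ∨ (a = y ∧ b = x)) := by
  rw [SimpleGraph.deleteEdges_adj, Set.mem_singleton_iff, Sym2.eq_iff]

theorem Mod.del (h : Mod K S μ) {x y : V} (hxy : S.Adj x y) : ¬HasMinor K (S.deleteEdges {s(x, y)}) := by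
  refine h.min _ (lt_of_le_of_ne (SimpleGraph.deleteEdges_le _) fun e => ?_)
  rw [← e, del_adj] at hxy
  exact hxy.2 (Or.inl ⟨rfl, rfl⟩)

theorem Mod.cross (h : Mod K S μ) {x y : V} {w w' : W} (hx : x ∈ μ w) (hy : y ∈ μ w') (hne : w ≠ w') (hxy : S.Adj x y) :
    K.Adj w w' ∧ ∀ x' ∈ μ w, ∀ y' ∈ μ w', S.Adj x' y' → x' = x ∧ y' = y := by
  by_contra hc
  rw [not_and] at hc
  push Not at hc
  have key : K.Adj w w' → ∃ x' ∈ μ w, ∃ y' ∈ μ w', (S.deleteEdges {s(x, y)}).Adj x' y' := fun hK => by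
    obtain ⟨x', hx', y', hy', hA, hn⟩ := hc hK
    refine ⟨x', hx', y', hy', del_adj.2 ⟨hA, ?_⟩⟩
    rintro (⟨h1, h2⟩ | ⟨rfl, -⟩)
    exacts [hn h1 h2, hne (h.bag hx' hy)]
  refine h.del hxy ⟨μ, fun u => (h.conn u).mono' fun a ha b hb hab => del_adj.2 ⟨hab, ?_⟩, h.dis, fun u u' hu => ?_⟩
  · rintro (⟨rfl, rfl⟩ | ⟨rfl, rfl⟩)
    exacts [hne ((h.bag hx ha).trans (h.bag hb hy)), hne ((h.bag hx hb).trans (h.bag ha hy))]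
  · obtain ⟨a, ha, b, hb, hab⟩ := h.adj u u' hu
    by_cases hd : (a = x ∧ b = y) ∨ (a = y ∧ b = x)
    · rcases hd with ⟨rfl, rfl⟩ | ⟨rfl, rfl⟩
      · obtain rfl := h.bag ha hx
        obtain rfl := h.bag hb hy
        exact key hu
      · obtain rfl := h.bag ha hy
        obtain rfl := h.bag hb hx
        obtain ⟨x', hx', y', hy', h'⟩ := key hu.symm
        exact ⟨y', hy', x', hx', h'.symm⟩
    · exact ⟨a, ha, b, hb, del_adj.2 ⟨hab, hd⟩⟩

theorem Mod.sdiff (h : Mod K S μ) {x : V} {w u : W} (hx : x ∈ μ w) (hu : u ≠ w) : μ u \ {x} = μ u :=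
  Set.sdiff_singleton_eq_self fun hxu => hu (h.bag hxu hx)

theorem Mod.rem (h : Mod K S μ) {x : V} {w : W} (hx : x ∈ μ w) (hc : Conn S (μ w \ {x})) :
    ∃ w', w' ≠ w ∧ ∃ z ∈ μ w', S.Adj x z := by
  by_contra! hn
  obtain ⟨y, hy, hxy⟩ := (h.conn w).nbr hx (hc.1.imp fun y hy => ⟨hy.1, hy.2⟩)
  refine h.del hxy ⟨fun u => μ u \ {x}, fun u => ?_, fun u u' hne => (h.dis u u' hne).mono Set.sdiff_subset Set.sdiff_subset, fun u u' hu => ?_⟩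
  · have : Conn S (μ u \ {x}) := by
      by_cases hu : u = w
      · rwa [hu]
      · rw [h.sdiff hx hu]; exact h.conn u
    refine this.mono' fun a ha b hb hab => del_adj.2 ⟨hab, ?_⟩
    rintro (⟨h1, -⟩ | ⟨-, h1⟩)
    exacts [ha.2 h1, hb.2 h1]
  · obtain ⟨a, ha, b, hb, hab⟩ := h.adj u u' hu
    have h1 : a ≠ x := by
      rintro rfl
      obtain rfl := h.bag ha hx
      exact hn u' hu.ne' b hb hab
    have h2 : b ≠ x := by
      rintro rfl
      obtain rfl := h.bag hb hx
      exact hn u hu.ne a ha hab.symm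
    exact ⟨a, ⟨ha, h1⟩, b, ⟨hb, h2⟩, del_adj.2 ⟨hab, by tauto⟩⟩

theorem Mod.one (h : Mod K S μ) {x y y' : V} {w : W} (hx : x ∈ μ w) (hc : Conn S (μ w \ {x})) (hy : y ∈ μ w) (hy' : y' ∈ μ w)
    (hxy : S.Adj x y) (hxy' : S.Adj x y') : y = y' := by
  by_contra hne
  have C : ∀ {s : Set V}, Conn S s → (x ∉ s ∨ y ∉ s) → Conn (S.deleteEdges {s(x, y)}) s := fun {s} hs hs' =>
    hs.mono' fun a ha b hb hab => del_adj.2 ⟨hab, by rintro (⟨rfl, rfl⟩ | ⟨rfl, rfl⟩) <;> tauto⟩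
  refine h.del hxy ⟨μ, fun u => ?_, h.dis, fun u u' hu => ?_⟩
  · by_cases hu : u = w
    · subst hu
      have := (C hc (Or.inl fun h => h.2 rfl)).insert (x := y') (y := x) ⟨hy', hxy'.ne'⟩
        (del_adj.2 ⟨hxy'.symm, by rintro (⟨h1, -⟩ | ⟨h1, -⟩); exacts [hxy'.ne' h1, hne h1.symm]⟩)
      rwa [Set.insert_sdiff_singleton, Set.insert_eq_self.2 hx] at this
    · exact C (h.conn u) (Or.inl fun hxu => hu (h.bag hxu hx))
  · obtain ⟨a, ha, b, hb, hab⟩ := h.adj u u' hu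
    refine ⟨a, ha, b, hb, del_adj.2 ⟨hab, ?_⟩⟩
    rintro (⟨rfl, rfl⟩ | ⟨rfl, rfl⟩)
    · exact hu.ne ((h.bag ha hx).trans (h.bag hy hb))
    · exact hu.ne ((h.bag ha hy).trans (h.bag hx hb))

theorem Mod.deg2 (h : Mod K S μ) {x : V} {w : W} (hx : x ∈ μ w) (hw : ∃ w1 w2, w1 ≠ w2 ∧ K.Adj w w1 ∧ K.Adj w w2) :
    ∃ y z, y ≠ z ∧ S.Adj x y ∧ S.Adj x z := by
  by_cases hs : ∃ y ∈ μ w, y ≠ x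
  · obtain ⟨y, hy, hxy⟩ := (h.conn w).nbr hx hs
    by_contra! hn
    have hc := (h.conn w).leaf (x := x) (y0 := y) (fun z _ hz => by_contra fun hne => hn z y hne hz hxy) hs
    obtain ⟨w', hw', z, hz, hxz⟩ := h.rem hx hc
    exact hn y z (fun e => hw' (h.bag hz (e ▸ hy))) hxy hxz
  · push Not at hs
    obtain ⟨w1, w2, hne, k1, k2⟩ := hw
    obtain ⟨a, ha, b, hb, hab⟩ := h.adj w w1 k1
    obtain ⟨a', ha', b', hb', hab'⟩ := h.adj w w2 k2
    rw [hs a ha] at hab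
    rw [hs a' ha'] at hab'
    exact ⟨b, b', fun e => hne (h.bag hb (e ▸ hb')), hab, hab'⟩

theorem Conn.far [Finite V] (h : Conn G s) {r : V} (hr : r ∈ s) (h2 : ∃ y ∈ s, y ≠ r) : ∃ x ∈ s, x ≠ r ∧ Conn G (s \ {x}) := by
  obtain ⟨T, ⟨hT1, hT2, hT3, hT4⟩, hm⟩ := (Set.toFinite {T : Set V | T ⊆ s ∧ T ≠ s ∧ r ∈ T ∧ Conn G T}).exists_maximal
    ⟨{r}, by simpa using hr, by rintro rfl; obtain ⟨y, hy, h⟩ := h2; exact h hy, rfl, Conn.single r⟩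
  obtain ⟨a, ha, haT, y, hy, hyT, hay⟩ := h.cross (A := T) ⟨r, hr, hT3⟩ fun hs => hT2 (hT1.antisymm hs)
  have e : Insert.insert y T = s := by
    by_contra hne
    exact hyT (hm ⟨Set.insert_subset hy hT1, hne, Or.inr hT3, hT4.insert haT hay⟩ (Set.subset_insert _ _) (Set.mem_insert _ _))
  refine ⟨y, hy, fun e => hyT (e ▸ hT3), ?_⟩
  rwa [← e, Set.insert_sdiff_of_mem _ (Set.mem_singleton y), Set.sdiff_singleton_eq_self hyT]

theorem sub_adj {u v : W} {a b : Option W} : (subdivideEdge K u v).Adj a b ↔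
    (∃ x y, a = some x ∧ b = some y ∧ K.Adj x y ∧ ¬((x = u ∧ y = v) ∨ (x = v ∧ y = u))) ∨
    (a = none ∧ (b = some u ∨ b = some v)) ∨ (b = none ∧ (a = some u ∨ a = some v)) := by
  rw [subdivideEdge, SimpleGraph.fromRel_adj]
  constructor
  · rintro ⟨-, (⟨x, y, h1, h2, h3, h4, h5⟩ | h) | ⟨x, y, h1, h2, h3, h4, h5⟩ | h⟩
    · exact Or.inl ⟨x, y, h1, h2, h3, by tauto⟩
    · tauto
    · exact Or.inl ⟨y, x, h2, h1, h3.symm, by tauto⟩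
    · tauto
  · rintro (⟨x, y, rfl, rfl, h3, h4⟩ | ⟨rfl, h⟩ | ⟨rfl, h⟩)
    · exact ⟨by simpa using h3.ne, Or.inl (Or.inl ⟨x, y, rfl, rfl, h3, by tauto, by tauto⟩)⟩
    · exact ⟨by rcases h with rfl | rfl <;> simp, Or.inl (Or.inr ⟨rfl, h⟩)⟩
    · exact ⟨by rcases h with rfl | rfl <;> simp, Or.inr (Or.inr ⟨rfl, h⟩)⟩

theorem Sub3.subdiv (hK : Sub3 K) {u v : W} (huv : K.Adj u v) : Sub3 (subdivideEdge K u v) := by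
  classical
  rintro (_ | w)
  · refine ⟨![some u, some v, none], fun w' h => ?_⟩
    rcases sub_adj.1 h with ⟨_, _, h, _⟩ | ⟨-, rfl | rfl⟩ | ⟨-, h | h⟩
    · cases h
    · exact ⟨0, rfl⟩
    · exact ⟨1, rfl⟩
    · cases h
    · cases h
  · obtain ⟨a, ha⟩ := hK w
    refine ⟨fun i => if (w = u ∧ a i = v) ∨ (w = v ∧ a i = u) then none else some (a i), fun w' h => ?_⟩
    rcases sub_adj.1 h with ⟨x, y, h1, rfl, h3, h4⟩ | ⟨h', -⟩ | ⟨rfl, h'⟩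
    · cases h1
      obtain ⟨i, rfl⟩ := ha y h3
      exact ⟨i, (if_neg h4).symm⟩
    · cases h'
    · rcases h' with h' | h' <;> cases h'
      · obtain ⟨i, rfl⟩ := ha v huv
        exact ⟨i, by simp⟩
      · obtain ⟨i, rfl⟩ := ha u huv.symm
        exact ⟨i, by simp⟩

theorem minor_unsub {u v : W} (huv : K.Adj u v) (h : HasMinor (subdivideEdge K u v) S) : HasMinor K S := by
  classical
  obtain ⟨ν, h1, h2, h3⟩ := h
  have c0 : (subdivideEdge K u v).Adj (some u) none := sub_adj.2 (Or.inr (Or.inr ⟨rfl, Or.inl rfl⟩))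
  have c1 : (subdivideEdge K u v).Adj none (some v) := sub_adj.2 (Or.inr (Or.inl ⟨rfl, Or.inr rfl⟩))
  have hsub : ∀ w, ν (some w) ⊆ if w = u then ν (some w) ∪ ν none else ν (some w) := fun w x hx => by
    split_ifs
    exacts [Or.inl hx, hx]
  refine ⟨fun w => if w = u then ν (some w) ∪ ν none else ν (some w), fun w => ?_, fun w w' hne => ?_, fun w w' hw => ?_⟩
  · beta_reduce
    split_ifs with hw
    · obtain ⟨x, hx, y, hy, hxy⟩ := h3 _ _ c0
      exact hw ▸ (h1 _).union_adj (h1 _) hx hy hxy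
    · exact h1 _
  · have k1 : Disjoint (ν (some w)) (ν (some w')) := h2 _ _ (by simpa using hne)
    have k2 : ∀ w, Disjoint (ν (some w)) (ν none) := fun w => h2 _ _ (by simp)
    beta_reduce
    split_ifs with a b b
    · exact (hne (a.trans b.symm)).elim
    · exact k1.union_left (k2 w').symm
    · exact k1.union_right (k2 w)
    · exact k1
  · obtain ⟨p, hp, q, hq, hpq⟩ := h3 _ _ c1
    have hpu : p ∈ if u = u then ν (some u) ∪ ν none else ν (some u) := by rw [if_pos rfl]; exact Or.inr hp
    by_cases hd : (w = u ∧ w' = v) ∨ (w = v ∧ w' = u)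
    · rcases hd with ⟨rfl, rfl⟩ | ⟨rfl, rfl⟩
      · exact ⟨p, hpu, q, hsub _ hq, hpq⟩
      · exact ⟨q, hsub _ hq, p, hpu, hpq.symm⟩
    · obtain ⟨x, hx, y, hy, hxy⟩ := h3 (some w) (some w') (sub_adj.2 (Or.inl ⟨w, w', rfl, rfl, hw, hd⟩))
      exact ⟨x, hsub w hx, y, hsub w' hy, hxy⟩
end
end Paper

namespace Paper
section
variable {V W : Type} {G H : SimpleGraph V} {s t : Set V} {v : V} {K : SimpleGraph W} {S : SimpleGraph V} {μ : W → Set V}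

theorem Mod.step [Finite V] (h : Mod K S μ) (hK : Sub3 K) {w : W} {r r' : V} (hr : r ∈ μ w) (hr' : r' ∈ μ w) (hrr : r ≠ r') :
    ∃ w', K.Adj w w' ∧ ∃ μ1 : Option W → Set V, Mod (subdivideEdge K w w') S μ1 ∧ ⋃ a, μ1 a = ⋃ a, μ a := by
  have hbig : ∀ x, ∃ y ∈ μ w, y ≠ x := fun x => by
    by_cases e : r = x
    · exact ⟨r', hr', fun e' => hrr (e.trans e'.symm)⟩
    · exact ⟨r, hr, e⟩
  obtain ⟨x, w', z, hx, hc, hww, hz, hxz, huniq⟩ : ∃ x w' z, x ∈ μ w ∧ Conn S (μ w \ {x}) ∧ w' ≠ w ∧ z ∈ μ w' ∧ S.Adj x z ∧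
      ∀ u, u ≠ w → ∀ b ∈ μ u, S.Adj x b → u = w' := by
    obtain ⟨x1, hx1, -, c1⟩ := (h.conn w).far hr (hbig r)
    obtain ⟨x2, hx2, hne, c2⟩ := (h.conn w).far hx1 (hbig x1)
    by_contra! hn
    obtain ⟨a, ha⟩ := hK w
    have key : ∀ x ∈ μ w, Conn S (μ w \ {x}) → ∃ i j, i ≠ j ∧ (∃ b ∈ μ (a i), a i ≠ w ∧ S.Adj x b) ∧ ∃ b ∈ μ (a j), a j ≠ w ∧ S.Adj x b := by
      intro x hx hc
      obtain ⟨w', hw', z, hz, hxz⟩ := h.rem hx hc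
      obtain ⟨u, hu, b, hb, hxb, huw⟩ := hn x w' z hx hc hw' hz hxz
      obtain ⟨i, rfl⟩ := ha w' (h.cross hx hz hw'.symm hxz).1
      obtain ⟨j, rfl⟩ := ha u (h.cross hx hb hu.symm hxb).1
      exact ⟨i, j, fun e => huw (by rw [e]), ⟨z, hz, hw', hxz⟩, b, hb, hu, hxb⟩
    have key2 : ∀ i, (∃ b ∈ μ (a i), a i ≠ w ∧ S.Adj x1 b) → ¬∃ b ∈ μ (a i), a i ≠ w ∧ S.Adj x2 b := by
      rintro i ⟨b, hb, hi, hxb⟩ ⟨b', hb', -, hxb'⟩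
      exact hne ((h.cross hx1 hb hi.symm hxb).2 x2 hx2 b' hb' hxb').1
    obtain ⟨i, j, hij, h1, h2⟩ := key x1 hx1 c1
    obtain ⟨k, l, hkl, h3, h4⟩ := key x2 hx2 c2
    have e1 : i ≠ k := fun e => key2 i h1 (e ▸ h3)
    have e2 : i ≠ l := fun e => key2 i h1 (e ▸ h4)
    have e3 : j ≠ k := fun e => key2 j h2 (e ▸ h3)
    have e4 : j ≠ l := fun e => key2 j h2 (e ▸ h4)
    clear key key2 h1 h2 h3 h4
    omega
  obtain ⟨hK1, hu1⟩ := h.cross hx hz hww.symm hxz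
  obtain ⟨y, hy, hxy⟩ := (h.conn w).nbr hx (hbig x)
  have hconn : ∀ u, Conn S (μ u \ {x}) := fun u => by
    by_cases hu : u = w
    · rwa [hu]
    · rw [h.sdiff hx hu]; exact h.conn u
  refine ⟨w', hK1, fun o => o.elim {x} fun u => μ u \ {x}, ⟨?_, ?_, ?_, fun S' hS' hm => h.min S' hS' (minor_unsub hK1 hm)⟩, ?_⟩
  · rintro (_ | u)
    exacts [Conn.single x, hconn u]
  · rintro (_ | u) (_ | u') hne
    · exact (hne rfl).elim
    · exact Set.disjoint_sdiff_right
    · exact Set.disjoint_sdiff_left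
    · exact (h.dis u u' fun e => hne (by rw [e])).mono Set.sdiff_subset Set.sdiff_subset
  · have hz' : z ∈ μ w' \ {x} := ⟨hz, hxz.ne'⟩
    have hy' : y ∈ μ w \ {x} := ⟨hy, hxy.ne'⟩
    intro a b hab
    rcases sub_adj.1 hab with ⟨u, u', rfl, rfl, h3, h4⟩ | ⟨rfl, rfl | rfl⟩ | ⟨rfl, rfl | rfl⟩
    · obtain ⟨p, hp, q, hq, hpq⟩ := h.adj u u' h3
      refine ⟨p, ⟨hp, ?_⟩, q, ⟨hq, ?_⟩, hpq⟩
      · rintro rfl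
        obtain rfl := h.bag hp hx
        exact h4 (Or.inl ⟨rfl, huniq u' h3.ne' q hq hpq⟩)
      · rintro rfl
        obtain rfl := h.bag hq hx
        exact h4 (Or.inr ⟨huniq u h3.ne p hp hpq.symm, rfl⟩)
    · exact ⟨x, rfl, y, hy', hxy⟩
    · exact ⟨x, rfl, z, hz', hxz⟩
    · exact ⟨y, hy', x, rfl, hxy.symm⟩
    · exact ⟨z, hz', x, rfl, hxz.symm⟩
  · ext a
    simp only [Set.mem_iUnion]
    constructor
    · rintro ⟨_ | u, hu⟩
      · exact ⟨w, (show a = x from hu) ▸ hx⟩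
      · exact ⟨u, hu.1⟩
    · rintro ⟨u, hu⟩
      by_cases e : a = x
      · exact ⟨none, e⟩
      · exact ⟨some u, hu, e⟩

theorem Mod.sub [Finite V] (n : ℕ) : ∀ (W : Type) [Finite W] (K : SimpleGraph W) (μ : W → Set V), Sub3 K → Mod K S μ →
    (⋃ w, μ w).ncard ≤ n + Nat.card W → IsSubdivision (S.induce (⋃ w, μ w)) K := by
  have card : ∀ (W : Type) (K : SimpleGraph W) (μ : W → Set V), Mod K S μ → Nat.card W ≤ (⋃ w, μ w).ncard := fun W K μ h => by
    choose f hf using fun w => (h.conn w).1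
    rw [← Nat.card_coe_set_eq]
    refine Nat.card_le_card_of_injective (fun w => (⟨f w, Set.mem_iUnion.2 ⟨w, hf w⟩⟩ : ↥(⋃ w, μ w))) fun w w' e => ?_
    have : f w = f w' := congrArg Subtype.val e
    exact h.bag (hf w) (this ▸ hf w')
  induction n with
  | zero =>
    intro W _ K μ hK h hn
    have hb : ∀ w, ∀ r ∈ μ w, ∀ r' ∈ μ w, r = r' := fun w r hr r' hr' => by
      by_contra hne
      obtain ⟨w', -, μ1, h1, e⟩ := h.step hK hr hr' hne
      have := card _ _ _ h1
      rw [e, Finite.card_option] at this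
      omega
    choose f hf using fun w => (h.conn w).1
    let φ : W → ↥(⋃ w, μ w) := fun w => ⟨f w, Set.mem_iUnion.2 ⟨w, hf w⟩⟩
    have hφ : Function.Bijective φ := by
      refine ⟨fun w w' e => ?_, fun ⟨x, hx⟩ => ?_⟩
      · have : f w = f w' := congrArg Subtype.val e
        exact h.bag (hf w) (this ▸ hf w')
      · obtain ⟨w, hw⟩ := Set.mem_iUnion.1 hx
        exact ⟨w, Subtype.ext (hb w _ (hf w) _ hw)⟩
    refine .base ⟨(⟨Equiv.ofBijective φ hφ, fun {w w'} => ?_⟩ : K ≃g S.induce (⋃ w, μ w)).symm⟩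
    show S.Adj (f w) (f w') ↔ K.Adj w w'
    constructor
    · intro hA
      refine (h.cross (hf w) (hf w') (fun e => hA.ne (by rw [e])) hA).1
    · intro hA
      obtain ⟨x, hx, y, hy, hxy⟩ := h.adj w w' hA
      rwa [hb w _ hx _ (hf w), hb w' _ hy _ (hf w')] at hxy
  | succ n ih =>
    intro W _ K μ hK h hn
    by_cases hb : ∀ w, ∀ r ∈ μ w, ∀ r' ∈ μ w, r = r'
    · refine ih W K μ hK h ?_
      choose f hf using fun w => (h.conn w).1
      have : (⋃ w, μ w) ⊆ Set.range f := fun x hx => by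
        obtain ⟨w, hw⟩ := Set.mem_iUnion.1 hx
        exact ⟨w, hb w _ (hf w) _ hw⟩
      have h1 := Set.ncard_le_ncard this
      have h2 : (Set.range f).ncard ≤ Nat.card W := by
        rw [← Set.image_univ, ← Set.ncard_univ]; exact Set.ncard_image_le
      omega
    · push Not at hb
      obtain ⟨w, r, hr, r', hr', hne⟩ := hb
      obtain ⟨w', hw', μ1, h1, e⟩ := h.step hK hr hr' hne
      refine .step w w' hw' ?_
      rw [← e]
      refine ih _ _ μ1 (hK.subdiv hw') h1 ?_
      rw [e, Finite.card_option]
      omega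

theorem IsSubdivision.restrict {α β : Type} {A : SimpleGraph α} {B : SimpleGraph β} (h : IsSubdivision A B) :
    ∀ {β' : Type} (B' : SimpleGraph β'), (B' ↪g B) → ∃ (α' : Type) (A' : SimpleGraph α'), IsSubdivision A' B' ∧ Nonempty (A' ↪g A) := by
  induction h with
  | base h =>
    intro β' B' e
    obtain ⟨f⟩ := h
    exact ⟨β', B', .base ⟨Iso.refl⟩, ⟨f.symm.toEmbedding.comp e⟩⟩
  | @step α A B u v huv _ ih =>
    intro β' B' e
    by_cases hu : ∃ u' v', e u' = u ∧ e v' = v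
    · obtain ⟨u', v', rfl, rfl⟩ := hu
      have e1 : subdivideEdge B' u' v' ↪g subdivideEdge B (e u') (e v') := by
        refine ⟨e.toEmbedding.optionMap, ?_⟩
        rintro (_ | a) (_ | b) <;> simp [sub_adj, e.map_adj_iff, e.injective.eq_iff]
      obtain ⟨α', A', h1, h2⟩ := ih _ e1
      exact ⟨α', A', .step u' v' (e.map_adj_iff.1 huv) h1, h2⟩
    · refine ih B' ⟨e.toEmbedding.trans Function.Embedding.some, ?_⟩
      intro a b
      have h1 : ¬((e a = u ∧ e b = v) ∨ (e a = v ∧ e b = u)) := by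
        rintro (⟨h1, h2⟩ | ⟨h1, h2⟩)
        exacts [hu ⟨_, _, h1, h2⟩, hu ⟨_, _, h2, h1⟩]
      have : (subdivideEdge B u v).Adj (some (e a)) (some (e b)) ↔ B.Adj (e a) (e b) := by
        rw [sub_adj]; simp only [Option.some.injEq, reduceCtorEq, false_and, or_false]
        exact ⟨by rintro ⟨x, y, rfl, rfl, h, _⟩; exact h, fun h => ⟨e a, e b, rfl, rfl, h, h1⟩⟩
      exact this.trans e.map_adj_iff
end
end Paper

namespace Paper
section
variable {V W : Type} {G H : SimpleGraph V} {s t : Set V} {v : V}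

theorem emb_induced {α : Type} {S : SimpleGraph α} (f : α → V) (hf : Function.Injective f)
    (h : ∀ a b, G.Adj (f a) (f b) ↔ S.Adj a b) : ContainsInduced G S :=
  ⟨Set.range f, ⟨⟨Equiv.ofInjective f hf, fun {a b} => h a b⟩⟩⟩

theorem claw (k : ℕ) (hk : 0 < k) : ∃ n, ∀ (V : Type) [Finite V] (G : SimpleGraph V), (∀ v, Clean G v) → (∀ x y z, ¬Tri G x y z) →
    HasBramble G n → ∃ (α : Type) (S : SimpleGraph α), IsSubdivision S (Wall k) ∧ ∃ e : S ↪g G, ∀ a, ∃ y, G.Adj (e a) y := by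
  obtain ⟨n, hn⟩ := grid (2 * k)
  refine ⟨n, fun V _ G hc ht hb => ?_⟩
  let C : Set (Fin (2 * k) × Fin (2 * (2 * k))) := {w | w.2.val + 1 < 4 * k}
  obtain ⟨S, hS, μ, hμ⟩ := ((hn V G hb).sub (K' := (Wall (2 * k)).induce C) Subtype.val Subtype.val_injective fun _ _ h => h).mod
  have h3 : Sub3 ((Wall (2 * k)).induce C) := by
    intro w
    classical
    obtain ⟨a, ha⟩ := sub3_wall (2 * k) w.1
    refine ⟨fun i => if h : a i ∈ C then ⟨a i, h⟩ else w, fun w' hw' => ?_⟩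
    obtain ⟨i, hi⟩ := ha w'.1 hw'
    refine ⟨i, ?_⟩
    have hm : a i ∈ C := hi ▸ w'.2
    beta_reduce
    rw [dif_pos hm]
    exact Subtype.ext hi
  have hK : ∀ w, ∃ w1 w2, w1 ≠ w2 ∧ ((Wall (2 * k)).induce C).Adj w w1 ∧ ((Wall (2 * k)).induce C).Adj w w2 := by
    rintro ⟨⟨⟨i, hi⟩, ⟨j, hj⟩⟩, hw⟩
    replace hw : j + 1 < 4 * k := hw
    have mk : ∀ i1 j1 i2 j2, (h1 : i1 < 2 * k ∧ j1 + 1 < 4 * k) → (h2 : i2 < 2 * k ∧ j2 + 1 < 4 * k) → (i1 ≠ i2 ∨ j1 ≠ j2) →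
        IW.Adj (i, j) (i1, j1) → IW.Adj (i, j) (i2, j2) → ∃ w1 w2, w1 ≠ w2 ∧ ((Wall (2 * k)).induce C).Adj ⟨⟨⟨i, hi⟩, ⟨j, hj⟩⟩, hw⟩ w1 ∧ ((Wall (2 * k)).induce C).Adj ⟨⟨⟨i, hi⟩, ⟨j, hj⟩⟩, hw⟩ w2 := by
      intro i1 j1 i2 j2 h1 h2 hne a1 a2
      refine ⟨⟨(⟨i1, h1.1⟩, ⟨j1, by omega⟩), h1.2⟩, ⟨(⟨i2, h2.1⟩, ⟨j2, by omega⟩), h2.2⟩, ?_, (wall_iw _ _).2 a1, (wall_iw _ _).2 a2⟩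
      intro e
      simp only [Subtype.mk.injEq, Prod.mk.injEq, Fin.mk.injEq] at e
      omega
    have e0 : ∀ i1 j1, IW.Adj (i, j) (i1, j1) ↔ ((i = i1 ∧ j + 1 = j1) ∨ (j = j1 ∧ i + 1 = i1 ∧ (i + j) % 2 = 0)) ∨ ((i1 = i ∧ j1 + 1 = j) ∨ (j1 = j ∧ i1 + 1 = i ∧ (i1 + j1) % 2 = 0)) := by
      intro i1 j1
      simp only [IW, SimpleGraph.fromRel_adj, ne_eq, Prod.mk.injEq]
      omega
    simp only [e0] at mk
    clear e0
    by_cases hj0 : j = 0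
    · by_cases hi2 : i % 2 = 0
      · exact mk i (j + 1) (i + 1) j (by omega) (by omega) (by omega) (by omega) (by omega)
      · exact mk i (j + 1) (i - 1) j (by omega) (by omega) (by omega) (by omega) (by omega)
    by_cases hj1 : j + 2 = 4 * k
    · by_cases hi2 : i % 2 = 0
      · exact mk i (j - 1) (i + 1) j (by omega) (by omega) (by omega) (by omega) (by omega)
      · exact mk i (j - 1) (i - 1) j (by omega) (by omega) (by omega) (by omega) (by omega)
    · exact mk i (j - 1) i (j + 1) (by omega) (by omega) (by omega) (by omega) (by omega)
  have hd : ∀ x ∈ ⋃ w, μ w, ∃ y z, y ≠ z ∧ S.Adj x y ∧ S.Adj x z := fun x hx => by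
    obtain ⟨w, hw⟩ := Set.mem_iUnion.1 hx
    exact hμ.deg2 hw (hK w)
  have hSG : ∀ x ∈ ⋃ w, μ w, ∀ y ∈ ⋃ w, μ w, G.Adj x y → S.Adj x y := by
    intro x hx y hy hxy
    by_contra hn
    obtain ⟨y1, y2, h12, k1, k2⟩ := hd x hx
    obtain ⟨z1, z2, l12, l1, l2⟩ := hd y hy
    refine l12 ((hc x y y1 y2 hxy (hS k1) (hS k2) (fun e => hn (e ▸ k1)) (fun e => hn (e ▸ k2)) h12).2.2
      (fun h => ht x y y1 ⟨hxy, h, hS k1⟩) (fun h => ht x y y2 ⟨hxy, h, hS k2⟩) z1 z2 (hS l1) (hS l2) ?_ ?_)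
    · rintro rfl; exact hn l1.symm
    · rintro rfl; exact hn l2.symm
  have hsub := hμ.sub (⋃ w, μ w).ncard _ _ _ h3 (Nat.le_add_right _ _)
  let e : Wall k ↪g (Wall (2 * k)).induce C :=
    { toFun := fun w => ⟨(⟨w.1.val, by omega⟩, ⟨w.2.val, by omega⟩), show w.2.val + 1 < 4 * k by omega⟩
      inj' := by
        rintro ⟨⟨a, _⟩, ⟨b, _⟩⟩ ⟨⟨c, _⟩, ⟨d, _⟩⟩ h
        simpa using h
      map_rel_iff' := by
        intro a b
        exact (wall_iw _ _).trans (wall_iw a b).symm }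
  obtain ⟨α, A, hA, ⟨f⟩⟩ := hsub.restrict (Wall k) e
  refine ⟨α, A, hA, ⟨⟨fun a => (f a).1, fun a b h => f.injective (Subtype.ext h)⟩, ?_⟩, fun a => ?_⟩
  · intro a b
    rw [← f.map_adj_iff]
    exact ⟨fun h => hSG _ (f a).2 _ (f b).2 h, fun h => hS h⟩
  · obtain ⟨y, z, -, h, -⟩ := hd _ (f a).2
    exact ⟨y, hS h⟩

end
end Paper

namespace Paper
section
variable {V W : Type} {G H : SimpleGraph V} {s t : Set V} {v : V}

def kap (G : SimpleGraph V) (v u : V) : Set V := {x | x = v ∨ x = u ∨ (G.Adj x v ∧ G.Adj x u)}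

theorem kap_symm (v u : V) : kap G v u = kap G u v := by
  ext x; simp only [kap, Set.mem_ofPred_eq]; tauto

theorem kap_tri (hc : ∀ v, Clean G v) {a b c : V} (h : Tri G a b c) : kap G a b = {a, b, c} := by
  ext x
  simp only [kap, Set.mem_ofPred_eq, Set.mem_insert_iff, Set.mem_singleton_iff]
  constructor
  · rintro (h1 | h1 | ⟨h1, h2⟩)
    · exact Or.inl h1
    · exact Or.inr (Or.inl h1)
    · exact Or.inr (tri_uniq (hc a) h (e := b) ⟨h1.symm, h2, h.1⟩)
  · rintro (h1 | h1 | rfl)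
    · exact Or.inl h1
    · exact Or.inr (Or.inl h1)
    · exact Or.inr (Or.inr ⟨h.2.2.symm, h.2.1.symm⟩)

def Good (G : SimpleGraph V) (C : Set V) : Prop := C.ncard ≤ 3 ∧ ∀ x ∈ C, ∀ y ∈ C, x ≠ y → G.Adj x y ∧ kap G x y = C

theorem Good.single (v : V) : Good G {v} :=
  ⟨by simp, fun x hx y hy h => (h (hx.trans hy.symm)).elim⟩

theorem pair_le (a b : V) : ({a, b} : Set V).ncard ≤ 2 :=
  (Set.ncard_insert_le _ _).trans (by simp)

theorem Good.tri (hc : ∀ v, Clean G v) {a b c : V} (h : Tri G a b c) : Good G {a, b, c} := by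
  refine ⟨(Set.ncard_insert_le _ _).trans (Nat.succ_le_succ (pair_le _ _)), ?_⟩
  obtain ⟨h1, h2, h3⟩ := h
  have e1 : ({b, c, a} : Set V) = {a, b, c} := by ext; simp; tauto
  have e2 : ({a, c, b} : Set V) = {a, b, c} := by ext; simp; tauto
  have k1 := kap_tri hc (a := a) (b := b) (c := c) ⟨h1, h2, h3⟩
  have k2 := (kap_tri hc (a := b) (b := c) (c := a) ⟨h2, h3.symm, h1.symm⟩).trans e1
  have k3 := (kap_tri hc (a := a) (b := c) (c := b) ⟨h3, h2.symm, h1⟩).trans e2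
  rintro x (rfl | rfl | rfl) y (rfl | rfl | rfl) hne
  · exact (hne rfl).elim
  · exact ⟨h1, k1⟩
  · exact ⟨h3, k3⟩
  · exact ⟨h1.symm, (kap_symm _ _).trans k1⟩
  · exact (hne rfl).elim
  · exact ⟨h2, k2⟩
  · exact ⟨h3.symm, (kap_symm _ _).trans k3⟩
  · exact ⟨h2.symm, (kap_symm _ _).trans k2⟩
  · exact (hne rfl).elim

theorem Good.kap (hc : ∀ v, Clean G v) {a b : V} (h : G.Adj a b) : Good G (kap G a b) := by
  by_cases ht : ∃ c, Tri G a b c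
  · obtain ⟨c, ht⟩ := ht
    rw [kap_tri hc ht]; exact Good.tri hc ht
  · have e : Paper.kap G a b = {a, b} := by
      ext x
      simp only [Paper.kap, Set.mem_ofPred_eq, Set.mem_insert_iff, Set.mem_singleton_iff]
      refine ⟨?_, by tauto⟩
      rintro (h1 | h1 | ⟨h1, h2⟩)
      · exact Or.inl h1
      · exact Or.inr h1
      · exact (ht ⟨x, h, h2.symm, h1.symm⟩).elim
    refine ⟨e ▸ (pair_le _ _).trans (by norm_num), ?_⟩
    intro x hx y hy hne
    rw [e] at hx hy
    obtain rfl | rfl := hx <;> obtain rfl | rfl := hy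
    · exact (hne rfl).elim
    · exact ⟨h, rfl⟩
    · exact ⟨h.symm, kap_symm _ _⟩
    · exact (hne rfl).elim

theorem cls (hc : ∀ v, Clean G v) (ht : ∀ x, Br G x → ∃ y z, Tri G x y z) (v : V) :
    ∃ c1 c2 : Set V, (Good G c1 ∧ Good G c2) ∧ (v ∈ c1 ∧ v ∈ c2) ∧ ∀ u, G.Adj v u → kap G v u = c1 ∨ kap G v u = c2 := by
  have mk : ∀ a, ∃ c, Good G c ∧ v ∈ c ∧ (G.Adj v a → kap G v a = c) := fun a => by
    by_cases h : G.Adj v a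
    · exact ⟨_, Good.kap hc h, Or.inl rfl, fun _ => rfl⟩
    · exact ⟨_, Good.single v, rfl, fun h' => (h h').elim⟩
  suffices ∃ a b, ∀ u, G.Adj v u → u = a ∨ u = b ∨ kap G v u = kap G v a ∧ G.Adj v a by
    obtain ⟨a, b, h⟩ := this
    obtain ⟨c1, g1, m1, e1⟩ := mk a
    obtain ⟨c2, g2, m2, e2⟩ := mk b
    refine ⟨c1, c2, ⟨g1, g2⟩, ⟨m1, m2⟩, fun u hu => ?_⟩
    obtain rfl | rfl | ⟨h1, h2⟩ := h u hu
    · exact Or.inl (e1 hu)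
    · exact Or.inr (e2 hu)
    · exact Or.inl (h1.trans (e1 h2))
  by_cases h : ∃ y z, Tri G v y z
  · obtain ⟨y, z, h1, h2, h3⟩ := h
    have hz : kap G v z = kap G v y := by
      rw [kap_tri hc ⟨h1, h2, h3⟩, kap_tri hc ⟨h3, h2.symm, h1⟩]
      ext; simp; tauto
    by_cases hb : ∃ b, G.Adj v b ∧ b ≠ y ∧ b ≠ z
    · obtain ⟨b, hb, by', bz⟩ := hb
      refine ⟨y, b, fun u hu => ?_⟩
      obtain rfl | rfl | rfl := (hc v y z b h1 h3 hb h2.ne by'.symm bz.symm).1 u hu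
      · exact Or.inl rfl
      · exact Or.inr (Or.inr ⟨hz, h1⟩)
      · exact Or.inr (Or.inl rfl)
    · refine ⟨y, y, fun u hu => ?_⟩
      by_cases e : u = y
      · exact Or.inl e
      by_cases e' : u = z
      · exact Or.inr (Or.inr ⟨e' ▸ hz, h1⟩)
      · exact (hb ⟨u, hu, e, e'⟩).elim
  · obtain ⟨a, b, hab⟩ := not_br_iff fun hb => h (ht v hb)
    exact ⟨a, b, fun u hu => (hab u hu).imp_right Or.inl⟩

def JG (c1 c2 : V → Set V) : SimpleGraph (Set V) := SimpleGraph.fromRel fun A B => ∃ v, A = c1 v ∧ B = c2 v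

theorem tri_case (k : ℕ) : ∃ n, ∀ (V : Type) [Finite V] (G : SimpleGraph V), (∀ v, Clean G v) → (∀ x, Br G x → ∃ y z, Tri G x y z) →
    HasBramble G n → ∃ (α : Type) (S : SimpleGraph α), IsSubdivision S (Wall k) ∧ ∃ e : S.lineGraph ↪g G, ∀ a, ∃ y, G.Adj (e a) y := by
  obtain ⟨n, hn⟩ := grid k
  refine ⟨3 * n, fun V _ G hc ht hb => ?_⟩
  choose c1 c2 hg hm hk using cls hc ht
  have F1 : ∀ u v, G.Adj u v → ∃ C, (C = c1 u ∨ C = c2 u) ∧ (C = c1 v ∨ C = c2 v) := fun u v h =>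
    ⟨kap G u v, hk u v h, kap_symm (G := G) u v ▸ hk v u h.symm⟩
  have gC : ∀ v C, (C = c1 v ∨ C = c2 v) → Good G C ∧ v ∈ C := by
    rintro v C (rfl | rfl)
    exacts [⟨(hg v).1, (hm v).1⟩, ⟨(hg v).2, (hm v).2⟩]
  have hJ : HasBramble (JG c1 c2) n := by
    obtain ⟨β, b1, b2⟩ := hb
    refine ⟨(fun b => {C | ∃ v ∈ b, C = c1 v ∨ C = c2 v}) '' β, ?_, fun X hX => ?_⟩
    · rintro _ ⟨b, hb, rfl⟩ _ ⟨b', hb', rfl⟩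
      have hcn := b1 b hb b' hb'
      have e : {C | ∃ v ∈ b, C = c1 v ∨ C = c2 v} ∪ {C | ∃ v ∈ b', C = c1 v ∨ C = c2 v} = {C | ∃ v ∈ b ∪ b', C = c1 v ∨ C = c2 v} := by
        ext C
        simp only [Set.mem_union, Set.mem_ofPred_eq, or_and_right, exists_or]
      beta_reduce
      rw [e]
      obtain ⟨v0, hv0⟩ := hcn.1
      refine ⟨⟨_, v0, hv0, Or.inl rfl⟩, fun t hts ⟨C0, hC0⟩ hcl => ?_⟩
      have sw : ∀ v ∈ b ∪ b', ∀ C D, (C = c1 v ∨ C = c2 v) → (D = c1 v ∨ D = c2 v) → C ∈ t → D ∈ t := by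
        intro v hv C D hC hD hCt
        by_cases e : C = D
        · exact e ▸ hCt
        · refine hcl C hCt D ⟨v, hv, hD⟩ ((SimpleGraph.fromRel_adj _ _ _).2 ⟨e, ?_⟩)
          rcases hC with rfl | rfl <;> rcases hD with rfl | rfl
          · exact (e rfl).elim
          · exact Or.inl ⟨v, rfl, rfl⟩
          · exact Or.inr ⟨v, rfl, rfl⟩
          · exact (e rfl).elim
      obtain ⟨v1, hv1, hC1⟩ := hts hC0
      have := hcn.2 {v | v ∈ b ∪ b' ∧ c1 v ∈ t} (fun v hv => hv.1) ⟨v1, hv1, sw v1 hv1 _ _ hC1 (Or.inl rfl) hC0⟩ (by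
        intro x hx y hy hxy
        obtain ⟨C, k1, k2⟩ := F1 x y hxy
        exact ⟨hy, sw y hy C _ k2 (Or.inl rfl) (sw x hx.1 _ C (Or.inl rfl) k1 hx.2)⟩)
      rintro C ⟨v, hv, hC⟩
      have hv2 : v ∈ {v | v ∈ b ∪ b' ∧ c1 v ∈ t} := this hv
      exact sw v hv _ C (Or.inl rfl) hC hv2.2
    · classical
      have hcard : (⋃ C ∈ (Set.toFinite X).toFinset, {x | x ∈ C ∧ Good G C}).ncard ≤ 3 * X.ncard := by
        rw [mul_comm, Set.ncard_eq_toFinset_card X (Set.toFinite X)]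
        refine (Finset.set_ncard_biUnion_le _ _).trans (Finset.sum_le_card_nsmul _ _ _ fun C _ => ?_)
        by_cases h : Good G C
        · exact (Set.ncard_le_ncard (fun x hx => hx.1) (Set.toFinite _)).trans h.1
        · have : {x | x ∈ C ∧ Good G C} = ∅ := by ext; simp [h]
          rw [this]; simp
      obtain ⟨b, hb, hbX⟩ := b2 _ (hcard.trans_lt (by omega : 3 * X.ncard < 3 * n))
      refine ⟨_, ⟨b, hb, rfl⟩, Set.disjoint_left.2 ?_⟩
      rintro C ⟨v, hv, hC⟩ hCX
      refine Set.disjoint_left.1 hbX hv ?_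
      simp only [Set.mem_iUnion]
      exact ⟨C, (Set.toFinite X).mem_toFinset.2 hCX, (gC v C hC).2, (gC v C hC).1⟩
  obtain ⟨S, hS, μ, hμ⟩ := (hn _ _ hJ).mod
  have hsub := hμ.sub (⋃ w, μ w).ncard _ _ _ (sub3_wall k) (Nat.le_add_right _ _)
  have hv : ∀ e : (S.induce (⋃ w, μ w)).edgeSet, ∃ v, c1 v ≠ c2 v ∧ ∀ A, A ∈ e.1 ↔ (A.1 = c1 v ∨ A.1 = c2 v) := by
    rintro ⟨e, he⟩
    induction e with
    | _ A B =>
      have h : S.Adj A.1 B.1 := he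
      obtain ⟨hne, h1⟩ := (SimpleGraph.fromRel_adj _ _ _).1 (hS h)
      have : ∃ v, (A.1 = c1 v ∧ B.1 = c2 v) ∨ (A.1 = c2 v ∧ B.1 = c1 v) := by
        rcases h1 with ⟨v, a, b⟩ | ⟨v, a, b⟩
        exacts [⟨v, Or.inl ⟨a, b⟩⟩, ⟨v, Or.inr ⟨b, a⟩⟩]
      obtain ⟨v, hv⟩ := this
      refine ⟨v, ?_, fun D => ?_⟩
      · rcases hv with ⟨a, b⟩ | ⟨a, b⟩
        · rwa [← a, ← b]
        · rw [← a, ← b]; exact hne.symm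
      · rw [Sym2.mem_iff, Subtype.ext_iff, Subtype.ext_iff]
        rcases hv with ⟨a, b⟩ | ⟨a, b⟩
        · rw [a, b]
        · rw [a, b]; exact Or.comm
  have hv2 : ∀ (e : (S.induce (⋃ w, μ w)).edgeSet) v, (∀ A, A ∈ e.1 ↔ (A.1 = c1 v ∨ A.1 = c2 v)) → c1 v ≠ c2 v → ∀ C, (C = c1 v ∨ C = c2 v) → ∃ A ∈ e.1, A.1 = C := by
    rintro ⟨e, he⟩ v hA hne C hC
    induction e with
    | _ A B =>
      have h : S.Adj A.1 B.1 := he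
      have h1 := ((hA A).1 (Sym2.mem_mk_left _ _))
      have h2 := ((hA B).1 (Sym2.mem_mk_right _ _))
      have h3 := h.ne
      by_cases e : A.1 = C
      · exact ⟨A, Sym2.mem_mk_left _ _, e⟩
      · refine ⟨B, Sym2.mem_mk_right _ _, ?_⟩
        grind
  choose f hf1 hf2 using hv
  have hinj : Function.Injective f := fun e e' h => by
    refine Subtype.ext (Sym2.ext fun A => ?_)
    rw [hf2, hf2, h]
  refine ⟨_, _, hsub, ⟨⟨f, hinj⟩, ?_⟩, fun e => ?_⟩
  · intro e e'
    rw [SimpleGraph.lineGraph_adj_iff_exists]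
    constructor
    · intro h
      refine ⟨fun e => h.ne (by rw [e]), ?_⟩
      obtain ⟨C, k1, k2⟩ := F1 _ _ h
      obtain ⟨A, hA, rfl⟩ := hv2 e _ (hf2 e) (hf1 e) C k1
      exact ⟨A, hA, (hf2 e' A).2 k2⟩
    · rintro ⟨hne, A, h1, h2⟩
      obtain ⟨g, m⟩ := gC _ _ ((hf2 e A).1 h1)
      exact (g.2 _ m _ (gC _ _ ((hf2 e' A).1 h2)).2 fun h => hne (hinj h)).1
  · by_contra! hno
    refine hf1 e ?_
    have : ∀ C, (C = c1 (f e) ∨ C = c2 (f e)) → C = {f e} := fun C hC => by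
      obtain ⟨g, m⟩ := gC _ _ hC
      refine Set.eq_singleton_iff_unique_mem.2 ⟨m, fun x hx => ?_⟩
      by_contra hne
      exact hno x (g.2 _ m _ hx (Ne.symm hne)).1
    rw [this _ (Or.inl rfl), ← this _ (Or.inr rfl)]

end
end Paper

namespace Paper
section
variable {V W : Type} {G H : SimpleGraph V} {s t : Set V} {v : V}

theorem emb_res {α : Type} {S : SimpleGraph α} {U : Set V} (e : S ↪g res G U) (h : ∀ a, ∃ y, (res G U).Adj (e a) y) : ContainsInduced G S := by
  refine emb_induced e e.injective fun a b => ?_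
  obtain ⟨_, ha⟩ := h a
  obtain ⟨_, hb⟩ := h b
  exact ⟨fun hab => e.map_adj_iff.1 ⟨hab, ha.2.1, hb.2.1⟩, fun hab => (e.map_adj_iff.2 hab).1⟩

end
/-- Theorem `smalldensecomps`. -/
theorem statement17 (k γ : ℕ) (hk : 0 < k) (hγ : 0 < γ) :
    ∃ w : ℕ, ∀ (V : Type) [Fintype V] (G : SimpleGraph V),
      (∀ v : V, 3 ≤ deg G v → (G.neighborSet v ∩ {u | 3 ≤ deg G u}).ncard ≤ γ) →
      ¬HasTreewidthAtMost G w →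
        ContainsWallSubdiv G k ∨ ContainsLineWallSubdiv G k := by
  obtain ⟨n1, h1⟩ := claw k hk
  obtain ⟨n2, h2⟩ := tri_case k
  obtain ⟨nC, hC⟩ := stageC (max n1 n2)
  obtain ⟨nB, hB⟩ := stageB nC (γ + 9)
  obtain ⟨nA, hA⟩ := stageA (nB + 1) γ (Nat.succ_pos _)
  refine ⟨3 * nA, fun V _ G hG hw => ?_⟩
  obtain ⟨U1, b1, d1⟩ := hA V G hG (tw_bramble hw)
  obtain ⟨U2, b2, d2⟩ := hB V _ d1 (b1.mono (Nat.le_succ _))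
  obtain ⟨U3, b3, d3⟩ := hC V _ d2 b2
  have d4 := fun v => (d2 v).res U3
  rw [res_res, res_res] at b3 d3 d4
  rcases d3 with d3 | d3
  · obtain ⟨α, S, hS, e, he⟩ := h1 V _ d4 d3 (b3.mono (le_max_left _ _))
    exact Or.inl ⟨α, S, hS, emb_res e he⟩
  · obtain ⟨α, S, hS, e, he⟩ := h2 V _ d4 d3 (b3.mono (le_max_right _ _))
    exact Or.inr ⟨α, S, hS, emb_res e he⟩

end Paper
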